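/- There exists a constant C, depending only on V_F, V_E, g_L, g_in, a and σ_E (but not on q), with the following property: for every classical stationary solution p of the voltage–conductance equation with p > 0 on (0,V_F)×[0,∞), and every q ≥ 4/3 such that d_q := ∫_Ω (g + g_L)²·p(v,g)^q dv dg < ∞ and such that p^q, g²·p^q and ∂_g(p^q) decay to 0 as g → ∞ uniformly in v, one has sup_{0 < v < V_F} ∫_0^∞ J(v,g)²·p(v,g)^q dg ≤ C·q·d_q. -/

import Mathlib

open Real MeasureTheory Set Filter

noncomputable section

/-- The voltage flux `J(v,g) = -g_L v + g (V_E - v)`. -/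
def Jflux (VE gL v g : ℝ) : ℝ := -gL * v + g * (VE - v)

/-- The Maxwellian `M(g) = exp(-(g - g_in)^2 / (2a))`. -/
def Mw (gin a g : ℝ) : ℝ := Real.exp (-(g - gin) ^ 2 / (2 * a))

/-- A classical stationary solution of the voltage-conductance equation:
`p : (0,V_F) × [0,∞) → [0,∞)`, C¹ in `v` (with continuous boundary extension) and
C² in `g` up to `g = 0`, satisfying the stationary equation, the no-flux boundary
condition at `g = 0`, the `v`-boundary conditions changing type at `g_F = g_L V_F/(V_E - V_F)`,
the normalization, and decay (uniform in `v`) of `p`, `g² p`, `∂_g p` as `g → ∞`. -/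
structure StatSol (VF VE gL gin a σE : ℝ) (p : ℝ → ℝ → ℝ) : Prop where
  nonneg : ∀ v ∈ Ioo 0 VF, ∀ g ∈ Ici (0:ℝ), 0 ≤ p v g
  cont_v : ∀ g ∈ Ici (0:ℝ), ContinuousOn (fun v => p v g) (Icc 0 VF)
  diff_v : ∀ v ∈ Ioo 0 VF, ∀ g ∈ Ioi (0:ℝ), DifferentiableAt ℝ (fun v' => p v' g) v
  smooth_g : ∀ v ∈ Ioo 0 VF, ContDiffOn ℝ 2 (fun g => p v g) (Ici 0)
  pde : ∀ v ∈ Ioo 0 VF, ∀ g ∈ Ioi (0:ℝ),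
    deriv (fun v' => Jflux VE gL v' g * p v' g) v
      + deriv (fun g' => ((gin - g') / σE) * p v g') g
      - (a / σE) * deriv (deriv (fun g' => p v g')) g = 0
  bc_g : ∀ v ∈ Ioo 0 VF, (0 - gin) * p v 0 + a * deriv (fun g' => p v g') 0 = 0
  bc_v_low : ∀ g ∈ Ioo 0 (gL * VF / (VE - VF)),
    Jflux VE gL 0 g * p 0 g = 0 ∧ Jflux VE gL VF g * p VF g = 0
  bc_v_high : ∀ g ∈ Ici (gL * VF / (VE - VF)),
    Jflux VE gL 0 g * p 0 g = Jflux VE gL VF g * p VF g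
  normalized : ∫ v in Ioo 0 VF, ∫ g in Ioi (0:ℝ), p v g = 1
  decay : ∀ ε > 0, ∃ G : ℝ, ∀ g ∈ Ici G, ∀ v ∈ Ioo 0 VF,
    p v g < ε ∧ g ^ 2 * p v g < ε ∧ |deriv (fun g' => p v g') g| < ε

/-- Step lemma along a closed set. -/
lemma step_lemma {Z : Set ℝ} (hZ : IsClosed Z) {F : ℝ → ℝ} (hF : Continuous F) {v w L : ℝ}
    (hv : v ∈ Z) (hvw : v ≤ w)
    (h : ∀ s ∈ Z, v ≤ s → s < w → ∃ t ∈ Z, s < t ∧ t ≤ w ∧ F s - L * (t - s) ≤ F t) :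
    F v - L * (w - v) ≤ F w := by
  set S : Set ℝ := {s | s ∈ Z ∧ v ≤ s ∧ s ≤ w ∧ F v - L * (s - v) ≤ F s} with hS
  have hcl : IsClosed S := by
    have h1 : IsClosed {s : ℝ | v ≤ s} := isClosed_Ici
    have h2 : IsClosed {s : ℝ | s ≤ w} := isClosed_Iic
    have h3 : IsClosed {s : ℝ | F v - L * (s - v) ≤ F s} :=
      isClosed_le (by fun_prop) hF
    exact hZ.inter (h1.inter (h2.inter h3))
  have hne : S.Nonempty := ⟨v, hv, le_rfl, hvw, by simp⟩
  have hbd : BddAbove S := ⟨w, fun s hs => hs.2.2.1⟩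
  have hm := hcl.csSup_mem hne hbd
  set s := sSup S
  obtain ⟨hsZ, hvs, hsw, hFs⟩ := hm
  rcases hsw.lt_or_eq with hlt | heq
  · obtain ⟨t, htZ, hst, htw, hFt⟩ := h s hsZ hvs hlt
    have : t ∈ S := ⟨htZ, by linarith, htw, by nlinarith⟩
    have := le_csSup hbd this
    linarith
  · rw [← heq]; exact hFs

/-- Gronwall in integral form. -/
lemma gronwall_zero {Y : ℝ → ℝ} (hY : Continuous Y) {c d K : ℝ} (hK : 0 ≤ K)
    (h0 : ∀ v, c ≤ v → v < d → 0 ≤ Y v)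
    (h : ∀ v, c ≤ v → v < d → Y v ≤ K * ∫ t in c..v, Y t) :
    ∀ v, c ≤ v → v < d → Y v = 0 := by
  intro v hcv hvd
  set F : ℝ → ℝ := fun v => ∫ t in c..v, Y t with hF
  have hd : ∀ x, HasDerivAt F (Y x) x := fun x =>
    intervalIntegral.integral_hasDerivAt_right (hY.intervalIntegrable _ _)
      (hY.stronglyMeasurableAtFilter _ _) hY.continuousAt
  have hd2 : ∀ x, HasDerivAt (fun x => F x * Real.exp (-K * x))
      (Y x * Real.exp (-K*x) + F x * (Real.exp (-K*x) * -K)) x := by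
    intro x
    have h1 : HasDerivAt (fun x => -K * x) (-K) x := by
      simpa using (hasDerivAt_id x).const_mul (-K)
    exact (hd x).mul h1.exp
  have hanti : AntitoneOn (fun x => F x * Real.exp (-K * x)) (Icc c v) := by
    apply antitoneOn_of_hasDerivWithinAt_nonpos (convex_Icc c v)
      (f' := fun x => (Y x * Real.exp (-K*x) + F x * (Real.exp (-K*x) * -K)))
    · exact fun x _ => (hd2 x).continuousAt.continuousWithinAt
    · exact fun x _ => (hd2 x).hasDerivWithinAt
    · intro x hx
      rw [interior_Icc] at hx
      have := h x hx.1.le (hx.2.trans hvd)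
      have he := Real.exp_pos (-K*x)
      have : (Y x - K * F x) * Real.exp (-K*x) ≤ 0 :=
        mul_nonpos_of_nonpos_of_nonneg (by simp only [hF]; linarith) he.le
      linarith
  have h1 := hanti (left_mem_Icc.2 hcv) (right_mem_Icc.2 hcv) hcv
  have hFc : F c = 0 := by simp [hF]
  simp only [hFc, zero_mul] at h1
  have h2 : F v ≤ 0 := by
    by_contra hh
    push Not at hh
    have := mul_pos hh (Real.exp_pos (-K * v))
    linarith
  have h3 := h v hcv hvd
  have h4 := h0 v hcv hvd
  have : K * F v ≤ 0 := mul_nonpos_of_nonneg_of_nonpos hK h2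
  exact le_antisymm (by simp only [hF] at this; linarith) h4

lemma exp_neg_le_pow5 {x : ℝ} (hx : 0 < x) : Real.exp (-x) ≤ 120 / x ^ 5 := by
  have h := Real.pow_div_factorial_le_exp x hx.le 5
  have h2 : (Nat.factorial 5 : ℝ) = 120 := by norm_num [Nat.factorial]
  rw [h2] at h
  rw [Real.exp_neg, inv_eq_one_div, div_le_div_iff₀ (Real.exp_pos x) (by positivity)]
  rw [div_le_iff₀ (by norm_num)] at h
  linarith

/-- one-sided/two-sided mean value bound on an interval with interior derivatives -/
lemma mv_bound {f f' : ℝ → ℝ} {x y K : ℝ} (hxy : x ≤ y) (hc : ContinuousOn f (Icc x y))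
    (hd : ∀ z ∈ Ioo x y, HasDerivAt f (f' z) z) (hb : ∀ z ∈ Ioo x y, f' z ≤ K) :
    f y - f x ≤ K * (y - x) := by
  rcases hxy.eq_or_lt with rfl | hlt
  · simp
  obtain ⟨c, hc1, hc2⟩ := exists_hasDerivAt_eq_slope f f' hlt hc hd
  have := hb c hc1
  rw [hc2, div_le_iff₀ (by linarith)] at this
  exact this

lemma mv_bound_below {f f' : ℝ → ℝ} {x y K : ℝ} (hxy : x ≤ y) (hc : ContinuousOn f (Icc x y))
    (hd : ∀ z ∈ Ioo x y, HasDerivAt f (f' z) z) (hb : ∀ z ∈ Ioo x y, K ≤ f' z) :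
    K * (y - x) ≤ f y - f x := by
  have := mv_bound (f := fun z => - f z) (f' := fun z => - f' z) (K := -K) hxy hc.neg
    (fun z hz => (hd z hz).neg) (fun z hz => by linarith [hb z hz])
  linarith

/-- Second order Taylor lower bound with interior derivatives. -/
lemma taylor2_below {f f1 f2 : ℝ → ℝ} {A B n : ℝ}
    (hc : ContinuousOn f (Icc A B)) (hc1 : ContinuousOn f1 (Icc A B))
    (hd : ∀ z ∈ Ioo A B, HasDerivAt f (f1 z) z)
    (hd1 : ∀ z ∈ Ioo A B, HasDerivAt f1 (f2 z) z)
    (hb : ∀ z ∈ Ioo A B, -n ≤ f2 z) {x y : ℝ} (hx : x ∈ Icc A B) (hy : y ∈ Icc A B) :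
    f x + f1 x * (y - x) - n / 2 * (y - x) ^ 2 ≤ f y := by
  -- h(z) = f z + n/2 (z-x)^2 has nondecreasing derivative
  rcases le_total x y with hxy | hxy
  · have key := mv_bound_below (f := fun z => f z - f1 x * (z - x) + n / 2 * (z - x)^2)
      (f' := fun z => f1 z - f1 x + n * (z - x)) (K := 0) hxy
      (by
        have : ContinuousOn f (Icc x y) := hc.mono (Icc_subset_Icc hx.1 hy.2)
        fun_prop)
      (by
        intro z hz
        have h1 := hd z ⟨by linarith [hx.1, hz.1], by linarith [hy.2, hz.2]⟩
        have h2 : HasDerivAt (fun z => z - x) 1 z := (hasDerivAt_id z).sub_const x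
        have h3 := ((h1.sub (h2.const_mul (f1 x))).add ((h2.pow 2).const_mul (n/2)))
        refine HasDerivAt.congr_deriv h3 ?_; norm_num; ring)
      (by
        intro z hz
        have := mv_bound_below (f := f1) (f' := f2) (K := -n) (x := x) (y := z) hz.1.le
          (hc1.mono (Icc_subset_Icc hx.1 (by linarith [hy.2, hz.2])))
          (fun t ht => hd1 t ⟨by linarith [hx.1, ht.1], by linarith [hy.2, hz.2, ht.2]⟩)
          (fun t ht => hb t ⟨by linarith [hx.1, ht.1], by linarith [hy.2, hz.2, ht.2]⟩)
        linarith)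
    simp only [sub_self, mul_zero] at key
    nlinarith
  · have key := mv_bound (f := fun z => f z - f1 x * (z - x) + n / 2 * (z - x)^2)
      (f' := fun z => f1 z - f1 x + n * (z - x)) (K := 0) hxy
      (by
        have : ContinuousOn f (Icc y x) := hc.mono (Icc_subset_Icc hy.1 hx.2)
        fun_prop)
      (by
        intro z hz
        have h1 := hd z ⟨by linarith [hy.1, hz.1], by linarith [hx.2, hz.2]⟩
        have h2 : HasDerivAt (fun z => z - x) 1 z := (hasDerivAt_id z).sub_const x
        have h3 := ((h1.sub (h2.const_mul (f1 x))).add ((h2.pow 2).const_mul (n/2)))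
        refine HasDerivAt.congr_deriv h3 ?_; norm_num; ring)
      (by
        intro z hz
        have := mv_bound_below (f := f1) (f' := f2) (K := -n) (x := z) (y := x) hz.2.le
          (hc1.mono (Icc_subset_Icc (by linarith [hy.1, hz.1]) hx.2))
          (fun t ht => hd1 t ⟨by linarith [hy.1, hz.1, ht.1], by linarith [hx.2, ht.2]⟩)
          (fun t ht => hb t ⟨by linarith [hy.1, hz.1, ht.1], by linarith [hx.2, ht.2]⟩)
        linarith)
    simp only [sub_self, mul_zero] at key
    nlinarith

lemma taylor2_above {f f1 f2 : ℝ → ℝ} {A B n : ℝ}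
    (hc : ContinuousOn f (Icc A B)) (hc1 : ContinuousOn f1 (Icc A B))
    (hd : ∀ z ∈ Ioo A B, HasDerivAt f (f1 z) z)
    (hd1 : ∀ z ∈ Ioo A B, HasDerivAt f1 (f2 z) z)
    (hb : ∀ z ∈ Ioo A B, f2 z ≤ n) {x y : ℝ} (hx : x ∈ Icc A B) (hy : y ∈ Icc A B) :
    f y ≤ f x + f1 x * (y - x) + n / 2 * (y - x) ^ 2 := by
  have := taylor2_below (f := fun z => - f z) (f1 := fun z => - f1 z) (f2 := fun z => - f2 z)
    (n := n) hc.neg hc1.neg (fun z hz => (hd z hz).neg) (fun z hz => (hd1 z hz).neg)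
    (fun z hz => by linarith [hb z hz]) hx hy
  linarith

/-- Odd interpolation. -/
lemma odd_interp {E E1 E2 : ℝ → ℝ} {γ j K X : ℝ} (hj : 0 < j) (hX : 0 ≤ X)
    (hc : ContinuousOn E (Icc (γ - j) (γ + j))) (hc1 : ContinuousOn E1 (Icc (γ - j) (γ + j)))
    (hd : ∀ z ∈ Ioo (γ - j) (γ + j), HasDerivAt E (E1 z) z)
    (hd1 : ∀ z ∈ Ioo (γ - j) (γ + j), HasDerivAt E1 (E2 z) z)
    (hb : ∀ z ∈ Ioo (γ - j) (γ + j), |E2 z| ≤ K)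
    (hX1 : E (γ + j) ≤ X) (hX2 : -X ≤ E (γ - j)) :
    ∫ g in (γ - j)..(γ + j), (g - γ) * E g ≤ 2 * X * j ^ 2 + 4 * K * j ^ 4 := by
  have hK : 0 ≤ K := (abs_nonneg _).trans (hb γ ⟨by linarith, by linarith⟩)
  have hγ : γ ∈ Icc (γ - j) (γ + j) := ⟨by linarith, by linarith⟩
  have hlo := fun y hy => taylor2_below hc hc1 hd hd1
    (fun z hz => neg_le_of_abs_le (hb z hz)) hγ (y := y) hy
  have hhi := fun y hy => taylor2_above hc hc1 hd hd1
    (fun z hz => le_of_abs_le (hb z hz)) hγ (y := y) hy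
  have h1 := hlo (γ + j) ⟨by linarith, by linarith⟩
  have h2 := hhi (γ - j) ⟨by linarith, by linarith⟩
  have hE1 : E1 γ * j ≤ X + K * j^2 := by nlinarith
  have hle : ∀ y ∈ Icc (γ - j) (γ + j),
      (y - γ) * E y ≤ E γ * (y - γ) + E1 γ * (y-γ)^2 + K * j^3 := by
    intro y hy
    have a1 := hlo y hy
    have a2 := hhi y hy
    have hy1 : |y - γ| ≤ j := abs_le.2 ⟨by linarith [hy.1], by linarith [hy.2]⟩
    have hrem : |E y - E γ - E1 γ * (y - γ)| ≤ K / 2 * (y-γ)^2 :=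
      abs_le.2 ⟨by linarith, by linarith⟩
    have h5 : (y - γ) * (E y - E γ - E1 γ * (y - γ)) ≤ K * j^3 := by
      calc _ ≤ |(y - γ) * (E y - E γ - E1 γ * (y - γ))| := le_abs_self _
        _ = |y-γ| * |(E y - E γ - E1 γ * (y - γ))| := abs_mul _ _
        _ ≤ j * (K/2 * j^2) := by
            refine mul_le_mul hy1 (hrem.trans ?_) (abs_nonneg _) hj.le
            have : (y-γ)^2 ≤ j^2 := sq_le_sq' (by linarith [hy.1]) (by linarith [hy.2])
            nlinarith
        _ ≤ K * j^3 := by nlinarith [mul_nonneg hK (pow_pos hj 3).le]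
    nlinarith
  have hint : ∫ y in (γ - j)..(γ + j), (E γ * (y - γ) + E1 γ * (y-γ)^2 + K * j^3)
      = E1 γ * (2/3 * j^3) + 2 * K * j^4 := by
    have hder : ∀ y ∈ uIcc (γ-j) (γ+j), HasDerivAt
      (fun y => E γ * (y-γ)^2/2 + E1 γ * (y-γ)^3/3 + K*j^3*(y-γ))
      (E γ * (y - γ) + E1 γ * (y-γ)^2 + K * j^3) y := by
      intro y _
      have h2 : HasDerivAt (fun z => z - γ) 1 y := (hasDerivAt_id y).sub_const γ
      have := ((((h2.pow 2).const_mul (E γ)).div_const 2).add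
        (((h2.pow 3).const_mul (E1 γ)).div_const 3)).add (h2.const_mul (K*j^3))
      refine HasDerivAt.congr_deriv this ?_; norm_num; ring
    rw [intervalIntegral.integral_eq_sub_of_hasDerivAt hder
      (Continuous.intervalIntegrable (by fun_prop) _ _)]
    ring
  have hmono : ∫ g in (γ - j)..(γ + j), (g - γ) * E g ≤
      ∫ y in (γ - j)..(γ + j), (E γ * (y - γ) + E1 γ * (y-γ)^2 + K * j^3) := by
    apply intervalIntegral.integral_mono_on (by linarith)
    · apply ContinuousOn.intervalIntegrable
      rw [uIcc_of_le (by linarith)]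
      fun_prop
    · exact Continuous.intervalIntegrable (by fun_prop) _ _
    · exact hle
  rw [hint] at hmono
  have : E1 γ * (2/3*j^3) ≤ 2/3 * (X + K*j^2) * j^2 := by
    have := mul_le_mul_of_nonneg_right hE1 (by positivity : 0 ≤ 2/3*j^2)
    nlinarith
  nlinarith [mul_nonneg hX (sq_nonneg j), mul_nonneg hK (pow_pos hj 4).le]

/-- Robin boundary lemma. -/
lemma robin_bound {e e1 e2 : ℝ → ℝ} {x0 n X k : ℝ} (hx0 : 0 < x0) (hk : 0 ≤ k) (hn : 0 ≤ n)
    (hX : 0 ≤ X)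
    (hc : ContinuousOn e (Icc 0 x0)) (hc1 : ContinuousOn e1 (Icc 0 x0))
    (hd : ∀ z ∈ Ioo 0 x0, HasDerivAt e (e1 z) z)
    (hd1 : ∀ z ∈ Ioo 0 x0, HasDerivAt e1 (e2 z) z)
    (hb : ∀ z ∈ Ioo 0 x0, |e2 z| ≤ n)
    (hr : e1 0 = k * e 0) (hX1 : e x0 ≤ X) :
    ∀ g ∈ Icc 0 x0, e g ≤ X + n * x0 ^ 2 := by
  intro g hg
  have h0 : (0:ℝ) ∈ Icc 0 x0 := ⟨le_rfl, hx0.le⟩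
  have hg2 : g^2 ≤ x0^2 := by nlinarith [hg.1, hg.2]
  rcases le_total 0 (e 0) with h | h
  · have h1 : e1 0 ≥ 0 := by rw [hr]; positivity
    have hlow : ∀ z ∈ Icc 0 x0, -n * x0 ≤ e1 z := by
      intro z hz
      have := mv_bound_below (f := e1) (f' := e2) (K := -n) (x := 0) (y := z) hz.1
        (hc1.mono (Icc_subset_Icc le_rfl hz.2))
        (fun t ht => hd1 t ⟨ht.1, ht.2.trans_le hz.2⟩)
        (fun t ht => neg_le_of_abs_le (hb t ⟨ht.1, ht.2.trans_le hz.2⟩))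
      nlinarith [hz.1, hz.2]
    have := mv_bound_below (f := e) (f' := e1) (K := -n*x0) (x := g) (y := x0) hg.2
        (hc.mono (Icc_subset_Icc hg.1 le_rfl))
        (fun t ht => hd t ⟨hg.1.trans_lt ht.1, ht.2⟩)
        (fun t ht => hlow t ⟨hg.1.trans ht.1.le, ht.2.le⟩)
    nlinarith [mul_nonneg (mul_nonneg hn hx0.le) hg.1]
  · have := taylor2_above hc hc1 hd hd1 (fun z hz => le_of_abs_le (hb z hz)) h0 hg
    have h1 : e1 0 ≤ 0 := by rw [hr]; exact mul_nonpos_of_nonneg_of_nonpos hk h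
    nlinarith [mul_nonneg hn (sq_nonneg g), mul_nonpos_of_nonpos_of_nonneg h1 hg.1]

/-- Parameters. -/
structure Par where
  V : ℝ
  k1 : ℝ
  k0 : ℝ
  gL : ℝ
  gin : ℝ
  a : ℝ
  σ : ℝ
  hV : 0 < V
  hgL : 0 < gL
  hgin : 0 < gin
  ha : 0 < a
  hσ : 0 < σ

/-- flux -/
def Par.J (P : Par) (v g : ℝ) : ℝ := P.k1 * g + P.k0 - (g + P.gL) * v

/-- The operator `𝓛`. -/
def Par.Lop (P : Par) (f f1 f2 g : ℝ) : ℝ := 1 / P.σ * (f + (g - P.gin) * f1 + P.a * f2)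

/-- Separately regular solutions. -/
structure Sol (P : Par) (p p1 p2 : ℝ → ℝ → ℝ) : Prop where
  nonneg : ∀ v g, 0 ≤ p v g
  contv : ∀ g, Continuous fun v => p v g
  meas : Measurable fun x : ℝ × ℝ => p x.1 x.2
  c0 : ∀ v ∈ Ioo 0 P.V, Continuous (p v)
  c1 : ∀ v ∈ Ioo 0 P.V, Continuous (p1 v)
  c2 : ∀ v ∈ Ioo 0 P.V, Continuous (p2 v)
  d1 : ∀ v ∈ Ioo 0 P.V, ∀ g, 0 < g → HasDerivAt (p v) (p1 v g) g
  d2 : ∀ v ∈ Ioo 0 P.V, ∀ g, 0 < g → HasDerivAt (p1 v) (p2 v g) g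
  robin : ∀ v ∈ Ioo 0 P.V, P.a * p1 v 0 = P.gin * p v 0
  pde : ∀ v ∈ Ioo 0 P.V, ∀ g, 0 < g → ∃ d, HasDerivAt (fun t => p t g) d v ∧
    P.J v g * d = P.Lop (p v g) (p1 v g) (p2 v g) g + (P.gL + g) * p v g

/-- Test functions in `g`. -/
structure Tst (G : ℝ) where
  f : ℝ → ℝ
  f1 : ℝ → ℝ
  f2 : ℝ → ℝ
  nonneg : ∀ g, 0 ≤ f g
  d1 : ∀ g, HasDerivAt f (f1 g) g
  d2 : ∀ g, HasDerivAt f1 (f2 g) g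
  c2 : Continuous f2
  supp : ∃ ρ > 0, ∀ g, G - ρ ≤ g → f g = 0

/-- Convex nonlinearities. -/
structure Eta where
  f : ℝ → ℝ
  f1 : ℝ → ℝ
  f2 : ℝ → ℝ
  d1 : ∀ u, HasDerivAt f (f1 u) u
  d2 : ∀ u, HasDerivAt f1 (f2 u) u
  c2 : Continuous f2
  z0 : ∀ u, u ≤ 0 → f u = 0
  z1 : ∀ u, u ≤ 0 → f1 u = 0
  n0 : ∀ u, 0 ≤ f u
  n1 : ∀ u, 0 ≤ f1 u
  n2 : ∀ u, 0 ≤ f2 u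

/-- Barriers. -/
structure Psi where
  f : ℝ → ℝ → ℝ
  fv : ℝ → ℝ → ℝ
  f1 : ℝ → ℝ → ℝ
  f2 : ℝ → ℝ → ℝ
  dv : ∀ v g, HasDerivAt (fun t => f t g) (fv v g) v
  d1 : ∀ v g, HasDerivAt (f v) (f1 v g) g
  d2 : ∀ v g, HasDerivAt (f1 v) (f2 v g) g
  c : Continuous fun x : ℝ × ℝ => f x.1 x.2
  cv : Continuous fun x : ℝ × ℝ => fv x.1 x.2
  c1 : Continuous fun x : ℝ × ℝ => f1 x.1 x.2
  c2 : Continuous fun x : ℝ × ℝ => f2 x.1 x.2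

lemma Tst.c {G : ℝ} (T : Tst G) : Continuous T.f :=
  continuous_iff_continuousAt.2 fun g => (T.d1 g).continuousAt
lemma Tst.c1 {G : ℝ} (T : Tst G) : Continuous T.f1 :=
  continuous_iff_continuousAt.2 fun g => (T.d2 g).continuousAt
lemma Eta.c (T : Eta) : Continuous T.f :=
  continuous_iff_continuousAt.2 fun g => (T.d1 g).continuousAt
lemma Eta.c1 (T : Eta) : Continuous T.f1 :=
  continuous_iff_continuousAt.2 fun g => (T.d2 g).continuousAt

lemma Eta.mono (H : Eta) : Monotone H.f :=
  monotone_of_deriv_nonneg (fun u => (H.d1 u).differentiableAt)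
    (fun u => by rw [(H.d1 u).deriv]; exact H.n1 u)

lemma Tst.zero_end {G : ℝ} (T : Tst G) : T.f G = 0 ∧ T.f1 G = 0 := by
  obtain ⟨ρ, hρ, h⟩ := T.supp
  refine ⟨h G (by linarith), ?_⟩
  have : T.f =ᶠ[nhds G] fun _ => 0 := by
    filter_upwards [Ioi_mem_nhds (show G - ρ < G by linarith)] with g hg using h g (le_of_lt hg)
  have h2 := this.deriv_eq
  rw [(T.d1 G).deriv] at h2
  simpa using h2

/-- adjoint operator on test functions -/
def Tst.Ls {G : ℝ} (T : Tst G) (P : Par) (g : ℝ) : ℝ :=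
  P.a / P.σ * T.f2 g - (g - P.gin) / P.σ * T.f1 g

def Psi.R (Ψ : Psi) (P : Par) (v g : ℝ) : ℝ :=
  P.J v g * Ψ.fv v g - P.Lop (Ψ.f v g) (Ψ.f1 v g) (Ψ.f2 v g) g - (P.gL + g) * Ψ.f v g

def Yk (P : Par) {G : ℝ} (T : Tst G) (H : Eta) (Ψ : Psi) (v g s : ℝ) : ℝ :=
  P.J v g * T.f g * H.f (Ψ.f v g - s)

def Ak (P : Par) {G : ℝ} (T : Tst G) (H : Eta) (Ψ : Psi) (v g s : ℝ) : ℝ :=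
  T.f g * H.f1 (Ψ.f v g - s) * Ψ.R P v g
    + T.f g * (P.gL + g + 1 / P.σ) *
      ((Ψ.f v g - s) * H.f1 (Ψ.f v g - s) - H.f (Ψ.f v g - s))
    + H.f (Ψ.f v g - s) * T.Ls P g

def Bk (P : Par) {G : ℝ} (T : Tst G) (H : Eta) (Ψ : Psi) (v s : ℝ) : ℝ :=
  1 / P.σ * (P.a * T.f1 0 * H.f (Ψ.f v 0 - s)
    - P.gin * T.f 0 * ((Ψ.f v 0 - s) * H.f1 (Ψ.f v 0 - s) - H.f (Ψ.f v 0 - s))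
    - T.f 0 * H.f1 (Ψ.f v 0 - s) * (P.a * Ψ.f1 v 0 - P.gin * Ψ.f v 0))

def Yf (P : Par) {G : ℝ} (T : Tst G) (H : Eta) (Ψ : Psi) (p : ℝ → ℝ → ℝ) (v : ℝ) : ℝ :=
  ∫ g in (0:ℝ)..G, Yk P T H Ψ v g (p v g)

def Af (P : Par) {G : ℝ} (T : Tst G) (H : Eta) (Ψ : Psi) (p : ℝ → ℝ → ℝ) (v : ℝ) : ℝ :=
  (∫ g in (0:ℝ)..G, Ak P T H Ψ v g (p v g)) + Bk P T H Ψ v (p v 0)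

/-- The supersolution property on an interval. -/
def Pr (P : Par) (G : ℝ) (p : ℝ → ℝ → ℝ) (c d : ℝ) : Prop :=
  ∀ (T : Tst G) (H : Eta) (Ψ : Psi) (v w : ℝ), c < v → v ≤ w → w < d →
    Yf P T H Ψ p w - Yf P T H Ψ p v ≤ ∫ t in v..w, Af P T H Ψ p t

lemma cont_int {G : ℝ} (hG : 0 ≤ G) {p : ℝ → ℝ → ℝ} (hp0 : ∀ v g, 0 ≤ p v g)
    (hpc : ∀ g, Continuous fun v => p v g) (hpm : Measurable fun x : ℝ × ℝ => p x.1 x.2)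
    {K : ℝ → ℝ → ℝ → ℝ} (hK : Continuous fun x : ℝ × ℝ × ℝ => K x.1 x.2.1 x.2.2)
    (hz : ∀ R, ∃ B, ∀ v g s, |v| ≤ R → 0 ≤ g → g ≤ G → B ≤ s → K v g s = 0) :
    (∀ R, ∃ M, ∀ v g s, |v| ≤ R → 0 ≤ g → g ≤ G → 0 ≤ s → |K v g s| ≤ M) ∧
    (Continuous fun v => ∫ g in (0:ℝ)..G, K v g (p v g)) := by
  have hbd : ∀ R, ∃ M, ∀ v g s, |v| ≤ R → 0 ≤ g → g ≤ G → 0 ≤ s → |K v g s| ≤ M := by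
    intro R
    obtain ⟨B, hB⟩ := hz R
    have hcomp : IsCompact (Icc (-R) R ×ˢ Icc 0 G ×ˢ Icc 0 B) :=
      isCompact_Icc.prod (isCompact_Icc.prod isCompact_Icc)
    obtain ⟨M, hM⟩ := hcomp.exists_bound_of_continuousOn hK.continuousOn
    refine ⟨max M 0, fun v g s hv h0 h1 hs => ?_⟩
    rcases le_total B s with h | h
    · rw [hB v g s hv h0 h1 h]; simp
    · exact (hM (v, g, s) ⟨⟨by linarith [neg_abs_le v], by linarith [le_abs_self v]⟩,
        ⟨h0, h1⟩, ⟨hs, h⟩⟩).trans (le_max_left _ _)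
  refine ⟨hbd, continuous_iff_continuousAt.2 fun v0 => ?_⟩
  obtain ⟨M, hM⟩ := hbd (|v0| + 1)
  apply intervalIntegral.continuousAt_of_dominated_interval (bound := fun _ => M)
  · refine Eventually.of_forall fun v => ?_
    have : Measurable fun g => K v g (p v g) := by
      have h1 : Measurable fun g => ((v, g, p v g) : ℝ × ℝ × ℝ) :=
        measurable_const.prodMk (measurable_id.prodMk
          (hpm.comp (measurable_const.prodMk measurable_id)))
      exact hK.measurable.comp h1
    exact this.aestronglyMeasurable
  · have : ∀ᶠ v in nhds v0, |v| ≤ |v0| + 1 := by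
      have : Metric.closedBall v0 1 ∈ nhds v0 := Metric.closedBall_mem_nhds v0 one_pos
      filter_upwards [this] with v hv
      rw [Metric.mem_closedBall, Real.dist_eq] at hv
      have := abs_sub_abs_le_abs_sub v v0
      linarith
    filter_upwards [this] with v hv
    refine Eventually.of_forall fun g hg => ?_
    rw [uIoc_of_le hG] at hg
    exact hM v g _ hv hg.1.le hg.2 (hp0 v g)
  · exact intervalIntegrable_const
  · refine Eventually.of_forall fun g _ => ?_
    have h1 : Continuous fun v => ((v, g, p v g) : ℝ × ℝ × ℝ) :=
      continuous_id.prodMk (continuous_const.prodMk (hpc g))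
    exact (hK.comp h1).continuousAt

lemma Psi.cR (Ψ : Psi) (P : Par) : Continuous fun x : ℝ × ℝ => Ψ.R P x.1 x.2 := by
  have := Ψ.c; have := Ψ.cv; have := Ψ.c1; have := Ψ.c2
  unfold Psi.R Par.J Par.Lop
  fun_prop

lemma Tst.cLs {G : ℝ} (T : Tst G) (P : Par) : Continuous fun g => T.Ls P g := by
  have := T.c; have := T.c1; have := T.c2
  unfold Tst.Ls
  fun_prop

lemma Yk_cont (P : Par) {G : ℝ} (T : Tst G) (H : Eta) (Ψ : Psi) :
    Continuous fun x : ℝ × ℝ × ℝ => Yk P T H Ψ x.1 x.2.1 x.2.2 := by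
  have h1 := T.c; have h2 := H.c
  have h3 : Continuous fun x : ℝ × ℝ × ℝ => Ψ.f x.1 x.2.1 :=
    Ψ.c.comp (continuous_fst.prodMk (continuous_fst.comp continuous_snd))
  unfold Yk Par.J
  fun_prop

lemma Ak_cont (P : Par) {G : ℝ} (T : Tst G) (H : Eta) (Ψ : Psi) :
    Continuous fun x : ℝ × ℝ × ℝ => Ak P T H Ψ x.1 x.2.1 x.2.2 := by
  have h1 := T.c; have h2 := H.c; have h4 := H.c1; have h5 := T.cLs P
  have h3 : Continuous fun x : ℝ × ℝ × ℝ => Ψ.f x.1 x.2.1 :=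
    Ψ.c.comp (continuous_fst.prodMk (continuous_fst.comp continuous_snd))
  have h6 : Continuous fun x : ℝ × ℝ × ℝ => Ψ.R P x.1 x.2.1 :=
    (Ψ.cR P).comp (continuous_fst.prodMk (continuous_fst.comp continuous_snd))
  unfold Ak
  fun_prop

lemma Psi.bd (Ψ : Psi) (G R : ℝ) : ∃ B, ∀ v g, |v| ≤ R → 0 ≤ g → g ≤ G → |Ψ.f v g| ≤ B := by
  have hcomp : IsCompact (Icc (-R) R ×ˢ Icc 0 G) := isCompact_Icc.prod isCompact_Icc
  obtain ⟨M, hM⟩ := hcomp.exists_bound_of_continuousOn Ψ.c.continuousOn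
  exact ⟨M, fun v g hv h0 h1 => hM (v, g) ⟨⟨by linarith [neg_abs_le v],
    by linarith [le_abs_self v]⟩, ⟨h0, h1⟩⟩⟩

lemma Yk_z (P : Par) {G : ℝ} (T : Tst G) (H : Eta) (Ψ : Psi) :
    ∀ R, ∃ B, ∀ v g s, |v| ≤ R → 0 ≤ g → g ≤ G → B ≤ s → Yk P T H Ψ v g s = 0 := by
  intro R
  obtain ⟨B, hB⟩ := Ψ.bd G R
  refine ⟨B, fun v g s hv h0 h1 hs => ?_⟩
  have := le_of_abs_le (hB v g hv h0 h1)
  simp [Yk, H.z0 (Ψ.f v g - s) (by linarith)]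

lemma Ak_z (P : Par) {G : ℝ} (T : Tst G) (H : Eta) (Ψ : Psi) :
    ∀ R, ∃ B, ∀ v g s, |v| ≤ R → 0 ≤ g → g ≤ G → B ≤ s → Ak P T H Ψ v g s = 0 := by
  intro R
  obtain ⟨B, hB⟩ := Ψ.bd G R
  refine ⟨B, fun v g s hv h0 h1 hs => ?_⟩
  have := le_of_abs_le (hB v g hv h0 h1)
  simp [Ak, H.z0 (Ψ.f v g - s) (by linarith), H.z1 (Ψ.f v g - s) (by linarith)]

lemma Yf_cont {P : Par} {p p1 p2 : ℝ → ℝ → ℝ} (S : Sol P p p1 p2) {G : ℝ} (hG : 0 ≤ G)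
    (T : Tst G) (H : Eta) (Ψ : Psi) : Continuous (Yf P T H Ψ p) :=
  (cont_int hG S.nonneg S.contv S.meas (Yk_cont P T H Ψ) (Yk_z P T H Ψ)).2

lemma Af_cont {P : Par} {p p1 p2 : ℝ → ℝ → ℝ} (S : Sol P p p1 p2) {G : ℝ} (hG : 0 ≤ G)
    (T : Tst G) (H : Eta) (Ψ : Psi) : Continuous (Af P T H Ψ p) := by
  refine (cont_int hG S.nonneg S.contv S.meas (Ak_cont P T H Ψ) (Ak_z P T H Ψ)).2.add ?_
  have h1 := H.c; have h2 := H.c1; have h3 := S.contv 0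
  have h4 : Continuous fun v => Ψ.f v 0 := Ψ.c.comp (continuous_id.prodMk continuous_const)
  have h5 : Continuous fun v => Ψ.f1 v 0 := Ψ.c1.comp (continuous_id.prodMk continuous_const)
  unfold Bk
  fun_prop

/-- pointwise `v`-derivative of the integrand of `Y` -/
def qd (P : Par) {G : ℝ} (T : Tst G) (H : Eta) (Ψ : Psi) (p p1 p2 : ℝ → ℝ → ℝ) (v g : ℝ) : ℝ :=
  -(P.gL + g) * T.f g * H.f (Ψ.f v g - p v g) + T.f g * H.f1 (Ψ.f v g - p v g) *
    (P.J v g * Ψ.fv v g - P.Lop (p v g) (p1 v g) (p2 v g) g - (P.gL + g) * p v g)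

lemma qd_cont {P : Par} {p p1 p2 : ℝ → ℝ → ℝ} (S : Sol P p p1 p2) {G : ℝ}
    (T : Tst G) (H : Eta) (Ψ : Psi) {v : ℝ} (hv : v ∈ Ioo 0 P.V) :
    Continuous (qd P T H Ψ p p1 p2 v) := by
  have := T.c; have := H.c; have := H.c1; have := S.c0 v hv; have := S.c1 v hv
  have := S.c2 v hv
  have h4 : Continuous fun g => Ψ.f v g := Ψ.c.comp (continuous_const.prodMk continuous_id)
  have h5 : Continuous fun g => Ψ.fv v g := Ψ.cv.comp (continuous_const.prodMk continuous_id)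
  unfold qd Par.J Par.Lop
  fun_prop

lemma slice_le {P : Par} {p p1 p2 : ℝ → ℝ → ℝ} (S : Sol P p p1 p2) {G : ℝ} (hG : 0 ≤ G)
    (T : Tst G) (H : Eta) (Ψ : Psi) {v : ℝ} (hv : v ∈ Ioo 0 P.V) :
    ∫ g in (0:ℝ)..G, qd P T H Ψ p p1 p2 v g ≤ Af P T H Ψ p v := by
  have i1 := T.c; have i2 := H.c; have i3 := H.c1; have i4 := S.c0 v hv; have i5 := S.c1 v hv
  have i6 := S.c2 v hv; have i7 := T.c1; have i8 := T.c2; have i9 := H.c2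
  have h4 : Continuous fun g => Ψ.f v g := Ψ.c.comp (continuous_const.prodMk continuous_id)
  have h5 : Continuous fun g => Ψ.f1 v g := Ψ.c1.comp (continuous_const.prodMk continuous_id)
  have h6 : Continuous fun g => Ψ.f2 v g := Ψ.c2.comp (continuous_const.prodMk continuous_id)
  have hσ := P.hσ
  set u : ℝ → ℝ := fun g => Ψ.f v g - p v g with hu
  set u1 : ℝ → ℝ := fun g => Ψ.f1 v g - p1 v g with hu1
  set u2 : ℝ → ℝ := fun g => Ψ.f2 v g - p2 v g with hu2
  set Sf : ℝ → ℝ := fun g => 1 / P.σ * (T.f g * (g - P.gin) * H.f (u g)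
    + P.a * (T.f g * H.f1 (u g) * u1 g) - P.a * (T.f1 g * H.f (u g))) with hSf
  set S' : ℝ → ℝ := fun g => 1 / P.σ * (
      T.f g * H.f1 (u g) * ((g - P.gin) * u1 g + P.a * u2 g) + T.f1 g * (g - P.gin) * H.f (u g)
      - P.a * T.f2 g * H.f (u g) + T.f g * H.f (u g)
      + P.a * T.f g * H.f2 (u g) * (u1 g)^2) with hS'
  have cu : Continuous u := by rw [hu]; fun_prop
  have cu1 : Continuous u1 := by rw [hu1]; fun_prop
  have cu2 : Continuous u2 := by rw [hu2]; fun_prop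
  have cSf : Continuous Sf := by rw [hSf]; fun_prop
  have cS' : Continuous S' := by rw [hS']; fun_prop
  have hder : ∀ g ∈ Ioo 0 G, HasDerivAt Sf (S' g) g := by
    intro g hg
    have du : HasDerivAt u (u1 g) g := (Ψ.d1 v g).sub (S.d1 v hv g hg.1)
    have du1 : HasDerivAt u1 (u2 g) g := (Ψ.d2 v g).sub (S.d2 v hv g hg.1)
    have dη : HasDerivAt (fun g => H.f (u g)) (H.f1 (u g) * u1 g) g := (H.d1 (u g)).comp g du
    have dη1 : HasDerivAt (fun g => H.f1 (u g)) (H.f2 (u g) * u1 g) g := (H.d2 (u g)).comp g du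
    have dg : HasDerivAt (fun g => g - P.gin) 1 g := (hasDerivAt_id g).sub_const _
    have := (((((T.d1 g).mul dg).mul dη).add ((((T.d1 g).mul dη1).mul du1).const_mul P.a)).sub
      (((T.d2 g).mul dη).const_mul P.a)).const_mul (1 / P.σ)
    refine HasDerivAt.congr_deriv this ?_
    simp only [hS', Pi.mul_apply]
    ring
  have hFTC : ∫ g in (0:ℝ)..G, S' g = Sf G - Sf 0 :=
    intervalIntegral.integral_eq_sub_of_hasDerivAt_of_le hG cSf.continuousOn hder
      (cS'.intervalIntegrable _ _)
  have hSG : Sf G = 0 := by simp [hSf, T.zero_end.1, T.zero_end.2]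
  have cA : Continuous fun g => Ak P T H Ψ v g (p v g) :=
    (Ak_cont P T H Ψ).comp (continuous_const.prodMk (continuous_id.prodMk (S.c0 v hv)))
  have hmono : ∫ g in (0:ℝ)..G, qd P T H Ψ p p1 p2 v g ≤
      ∫ g in (0:ℝ)..G, (Ak P T H Ψ v g (p v g) + S' g) := by
    apply intervalIntegral.integral_mono_on hG ((qd_cont S T H Ψ hv).intervalIntegrable _ _)
      ((cA.add cS').intervalIntegrable _ _)
    intro g _
    have hid : Ak P T H Ψ v g (p v g) + S' g - qd P T H Ψ p p1 p2 v g
        = P.a / P.σ * (T.f g * H.f2 (u g) * (u1 g)^2) := by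
      simp only [Ak, qd, hS', Psi.R, Par.Lop, Tst.Ls, hu, hu1, hu2]
      field_simp
      ring
    have : 0 ≤ P.a / P.σ * (T.f g * H.f2 (u g) * (u1 g)^2) := by
      have := P.ha; have := T.nonneg g; have := H.n2 (u g); positivity
    show qd P T H Ψ p p1 p2 v g ≤ Ak P T H Ψ v g (p v g) + S' g
    linarith
  rw [intervalIntegral.integral_add (cA.intervalIntegrable _ _) (cS'.intervalIntegrable _ _),
    hFTC, hSG] at hmono
  have hB : -Sf 0 = Bk P T H Ψ v (p v 0) := by
    have hr := S.robin v hv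
    have : P.a * u1 0 = P.a * Ψ.f1 v 0 - P.gin * p v 0 := by simp only [hu1]; linarith
    have e : Sf 0 = 1 / P.σ * (T.f 0 * (0 - P.gin) * H.f (u 0)
        + T.f 0 * H.f1 (u 0) * (P.a * u1 0) - P.a * (T.f1 0 * H.f (u 0))) := by
      simp only [hSf]; ring
    rw [e, this]
    simp only [Bk, hu]
    ring
  unfold Af
  linarith

/-- Reflected parameters. -/
def Par.refl (P : Par) : Par where
  V := P.V
  k1 := P.V - P.k1
  k0 := P.gL * P.V - P.k0
  gL := P.gL
  gin := P.gin
  a := P.a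
  σ := P.σ
  hV := P.hV
  hgL := P.hgL
  hgin := P.hgin
  ha := P.ha
  hσ := P.hσ

lemma Par.refl_J (P : Par) (v g : ℝ) : P.refl.J v g = - P.J (P.V - v) g := by
  simp only [Par.refl, Par.J]; ring

def rf (V : ℝ) (p : ℝ → ℝ → ℝ) : ℝ → ℝ → ℝ := fun v g => p (V - v) g

lemma Sol.refl {P : Par} {p p1 p2 : ℝ → ℝ → ℝ} (S : Sol P p p1 p2) :
    Sol P.refl (rf P.V p) (rf P.V p1) (rf P.V p2) where
  nonneg v g := S.nonneg _ g
  contv g := (S.contv g).comp (continuous_const.sub continuous_id)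
  meas := by
    have h : Measurable fun x : ℝ × ℝ => (P.V - x.1, x.2) := by fun_prop
    exact S.meas.comp h
  c0 v hv := S.c0 (P.V - v) ⟨by linarith [show v < P.V from hv.2], by linarith [hv.1]⟩
  c1 v hv := S.c1 (P.V - v) ⟨by linarith [show v < P.V from hv.2], by linarith [hv.1]⟩
  c2 v hv := S.c2 (P.V - v) ⟨by linarith [show v < P.V from hv.2], by linarith [hv.1]⟩
  d1 v hv := S.d1 (P.V - v) ⟨by linarith [show v < P.V from hv.2], by linarith [hv.1]⟩
  d2 v hv := S.d2 (P.V - v) ⟨by linarith [show v < P.V from hv.2], by linarith [hv.1]⟩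
  robin v hv := S.robin (P.V - v) ⟨by linarith [show v < P.V from hv.2], by linarith [hv.1]⟩
  pde v hv g hg := by
    obtain ⟨d, h1, h2⟩ := S.pde (P.V - v)
      ⟨by linarith [show v < P.V from hv.2], by linarith [hv.1]⟩ g hg
    refine ⟨-d, ?_, ?_⟩
    · have h3 : HasDerivAt (fun t => P.V - t) (-1) v := by
        simpa using (hasDerivAt_id v).const_sub P.V
      have := HasDerivAt.comp v h1 h3
      simpa [rf, Function.comp_def] using this
    · rw [P.refl_J]
      rw [neg_mul_neg, h2]
      rfl

def Psi.refl (Ψ : Psi) (V : ℝ) : Psi where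
  f v g := Ψ.f (V - v) g
  fv v g := - Ψ.fv (V - v) g
  f1 v g := Ψ.f1 (V - v) g
  f2 v g := Ψ.f2 (V - v) g
  dv v g := by
    have h3 : HasDerivAt (fun t => V - t) (-1) v := by
      simpa using (hasDerivAt_id v).const_sub V
    have := HasDerivAt.comp v (Ψ.dv (V - v) g) h3
    simpa [Function.comp_def] using this
  d1 v g := Ψ.d1 (V - v) g
  d2 v g := Ψ.d2 (V - v) g
  c := Ψ.c.comp (f := fun x : ℝ × ℝ => (V - x.1, x.2)) (by fun_prop)
  cv := (Ψ.cv.comp (f := fun x : ℝ × ℝ => (V - x.1, x.2)) (by fun_prop)).neg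
  c1 := Ψ.c1.comp (f := fun x : ℝ × ℝ => (V - x.1, x.2)) (by fun_prop)
  c2 := Ψ.c2.comp (f := fun x : ℝ × ℝ => (V - x.1, x.2)) (by fun_prop)

lemma Yf_refl (P : Par) {G : ℝ} (T : Tst G) (H : Eta) (Ψ : Psi) (p : ℝ → ℝ → ℝ) (v : ℝ) :
    Yf P.refl T H Ψ (rf P.V p) v = - Yf P T H (Ψ.refl P.V) p (P.V - v) := by
  unfold Yf
  rw [← intervalIntegral.integral_neg]
  congr 1
  funext g
  simp [Yk, rf, Psi.refl, P.refl_J]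

lemma Af_refl (P : Par) {G : ℝ} (T : Tst G) (H : Eta) (Ψ : Psi) (p : ℝ → ℝ → ℝ) (v : ℝ) :
    Af P.refl T H Ψ (rf P.V p) v = Af P T H (Ψ.refl P.V) p (P.V - v) := by
  unfold Af
  congr 1
  · congr 1
    funext g
    simp [Ak, rf, Psi.refl, Psi.R, P.refl_J, Par.Lop, Tst.Ls]
    simp [Par.refl]
  · simp [Bk, rf, Psi.refl, Par.refl]

lemma Pr.refl {P : Par} {G : ℝ} {p : ℝ → ℝ → ℝ} {c d : ℝ} (h : Pr P G p c d) :
    Pr P.refl G (rf P.V p) (P.V - d) (P.V - c) := by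
  intro T H Ψ v w h1 h2 h3
  have := h T H (Ψ.refl P.V) (P.V - w) (P.V - v) (by linarith) (by linarith) (by linarith)
  rw [Yf_refl, Yf_refl]
  have h4 : ∫ t in v..w, Af P.refl T H Ψ (rf P.V p) t
      = ∫ t in (P.V - w)..(P.V - v), Af P T H (Ψ.refl P.V) p t := by
    simp only [Af_refl]
    rw [intervalIntegral.integral_comp_sub_left (fun t => Af P T H (Ψ.refl P.V) p t)]
  rw [h4]
  linarith

def Df (P : Par) {G : ℝ} (T : Tst G) (H : Eta) (Ψ : Psi) (p : ℝ → ℝ → ℝ) (v : ℝ) : ℝ :=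
  Yf P T H Ψ p v - ∫ t in (0:ℝ)..v, Af P T H Ψ p t

lemma Df_cont {P : Par} {p p1 p2 : ℝ → ℝ → ℝ} (S : Sol P p p1 p2) {G : ℝ} (hG : 0 ≤ G)
    (T : Tst G) (H : Eta) (Ψ : Psi) : Continuous (Df P T H Ψ p) :=
  by
  have hc := Af_cont S hG T H Ψ
  have h : ∀ a b, IntervalIntegrable (Af P T H Ψ p) volume a b :=
    fun a b => hc.intervalIntegrable a b
  exact (Yf_cont S hG T H Ψ).sub (intervalIntegral.continuous_primitive h 0)

lemma Df_sub {P : Par} {p p1 p2 : ℝ → ℝ → ℝ} (S : Sol P p p1 p2) {G : ℝ} (hG : 0 ≤ G)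
    (T : Tst G) (H : Eta) (Ψ : Psi) (v w : ℝ) :
    Df P T H Ψ p w - Df P T H Ψ p v
      = Yf P T H Ψ p w - Yf P T H Ψ p v - ∫ t in v..w, Af P T H Ψ p t := by
  have hc := Af_cont S hG T H Ψ
  have := intervalIntegral.integral_interval_sub_left (μ := volume) (hc.intervalIntegrable 0 w)
    (hc.intervalIntegrable 0 v)
  unfold Df
  linarith

lemma Pr.closed {P : Par} {p p1 p2 : ℝ → ℝ → ℝ} (S : Sol P p p1 p2) {G : ℝ} (hG : 0 ≤ G)
    {c d : ℝ} (h : Pr P G p c d) (T : Tst G) (H : Eta) (Ψ : Psi) {v w : ℝ} (hv : c ≤ v)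
    (hvw : v ≤ w) (hw : w ≤ d) :
    Yf P T H Ψ p w - Yf P T H Ψ p v ≤ ∫ t in v..w, Af P T H Ψ p t := by
  rcases hvw.eq_or_lt with rfl | hlt
  · simp
  have hD := Df_cont S hG T H Ψ
  have key : Df P T H Ψ p w ≤ Df P T H Ψ p v := by
    have t1 : Tendsto (fun ε => Df P T H Ψ p (w - ε)) (nhdsWithin 0 (Ioi 0))
        (nhds (Df P T H Ψ p w)) := by
      have : Continuous fun ε : ℝ => Df P T H Ψ p (w - ε) := by fun_prop
      simpa using (this.tendsto 0).mono_left nhdsWithin_le_nhds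
    have t2 : Tendsto (fun ε => Df P T H Ψ p (v + ε)) (nhdsWithin 0 (Ioi 0))
        (nhds (Df P T H Ψ p v)) := by
      have : Continuous fun ε : ℝ => Df P T H Ψ p (v + ε) := by fun_prop
      simpa using (this.tendsto 0).mono_left nhdsWithin_le_nhds
    refine le_of_tendsto_of_tendsto t1 t2 ?_
    filter_upwards [Ioo_mem_nhdsGT (show (0:ℝ) < (w - v) / 2 by linarith)] with ε hε
    have := Df_sub S hG T H Ψ (v + ε) (w - ε)
    have := h T H Ψ (v + ε) (w - ε) (by linarith [hε.1]) (by linarith [hε.2]) (by linarith [hε.1])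
    linarith
  have := Df_sub S hG T H Ψ v w
  linarith

lemma Pr_of_step {P : Par} {p p1 p2 : ℝ → ℝ → ℝ} (S : Sol P p p1 p2) {G : ℝ} (hG : 0 ≤ G)
    {c d : ℝ} (h : ∀ (T : Tst G) (H : Eta) (Ψ : Psi) (s w ε : ℝ), c < s → s < w → w < d → 0 < ε →
      ∃ t, s < t ∧ t ≤ w ∧ Df P T H Ψ p t ≤ Df P T H Ψ p s + ε * (t - s)) : Pr P G p c d := by
  intro T H Ψ v w hv hvw hw
  have hD := Df_cont S hG T H Ψ
  have key : ∀ ε > 0, Df P T H Ψ p w ≤ Df P T H Ψ p v + ε * (w - v) := by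
    intro ε hε
    have := step_lemma (Z := univ) isClosed_univ (F := fun s => - Df P T H Ψ p s) hD.neg
      (L := ε) (mem_univ v) hvw (by
        intro s _ hvs hsw
        obtain ⟨t, h1, h2, h3⟩ := h T H Ψ s w ε (by linarith) hsw hw hε
        exact ⟨t, mem_univ _, h1, h2, by linarith⟩)
    linarith
  have key2 : Df P T H Ψ p w ≤ Df P T H Ψ p v := by
    refine le_of_forall_pos_le_add fun δ hδ => ?_
    have h1 := key (δ / (w - v + 1)) (div_pos hδ (by linarith))
    have h2 : δ / (w - v + 1) * (w - v) ≤ δ := by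
      rw [div_mul_eq_mul_div, div_le_iff₀ (by linarith)]
      nlinarith
    linarith
  have := Df_sub S hG T H Ψ v w
  linarith

/-- Build a nonlinearity from its second derivative. -/
def Eta.ofB (b : ℝ → ℝ) (hb : Continuous b) (h0 : ∀ u, 0 ≤ b u) (hz : ∀ u, u ≤ 0 → b u = 0) :
    Eta :=
  have hd2 : ∀ u, HasDerivAt (fun u => ∫ t in (0:ℝ)..u, b t) (b u) u := fun u =>
    intervalIntegral.integral_hasDerivAt_right (hb.intervalIntegrable _ _)
      (hb.stronglyMeasurableAtFilter _ _) hb.continuousAt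
  have hc1 : Continuous fun u => ∫ t in (0:ℝ)..u, b t :=
    continuous_iff_continuousAt.2 fun g => (hd2 g).continuousAt
  have hz1 : ∀ u, u ≤ 0 → ∫ t in (0:ℝ)..u, b t = 0 := by
    intro u hu
    rw [intervalIntegral.integral_congr (g := fun _ => 0)]
    · simp
    · intro t ht
      rw [uIcc_of_ge hu] at ht
      exact hz t ht.2
  have hn1 : ∀ u, 0 ≤ ∫ t in (0:ℝ)..u, b t := by
    intro u
    rcases le_total u 0 with h | h
    · rw [hz1 u h]
    · exact intervalIntegral.integral_nonneg h fun t _ => h0 t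
  { f := fun u => ∫ s in (0:ℝ)..u, ∫ t in (0:ℝ)..s, b t
    f1 := fun u => ∫ t in (0:ℝ)..u, b t
    f2 := b
    d1 := fun u => intervalIntegral.integral_hasDerivAt_right (hc1.intervalIntegrable _ _)
      (hc1.stronglyMeasurableAtFilter _ _) hc1.continuousAt
    d2 := hd2
    c2 := hb
    z0 := by
      intro u hu
      show ∫ s in (0:ℝ)..u, ∫ t in (0:ℝ)..s, b t = 0
      rw [intervalIntegral.integral_congr (g := fun _ => 0)]
      · simp
      · intro t ht
        rw [uIcc_of_ge hu] at ht
        exact hz1 t ht.2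
    z1 := hz1
    n0 := by
      intro u
      rcases le_total u 0 with h | h
      · show 0 ≤ ∫ s in (0:ℝ)..u, ∫ t in (0:ℝ)..s, b t
        rw [intervalIntegral.integral_congr (g := fun _ => 0)]
        · simp
        · intro t ht
          rw [uIcc_of_ge h] at ht
          exact hz1 t ht.2
      · exact intervalIntegral.integral_nonneg h fun t _ => hn1 t
    n1 := hn1
    n2 := h0 }

def cubeEta : Eta := Eta.ofB (fun u => 6 * max u 0) (by fun_prop) (fun u => by positivity)
  (fun u hu => by simp [max_eq_right hu])

lemma cubeEta_f1 {u : ℝ} (hu : 0 ≤ u) : cubeEta.f1 u = 3 * u ^ 2 := by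
  show ∫ t in (0:ℝ)..u, 6 * max t 0 = _
  rw [intervalIntegral.integral_congr (g := fun t => 6 * t)]
  · rw [intervalIntegral.integral_const_mul, integral_id]; ring
  · intro t ht
    rw [uIcc_of_le hu] at ht
    simp [max_eq_left ht.1]

lemma cubeEta_f {u : ℝ} (hu : 0 ≤ u) : cubeEta.f u = u ^ 3 := by
  show ∫ t in (0:ℝ)..u, cubeEta.f1 t = _
  rw [intervalIntegral.integral_congr (g := fun t => 3 * t^2)]
  · rw [intervalIntegral.integral_const_mul, integral_pow]; norm_num; ring
  · intro t ht
    rw [uIcc_of_le hu] at ht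
    exact cubeEta_f1 ht.1

/-- Smooth cutoff -/
lemma exists_cutoff {A B G : ℝ} (hAB : A < B) (hBG : B < G) :
    ∃ T : Tst G, (∀ g, g ≤ A → T.f g = 1) ∧ (∀ g, g < A → T.f1 g = 0 ∧ T.f2 g = 0) := by
  set F : ℝ → ℝ := fun g => Real.smoothTransition ((B - g) / (B - A)) with hF
  have hsm : ContDiff ℝ 2 F := by
    apply Real.smoothTransition.contDiff.comp
    fun_prop
  have h1 : ContDiff ℝ 1 (deriv F) := by
    have : ContDiff ℝ (1 + 1) F := by norm_num; exact hsm
    exact ((contDiff_succ_iff_deriv).1 this).2.2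
  have h2 : Continuous (deriv (deriv F)) := h1.continuous_deriv le_rfl
  have hone : ∀ g, g ≤ A → F g = 1 := fun g hg =>
    Real.smoothTransition.one_of_one_le (by rw [le_div_iff₀ (by linarith)]; linarith)
  have hd1 : ∀ g, g < A → deriv F g = 0 := by
    intro g hg
    have : F =ᶠ[nhds g] fun _ => 1 := by
      filter_upwards [Iio_mem_nhds hg] with x hx using hone x (le_of_lt hx)
    rw [this.deriv_eq]; simp
  have hd2 : ∀ g, g < A → deriv (deriv F) g = 0 := by
    intro g hg
    have : deriv F =ᶠ[nhds g] fun _ => 0 := by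
      filter_upwards [Iio_mem_nhds hg] with x hx using hd1 x hx
    rw [this.deriv_eq]; simp
  refine ⟨{ f := F, f1 := deriv F, f2 := deriv (deriv F)
            nonneg := fun g => Real.smoothTransition.nonneg _
            d1 := fun g => (hsm.differentiable (by norm_num) g).hasDerivAt
            d2 := fun g => (h1.differentiable (by norm_num) g).hasDerivAt
            c2 := h2
            supp := ⟨G - B, by linarith, fun g hg =>
              Real.smoothTransition.zero_of_nonpos
                (div_nonpos_of_nonpos_of_nonneg (by linarith) (by linarith))⟩ },
    hone, fun g hg => ⟨hd1 g hg, hd2 g hg⟩⟩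

/-- The barrier. -/
def barrier (c g0 f0 f1 n K lam μ D : ℝ) : Psi where
  f v g := f0 + f1 * (g - g0) - n / 2 * (g - g0) ^ 2 - K * (v - c)
    - D * (Real.cosh (lam * (g - g0)) * Real.exp (μ * (v - c)))
  fv v g := - K - D * (Real.cosh (lam * (g - g0)) * (Real.exp (μ * (v - c)) * μ))
  f1 v g := f1 - n * (g - g0) - D * (Real.sinh (lam * (g - g0)) * lam * Real.exp (μ * (v - c)))
  f2 v g := - n - D * (Real.cosh (lam * (g - g0)) * lam * lam * Real.exp (μ * (v - c)))
  dv v g := by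
    have h1 : HasDerivAt (fun v => v - c) 1 v := (hasDerivAt_id v).sub_const c
    have h2 : HasDerivAt (fun v => μ * (v - c)) μ v := by simpa using h1.const_mul μ
    have h := (((h1.const_mul K).const_sub (f0 + f1 * (g - g0) - n / 2 * (g - g0) ^ 2))).sub
      ((h2.exp.const_mul (Real.cosh (lam * (g - g0)))).const_mul D)
    refine HasDerivAt.congr_deriv h ?_
    ring
  d1 v g := by
    have h1 : HasDerivAt (fun g => g - g0) 1 g := (hasDerivAt_id g).sub_const g0
    have h2 : HasDerivAt (fun g => lam * (g - g0)) lam g := by simpa using h1.const_mul lam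
    have h := ((((h1.const_mul f1).const_add f0).sub ((h1.pow 2).const_mul (n/2))).sub_const
      (K * (v - c))).sub ((h2.cosh.mul_const (Real.exp (μ * (v - c)))).const_mul D)
    refine HasDerivAt.congr_deriv h ?_
    norm_num; ring
  d2 v g := by
    have h1 : HasDerivAt (fun g => g - g0) 1 g := (hasDerivAt_id g).sub_const g0
    have h2 : HasDerivAt (fun g => lam * (g - g0)) lam g := by simpa using h1.const_mul lam
    have h := ((h1.const_mul n).const_sub f1).sub
      (((h2.sinh.mul_const lam).mul_const (Real.exp (μ * (v - c)))).const_mul D)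
    refine HasDerivAt.congr_deriv h ?_
    ring
  c := by fun_prop
  cv := by fun_prop
  c1 := by fun_prop
  c2 := by fun_prop

def Par.C1 (P : Par) (G : ℝ) : ℝ := (2 * (G + P.gin) + P.a) / P.σ
def Par.C2 (P : Par) (G : ℝ) : ℝ := ((G + P.gin) + P.a) / P.σ

/-- differential inequality for the barrier -/
lemma barrier_R (P : Par) {G c g0 f0 f1 n lam r j v g : ℝ} (hn : 0 ≤ n)
    (hlam : 1 ≤ lam) (hr1 : r ≤ 1) (hj : 0 < j) (hf1 : |f1| ≤ n) (hg : 0 ≤ g) (hgG : g ≤ G)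
    (hgr : |g - g0| ≤ r) (hJ : j ≤ P.J v g) (D : ℝ) (hD : 0 ≤ D)
    (hpos : 0 ≤ (barrier c g0 f0 f1 n (P.C1 G * n / j) lam (P.C2 G * lam ^ 2 / j) D).f v g) :
    (barrier c g0 f0 f1 n (P.C1 G * n / j) lam (P.C2 G * lam ^ 2 / j) D).R P v g ≤ 0 := by
  set Ψ := barrier c g0 f0 f1 n (P.C1 G * n / j) lam (P.C2 G * lam ^ 2 / j) D
  have hσ := P.hσ; have ha := P.ha; have hgi := P.hgin; have hgL := P.hgL
  set X := Real.cosh (lam * (g - g0)) * Real.exp (P.C2 G * lam ^ 2 / j * (v - c)) with hX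
  set W := Real.sinh (lam * (g - g0)) * Real.exp (P.C2 G * lam ^ 2 / j * (v - c)) with hW
  have hX0 : 0 ≤ X := mul_nonneg (Real.cosh_pos _).le (Real.exp_pos _).le
  have hWX : |W| ≤ X := by
    rw [hW, hX, abs_mul, abs_of_pos (Real.exp_pos _)]
    refine mul_le_mul_of_nonneg_right ?_ (Real.exp_pos _).le
    rw [abs_le]
    constructor
    · have := Real.cosh_add_sinh (lam * (g - g0)); have := Real.exp_pos (lam * (g-g0)); linarith
    · exact (Real.sinh_lt_cosh _).le
  have hv : Ψ.fv v g = -(P.C1 G * n / j) - D * X * (P.C2 G * lam ^ 2 / j) := by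
    simp only [Ψ, barrier, hX]; ring
  have h1 : Ψ.f1 v g = f1 - n * (g - g0) - D * lam * W := by
    simp only [Ψ, barrier, hW]; ring
  have h2 : Ψ.f2 v g = -n - D * lam^2 * X := by
    simp only [Ψ, barrier, hX]; ring
  have hC1 : 0 ≤ P.C1 G := by unfold Par.C1; have : 0 ≤ G := hg.trans hgG; positivity
  have hC2 : 0 ≤ P.C2 G := by unfold Par.C2; have : 0 ≤ G := hg.trans hgG; positivity
  have hb1 : |Ψ.f1 v g| ≤ 2 * n + D * lam^2 * X := by
    rw [h1]
    have e1 : |n * (g - g0)| ≤ n := by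
      rw [abs_mul, abs_of_nonneg hn]; nlinarith
    have e2 : |D * lam * W| ≤ D * lam^2 * X := by
      rw [abs_mul, abs_of_nonneg (by positivity)]
      have : D * lam ≤ D * lam^2 := by nlinarith [mul_nonneg hD (by linarith : 0 ≤ lam)]
      exact mul_le_mul this hWX (abs_nonneg _) (by positivity)
    calc _ ≤ |f1 - n * (g - g0)| + |D * lam * W| := abs_sub _ _
      _ ≤ |f1| + |n * (g-g0)| + |D * lam * W| := by gcongr; exact abs_sub _ _
      _ ≤ _ := by linarith
  have hgg : |g - P.gin| ≤ G + P.gin := abs_le.2 ⟨by linarith, by linarith⟩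
  have hprod : |(g - P.gin) * Ψ.f1 v g| ≤ (G + P.gin) * (2 * n + D * lam^2 * X) := by
    rw [abs_mul]
    exact mul_le_mul hgg hb1 (abs_nonneg _) (by linarith)
  have hJv : P.J v g * Ψ.fv v g ≤ j * Ψ.fv v g := by
    have : Ψ.fv v g ≤ 0 := by
      rw [hv]
      have e1 : 0 ≤ P.C1 G * n / j := by positivity
      have e2 : 0 ≤ D * X * (P.C2 G * lam ^ 2 / j) := by positivity
      linarith
    nlinarith
  have hjv : j * Ψ.fv v g = -(P.C1 G * n) - D * X * (P.C2 G * lam^2) := by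
    rw [hv]; field_simp
  have e3 : P.C1 G * n + D * X * (P.C2 G * lam^2) =
      1 / P.σ * ((G + P.gin) * (2 * n + D * lam^2 * X) + P.a * (n + D * lam^2 * X)) := by
    unfold Par.C1 Par.C2; field_simp; ring
  have e4 : -(1 / P.σ * ((G + P.gin) * (2 * n + D * lam^2 * X) + P.a * (n + D * lam^2 * X)))
     ≤ 1 / P.σ * ((g - P.gin) * Ψ.f1 v g + P.a * Ψ.f2 v g) := by
    rw [← mul_neg]
    apply mul_le_mul_of_nonneg_left _ (by positivity)
    rw [h2]
    have := neg_le_of_abs_le hprod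
    linarith
  have e5 : 0 ≤ 1 / P.σ * Ψ.f v g := by positivity
  have e6 : 0 ≤ (P.gL + g) * Ψ.f v g := by positivity
  have e7 : P.Lop (Ψ.f v g) (Ψ.f1 v g) (Ψ.f2 v g) g = 1 / P.σ * Ψ.f v g +
      1 / P.σ * ((g - P.gin) * Ψ.f1 v g + P.a * Ψ.f2 v g) := by unfold Par.Lop; ring
  unfold Psi.R
  rw [e7]
  linarith

lemma barrier_neg {c g0 f0 f1 n K lam μ r v g : ℝ} (hn : 0 ≤ n) (hK : 0 ≤ K) (hμ : 0 ≤ μ)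
    (hlam : 0 ≤ lam) (hr : 0 ≤ r) (hf0 : f0 ≤ n) (hf1 : |f1| ≤ n) (hv : c ≤ v) (hg : r ≤ |g - g0|) :
    (barrier c g0 f0 f1 n K lam μ (2 * n / Real.cosh (lam * r))).f v g ≤ 0 := by
  simp only [barrier]
  set y := g - g0
  have hc : 0 < Real.cosh (lam * r) := Real.cosh_pos _
  have h1 : Real.cosh (lam * r) ≤ Real.cosh (lam * y) := by
    rw [Real.cosh_le_cosh, abs_mul, abs_mul, abs_of_nonneg hlam, abs_of_nonneg hr]
    gcongr
  have h2 : 1 ≤ Real.exp (μ * (v - c)) := Real.one_le_exp (mul_nonneg hμ (by linarith))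
  have h3 : 2 * n ≤ 2 * n / Real.cosh (lam * r) * (Real.cosh (lam * y) * Real.exp (μ * (v - c))) := by
    rw [div_mul_eq_mul_div, le_div_iff₀ hc]
    have : Real.cosh (lam * r) ≤ Real.cosh (lam * y) * Real.exp (μ * (v - c)) := by nlinarith
    nlinarith
  have h4 : f1 * y ≤ n * |y| := by
    calc f1 * y ≤ |f1 * y| := le_abs_self _
      _ = |f1| * |y| := abs_mul _ _
      _ ≤ _ := by gcongr
  have h5 : y ^ 2 = |y| ^ 2 := (sq_abs y).symm
  have h6 : 0 ≤ K * (v - c) := mul_nonneg hK (by linarith)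
  have h7 : 0 ≤ n * (|y| - 1) ^ 2 := by positivity
  rw [h5]
  nlinarith

set_option maxHeartbeats 2000000 in
/-- Gap lemma. -/
lemma gap_lemma {P : Par} {p p1 p2 : ℝ → ℝ → ℝ} (S : Sol P p p1 p2) {G : ℝ} {c d n r j g0 : ℝ}
    (hc : 0 < c) (hcd : c < d) (hd : d < P.V) (hPr : Pr P G p c d) (hn : 0 ≤ n)
    (hb0 : p c g0 ≤ n) (hb1 : |p1 c g0| ≤ n) (hb2 : ∀ g ∈ Icc 0 G, |p2 c g| ≤ n)
    (hr : 0 < r) (hr1 : r ≤ 1) (hg0 : 0 < g0 - r) (hgG : g0 + r < G) (hj : 0 < j)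
    (hJ : ∀ v ∈ Icc c d, ∀ g, |g - g0| ≤ r → j ≤ P.J v g)
    (hsm : 2 * P.C2 G * (d - c) ≤ j * r) :
    p c g0 - P.C1 G * n * (d - c) / j - 480 * (4 * P.C2 G) ^ 5 * n * ((d - c) / (j * r ^ 2)) ^ 5
      ≤ p d g0 := by
  have hG : 0 < G := by linarith
  have hσ := P.hσ; have ha := P.ha; have hgi := P.hgin; have hgL := P.hgL
  have hC2 : 0 < P.C2 G := by unfold Par.C2; positivity
  have hC1 : 0 < P.C1 G := by unfold Par.C1; positivity
  set Δ := d - c with hΔ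
  have hΔ0 : 0 < Δ := by linarith
  set lam := j * r / (2 * P.C2 G * Δ) with hlam
  have hlam1 : 1 ≤ lam := by rw [hlam, le_div_iff₀ (by positivity)]; linarith
  set D := 2 * n / Real.cosh (lam * r) with hD
  have hch : 0 < Real.cosh (lam * r) := Real.cosh_pos _
  have hD0 : 0 ≤ D := by positivity
  set Ψ := barrier c g0 (p c g0) (p1 c g0) n (P.C1 G * n / j) lam (P.C2 G * lam ^ 2 / j) D with hΨ
  have hcV : c ∈ Ioo 0 P.V := ⟨hc, by linarith⟩
  have hdV : d ∈ Ioo 0 P.V := ⟨by linarith, hd⟩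
  have hneg : ∀ v, c ≤ v → ∀ g, r ≤ |g - g0| → Ψ.f v g ≤ 0 := fun v hv g hg =>
    barrier_neg hn (by positivity) (by positivity) (by linarith) hr.le hb0 hb1 hv hg
  obtain ⟨T, hT1, hT2⟩ := exists_cutoff (show g0 + r < (g0 + r + G) / 2 by linarith)
    (show (g0 + r + G) / 2 < G by linarith)
  set H := cubeEta with hH
  set Y := Yf P T H Ψ p with hY
  have hYc : Continuous Y := Yf_cont S hG.le T H Ψ
  have hAc : Continuous (Af P T H Ψ p) := Af_cont S hG.le T H Ψ
  have hYk0 : ∀ v ∈ Icc c d, ∀ g, 0 ≤ Yk P T H Ψ v g (p v g) := by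
    intro v hv g
    unfold Yk
    rcases le_total r |g - g0| with h | h
    · rw [H.z0 _ (by linarith [hneg v hv.1 g h, S.nonneg v g])]; simp
    · have := hJ v hv g h
      have := T.nonneg g; have := H.n0 (Ψ.f v g - p v g)
      have : 0 ≤ P.J v g := by linarith
      positivity
  have hY0 : ∀ v ∈ Icc c d, 0 ≤ Y v := fun v hv =>
    intervalIntegral.integral_nonneg hG.le fun g _ => hYk0 v hv g
  set K := 2 * (P.gL + G + 1 / P.σ) / j with hK
  have hK0 : 0 ≤ K := by positivity
  have hAk : ∀ v ∈ Icc c d, ∀ g ∈ Icc 0 G,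
      Ak P T H Ψ v g (p v g) ≤ K * Yk P T H Ψ v g (p v g) := by
    intro v hv g hg
    rcases le_or_gt (Ψ.f v g - p v g) 0 with hu | hu
    · simp [Ak, Yk, H.z0 _ hu, H.z1 _ hu]
    have hΨ0 : 0 < Ψ.f v g := by linarith [S.nonneg v g]
    have hgr : |g - g0| < r := by
      by_contra hcon
      push Not at hcon
      linarith [hneg v hv.1 g hcon]
    have hJ' := hJ v hv g hgr.le
    have hR : Ψ.R P v g ≤ 0 := barrier_R P hn hlam1 hr1 hj hb1 hg.1 hg.2 hgr.le hJ' D hD0 hΨ0.le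
    have hglt : g < g0 + r := by linarith [(abs_lt.1 hgr).2]
    have e1 := hT1 g hglt.le
    have e2 := hT2 g hglt
    have e3 : T.Ls P g = 0 := by simp [Tst.Ls, e2.1, e2.2]
    unfold Ak Yk
    rw [e1, e3, hH, cubeEta_f hu.le, cubeEta_f1 hu.le]
    set u := Ψ.f v g - p v g
    have h1 : 3 * u ^ 2 * Ψ.R P v g ≤ 0 := mul_nonpos_of_nonneg_of_nonpos (by positivity) hR
    have h2 : (P.gL + g + 1 / P.σ) ≤ P.gL + G + 1 / P.σ := by linarith [hg.2]
    have h3 : K * (P.J v g * 1 * u ^ 3) ≥ 2 * (P.gL + G + 1 / P.σ) * u ^ 3 := by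
      have : K * j = 2 * (P.gL + G + 1 / P.σ) := by rw [hK]; field_simp
      rw [← this]
      have hu3 : 0 ≤ K * u ^ 3 := by positivity
      nlinarith
    have h4 : (P.gL + g + 1 / P.σ) * (2 * u ^ 3) ≤ (P.gL + G + 1 / P.σ) * (2 * u ^ 3) :=
      mul_le_mul_of_nonneg_right h2 (by positivity)
    nlinarith
  have hAf : ∀ v ∈ Icc c d, Af P T H Ψ p v ≤ K * Y v := by
    intro v hv
    have hB : Bk P T H Ψ v (p v 0) = 0 := by
      have h0 : Ψ.f v 0 - p v 0 ≤ 0 := by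
        have := hneg v hv.1 0 (by rw [zero_sub, abs_neg]; linarith [le_abs_self g0])
        linarith [S.nonneg v 0]
      simp [Bk, H.z0 _ h0, H.z1 _ h0]
    unfold Af
    rw [hB, add_zero, hY, Yf, ← intervalIntegral.integral_const_mul]
    have hvV : v ∈ Ioo 0 P.V := ⟨by linarith [hv.1], by linarith [hv.2]⟩
    have hm : Continuous fun g => ((v, g, p v g) : ℝ × ℝ × ℝ) :=
      continuous_const.prodMk (continuous_id.prodMk (S.c0 v hvV))
    refine intervalIntegral.integral_mono_on hG.le
      (((Ak_cont P T H Ψ).comp hm).intervalIntegrable _ _)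
      ((((Yk_cont P T H Ψ).comp hm).const_smul K).intervalIntegrable _ _) (hAk v hv)
  have hYcz : Y c = 0 := by
    rw [hY, Yf, intervalIntegral.integral_congr (g := fun _ => 0)]
    · simp
    intro g hg
    rw [uIcc_of_le hG.le] at hg
    have ht := taylor2_below (f := p c) (f1 := p1 c) (f2 := p2 c) (A := 0) (B := G) (n := n)
      (S.c0 c hcV).continuousOn (S.c1 c hcV).continuousOn (fun z hz => S.d1 c hcV z hz.1)
      (fun z hz => S.d2 c hcV z hz.1) (fun z hz => neg_le_of_abs_le (hb2 z ⟨hz.1.le, hz.2.le⟩))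
      (x := g0) (y := g) ⟨by linarith, by linarith⟩ hg
    have hu : Ψ.f c g - p c g ≤ 0 := by
      simp only [hΨ, barrier]
      have := mul_nonneg hD0 (mul_nonneg (Real.cosh_pos (lam * (g - g0))).le
        (Real.exp_pos (P.C2 G * lam ^ 2 / j * (c - c))).le)
      have e : P.C1 G * n / j * (c - c) = 0 := by simp
      linarith
    simp [Yk, H.z0 _ hu]
  have hYint : ∀ v, c ≤ v → v ≤ d → Y v ≤ K * ∫ t in c..v, Y t := by
    intro v hcv hvd
    have h1 := hPr.closed S hG.le T H Ψ le_rfl hcv hvd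
    have h2 : ∫ t in c..v, Af P T H Ψ p t ≤ ∫ t in c..v, K * Y t :=
      intervalIntegral.integral_mono_on hcv (hAc.intervalIntegrable _ _)
        ((hYc.const_smul K).intervalIntegrable _ _)
        fun t ht => hAf t ⟨ht.1, ht.2.trans hvd⟩
    rw [intervalIntegral.integral_const_mul] at h2
    have h3 : Yf P T H Ψ p c = 0 := hYcz
    have h4 : Y v = Yf P T H Ψ p v := rfl
    linarith
  have hYz := gronwall_zero hYc (d := d) hK0 (fun v h1 h2 => hY0 v ⟨h1, h2.le⟩)
    (fun v h1 h2 => hYint v h1 h2.le)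
  have hYd : Y d ≤ 0 := by
    have h1 := hYint d hcd.le le_rfl
    have h2 : ∫ t in c..d, Y t = 0 := by
      rw [intervalIntegral.integral_congr_ae (g := fun _ => 0)]
      · simp
      have : ∀ᵐ x : ℝ, x ≠ d := by simp [ae_iff, measure_singleton]
      filter_upwards [this] with x hx hx2
      rw [uIoc_of_le hcd.le] at hx2
      exact hYz x hx2.1.le (lt_of_le_of_ne hx2.2 hx)
    rw [h2] at h1
    simpa using h1
  have hfin : Ψ.f d g0 ≤ p d g0 := by
    by_contra hcon
    push Not at hcon
    have hm : Continuous fun g => ((d, g, p d g) : ℝ × ℝ × ℝ) :=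
      continuous_const.prodMk (continuous_id.prodMk (S.c0 d hdV))
    have := intervalIntegral.integral_pos hG (((Yk_cont P T H Ψ).comp hm).continuousOn)
      (fun g _ => hYk0 d ⟨hcd.le, le_rfl⟩ g) ⟨g0, ⟨by linarith, by linarith⟩, by
        show 0 < Yk P T H Ψ d g0 (p d g0)
        unfold Yk
        rw [hT1 g0 (by linarith), hH, cubeEta_f (by linarith)]
        have := hJ d ⟨hcd.le, le_rfl⟩ g0 (by simpa using hr.le)
        have h1 : 0 < P.J d g0 := by linarith
        have h2 : 0 < Ψ.f d g0 - p d g0 := by linarith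
        positivity⟩
    have h4 : Y d = ∫ g in (0:ℝ)..G, Yk P T H Ψ d g (p d g) := rfl
    simp only [Function.comp_def] at this
    linarith
  have hval : Ψ.f d g0 = p c g0 - P.C1 G * n * Δ / j - D * Real.exp (lam * r / 2) := by
    have e : P.C2 G * lam ^ 2 / j * (d - c) = lam * r / 2 := by
      rw [← hΔ]
      have : P.C2 G * lam * Δ / j = r / 2 := by rw [hlam]; field_simp
      calc _ = lam * (P.C2 G * lam * Δ / j) := by ring
        _ = _ := by rw [this]; ring
    simp only [hΨ, barrier]
    rw [e, ← hΔ]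
    simp
    ring
  have hx : 0 < lam * r / 2 := by positivity
  have hDe : D * Real.exp (lam * r / 2) ≤ 4 * n * Real.exp (-(lam * r / 2)) := by
    have h1 : Real.exp (lam * r) / 2 ≤ Real.cosh (lam * r) := by
      rw [Real.cosh_eq]; linarith [Real.exp_pos (-(lam * r))]
    rw [hD, div_mul_eq_mul_div, div_le_iff₀ hch]
    have h2 : Real.exp (lam * r / 2) = Real.exp (-(lam * r / 2)) * Real.exp (lam * r) := by
      rw [← Real.exp_add]; ring_nf
    rw [h2]
    have h3 : 0 ≤ 4 * n * Real.exp (-(lam * r / 2)) := by positivity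
    nlinarith
  have h5 := exp_neg_le_pow5 hx
  have h6 : 120 / (lam * r / 2) ^ 5 = 120 * (4 * P.C2 G) ^ 5 * (Δ / (j * r ^ 2)) ^ 5 := by
    rw [hlam]; field_simp; norm_num
  rw [h6] at h5
  have h7 : 4 * n * Real.exp (-(lam * r / 2)) ≤
      4 * n * (120 * (4 * P.C2 G) ^ 5 * (Δ / (j * r ^ 2)) ^ 5) := by gcongr
  rw [hval] at hfin
  nlinarith

/-- Uniformly regular slices with good gaps. -/
structure Slab (P : Par) (G : ℝ) (p p1 p2 : ℝ → ℝ → ℝ) (Z : Set ℝ) (n : ℝ) : Prop where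
  n1 : 1 ≤ n
  cl : ∀ v w, v ∈ Z → w ∈ Z → IsClosed (Z ∩ Icc v w)
  sub : Z ⊆ Ioo 0 P.V
  b0 : ∀ v ∈ Z, ∀ g ∈ Icc 0 G, |p v g| ≤ n
  b1 : ∀ v ∈ Z, ∀ g ∈ Icc 0 G, |p1 v g| ≤ n
  b2 : ∀ v ∈ Z, ∀ g ∈ Icc 0 G, |p2 v g| ≤ n
  gap : ∀ c ∈ Z, ∀ d ∈ Z, c < d → (∀ z ∈ Z, c < z → d ≤ z) → Pr P G p c d

lemma Slab.refl {P : Par} {G : ℝ} {p p1 p2 : ℝ → ℝ → ℝ} {Z : Set ℝ} {n : ℝ}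
    (h : Slab P G p p1 p2 Z n) :
    Slab P.refl G (rf P.V p) (rf P.V p1) (rf P.V p2) {v | P.V - v ∈ Z} n where
  n1 := h.n1
  cl v w hv hw := by
    have h1 := h.cl (P.V - w) (P.V - v) hw hv
    have h2 : Continuous fun t : ℝ => P.V - t := by fun_prop
    have h3 := h1.preimage h2
    convert h3 using 1
    ext t
    simp only [mem_inter_iff, mem_ofPred_eq, mem_Icc, mem_preimage]
    constructor
    · rintro ⟨a, b, c⟩; exact ⟨a, by linarith, by linarith⟩
    · rintro ⟨a, b, c⟩; exact ⟨a, by linarith, by linarith⟩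
  sub v hv := by
    have := h.sub hv
    exact ⟨by linarith [this.2], show v < P.V by linarith [this.1]⟩
  b0 v hv := h.b0 _ hv
  b1 v hv := h.b1 _ hv
  b2 v hv := h.b2 _ hv
  gap c hc d hd hcd hz := by
    have := (h.gap (P.V - d) hd (P.V - c) hc (by linarith) (fun z hz1 hz2 => by
      by_contra hcon
      push Not at hcon
      have := hz (P.V - z) (by simpa using hz1) (by linarith)
      linarith)).refl
    simpa using this

/-- closed sets: a point is right isolated with a next point or accumulated from the right -/
lemma next_or_acc {Z : Set ℝ} {s w : ℝ} (hcl : IsClosed (Z ∩ Icc s w)) (hw : w ∈ Z) (hsw : s < w) :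
    (∃ t ∈ Z, s < t ∧ t ≤ w ∧ ∀ z ∈ Z, s < z → t ≤ z) ∨
      ∀ δ > 0, ∃ z ∈ Z, s < z ∧ z ≤ w ∧ z < s + δ := by
  by_cases h : ∃ δ > 0, ∀ z ∈ Z, s < z → z ≤ w → s + δ ≤ z
  · left
    obtain ⟨δ, hδ, h⟩ := h
    have hw' := h w hw hsw le_rfl
    have hcomp : IsCompact ((Z ∩ Icc s w) ∩ Icc (s + δ) w) :=
      isCompact_Icc.inter_left hcl
    obtain ⟨t, ht1, ht2⟩ := hcomp.exists_isLeast ⟨w, ⟨hw, hsw.le, le_rfl⟩, hw', le_rfl⟩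
    refine ⟨t, ht1.1.1, by linarith [ht1.2.1], ht1.2.2, fun z hz hsz => ?_⟩
    rcases le_total z w with hzw | hzw
    · exact ht2 ⟨⟨hz, hsz.le, hzw⟩, h z hz hsz hzw, hzw⟩
    · exact ht1.2.2.trans hzw
  · right
    push Not at h
    intro δ hδ
    obtain ⟨z, h1, h2, h3, h4⟩ := h δ hδ
    exact ⟨z, h1, h2, h3, h4⟩

lemma line_lemma {P : Par} {p p1 p2 : ℝ → ℝ → ℝ} (S : Sol P p p1 p2) {G : ℝ} {Z : Set ℝ} {n : ℝ}
    (hZ : Slab P G p p1 p2 Z n) {v w r j g0 : ℝ} (hv : v ∈ Z) (hw : w ∈ Z) (hvw : v ≤ w)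
    (hr : 0 < r) (hr1 : r ≤ 1) (hg0 : 0 < g0 - r) (hgG : g0 + r < G) (hj : 0 < j)
    (hJ : ∀ t ∈ Icc v w, ∀ g, |g - g0| ≤ r → j ≤ P.J t g)
    (hsm : 2 * P.C2 G * (w - v) ≤ j * r) :
    p v g0 - (2 * P.C1 G * n / j + 480 * (4 * P.C2 G) ^ 5 * n * (w - v) ^ 4 / (j * r ^ 2) ^ 5)
      * (w - v) ≤ p w g0 := by
  have hG : 0 < G := by linarith
  have hσ := P.hσ; have ha := P.ha; have hgi := P.hgin; have hgL := P.hgL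
  have hC2 : 0 < P.C2 G := by unfold Par.C2; positivity
  have hC1 : 0 < P.C1 G := by unfold Par.C1; positivity
  have hn : 0 < n := by linarith [hZ.n1]
  have hgI : g0 ∈ Icc 0 G := ⟨by linarith, by linarith⟩
  have hZc := hZ.cl v w hv hw
  set L := 2 * P.C1 G * n / j + 480 * (4 * P.C2 G) ^ 5 * n * (w - v) ^ 4 / (j * r ^ 2) ^ 5 with hL
  have hL2 : 0 ≤ 480 * (4 * P.C2 G) ^ 5 * n * (w - v) ^ 4 / (j * r ^ 2) ^ 5 := by
    have : 0 ≤ (w - v)^4 := by positivity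
    positivity
  refine step_lemma hZc (S.contv g0) ⟨hv, le_rfl, hvw⟩ hvw ?_
  rintro s ⟨hs, _, _⟩ hvs hsw
  have hsV := hZ.sub hs
  have hwV := hZ.sub hw
  have hcl : IsClosed (Z ∩ Icc s w) := hZ.cl s w hs hw
  rcases next_or_acc hcl hw hsw with ⟨t, ht, hst, htw, hz⟩ | hacc
  · refine ⟨t, ⟨ht, by linarith, htw⟩, hst, htw, ?_⟩
    have hPr := hZ.gap s hs t ht hst hz
    have h1 := gap_lemma S (n := n) hsV.1 hst (hZ.sub ht).2 hPr hn.le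
      (le_of_abs_le (hZ.b0 s hs g0 hgI)) (hZ.b1 s hs g0 hgI) (hZ.b2 s hs) hr hr1 hg0 hgG hj
      (fun x hx => hJ x ⟨by linarith [hx.1], by linarith [hx.2]⟩)
      (by
        have : 2 * P.C2 G * (t - s) ≤ 2 * P.C2 G * (w - v) := by gcongr
        linarith)
    have h2 : P.C1 G * n * (t - s) / j ≤ 2 * P.C1 G * n / j * (t - s) := by
      rw [div_mul_eq_mul_div]
      gcongr
      nlinarith [mul_pos (mul_pos hC1 hn) (sub_pos.2 hst)]
    have h3 : 480 * (4 * P.C2 G) ^ 5 * n * ((t - s) / (j * r ^ 2)) ^ 5 ≤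
        480 * (4 * P.C2 G) ^ 5 * n * (w - v) ^ 4 / (j * r ^ 2) ^ 5 * (t - s) := by
      rw [div_pow, div_mul_eq_mul_div, ← mul_div_assoc]
      have : (t - s) ^ 5 ≤ (w - v) ^ 4 * (t - s) := by
        rw [pow_succ]
        have h0 : 0 < t - s := by linarith
        gcongr
      have hc : 0 ≤ 480 * (4 * P.C2 G) ^ 5 * n := by positivity
      have h4 := mul_le_mul_of_nonneg_left this hc
      exact div_le_div_of_nonneg_right (by linarith) (by positivity)
    show p s g0 - L * (t - s) ≤ p t g0
    rw [hL, add_mul]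
    linarith
  · obtain ⟨d, hd, hpde⟩ := S.pde s hsV g0 (by linarith)
    have hJs := hJ s ⟨hvs, hsw.le⟩ g0 (by simpa using hr.le)
    have hdb : -L < d := by
      have hlow : -(P.C1 G * n) ≤ P.J s g0 * d := by
        rw [hpde]
        have e0 := S.nonneg s g0
        have e1 := hZ.b1 s hs g0 hgI
        have e2 := hZ.b2 s hs g0 hgI
        have e3 : |(g0 - P.gin) * p1 s g0| ≤ (G + P.gin) * n := by
          rw [abs_mul]
          exact mul_le_mul (abs_le.2 ⟨by linarith, by linarith⟩) e1 (abs_nonneg _) (by linarith)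
        have e4 := neg_le_of_abs_le e3
        have e5 : -(P.a * n) ≤ P.a * p2 s g0 := by nlinarith [neg_le_of_abs_le e2]
        have e6 : P.C1 G * n = 1 / P.σ * ((2 * (G + P.gin) + P.a) * n) := by
          unfold Par.C1; ring
        have e7 : 0 ≤ (P.gL + g0) * p s g0 := mul_nonneg (by linarith) e0
        have e8 : 0 ≤ (G + P.gin) * n := by positivity
        unfold Par.Lop
        rw [e6, ← mul_neg]
        have : 1 / P.σ * -((2 * (G + P.gin) + P.a) * n) ≤
          1 / P.σ * (p s g0 + (g0 - P.gin) * p1 s g0 + P.a * p2 s g0) := by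
          apply mul_le_mul_of_nonneg_left _ (by positivity)
          nlinarith
        linarith
      have hL1 : P.C1 G * n / j < L := by
        rw [hL]
        have : P.C1 G * n / j < 2 * P.C1 G * n / j := by
          gcongr
          nlinarith [mul_pos hC1 hn]
        linarith
      by_contra hcon
      push Not at hcon
      rw [div_lt_iff₀ hj] at hL1
      have hd0 : d < 0 := by
        have : 0 < L := by
          have : 0 < P.C1 G * n / j := by positivity
          rw [← div_lt_iff₀ hj] at hL1
          linarith
        linarith
      nlinarith
    have hev : ∀ᶠ t in nhdsWithin s (Ioi s), p s g0 - L * (t - s) ≤ p t g0 := by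
      have h1 := hd.hasDerivWithinAt (s := Ioi s)
      rw [hasDerivWithinAt_iff_tendsto_slope' (by simp)] at h1
      filter_upwards [h1.eventually (lt_mem_nhds hdb), self_mem_nhdsWithin] with t ht hts
      rw [slope_def_field, lt_div_iff₀ (by simpa using hts)] at ht
      linarith
    rw [eventually_nhdsWithin_iff, Metric.eventually_nhds_iff] at hev
    obtain ⟨δ, hδ, hev⟩ := hev
    obtain ⟨z, hz, hsz, hzw, hzd⟩ := hacc δ hδ
    refine ⟨z, ⟨hz, by linarith, hzw⟩, hsz, hzw, hev ?_ hsz⟩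
    rw [Real.dist_eq, abs_of_pos (by linarith)]
    linarith

/-- The zero of `J v`. -/
def Par.γ (P : Par) (v : ℝ) : ℝ := P.gL * v / (P.k1 - v)

lemma Par.J_eq (P : Par) (hk0 : P.k0 = 0) {v : ℝ} (hv : v < P.k1) (g : ℝ) :
    P.J v g = (P.k1 - v) * (g - P.γ v) := by
  have : P.k1 - v ≠ 0 := by linarith
  unfold Par.J Par.γ
  rw [hk0]
  field_simp
  ring

lemma Par.γ_lt (P : Par) (hk1 : P.V < P.k1) {v : ℝ} (hv : v ∈ Ioo 0 P.V) :
    0 < P.γ v ∧ P.γ v < P.gL * P.V / (P.k1 - P.V) := by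
  have h1 := hv.1; have h2 := hv.2; have h3 := P.hgL; have h4 := P.hV
  have h5 : 0 < P.k1 - v := by linarith
  unfold Par.γ
  refine ⟨by positivity, ?_⟩
  apply div_lt_div₀ (by nlinarith) (by linarith) (by positivity) (by linarith)

lemma pow_cmp {γ d g0 s : ℝ} (hγ : 0 < γ) (hs : 0 < s) (hd : s ^ 10 ≤ d) (hg : s ^ 14 ≤ g0)
    (hdg : γ ≤ g0 + d) :
    s ^ 140 ≤ ((2 / γ) ^ 10 + (2 / γ) ^ 14) * (d ^ 14 * g0 ^ 10) := by
  have hs10 : 0 < s ^ 10 := by positivity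
  have hs14 : 0 < s ^ 14 := by positivity
  have hd0 : 0 < d := by linarith
  have hg00 : 0 < g0 := by linarith
  rcases le_total (γ / 2) g0 with h | h
  · have h1 : s ^ 140 ≤ d ^ 14 := by
      calc s ^ 140 = (s ^ 10) ^ 14 := by ring
        _ ≤ d ^ 14 := by gcongr
    have h2 : 1 ≤ (2 / γ) ^ 10 * g0 ^ 10 := by
      rw [← mul_pow]
      apply one_le_pow₀
      rw [div_mul_eq_mul_div, le_div_iff₀ hγ]; linarith
    calc s ^ 140 ≤ d ^ 14 * 1 := by linarith
      _ ≤ d ^ 14 * ((2 / γ) ^ 10 * g0 ^ 10) := by gcongr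
      _ = (2 / γ) ^ 10 * (d ^ 14 * g0 ^ 10) := by ring
      _ ≤ _ := by gcongr; linarith [show 0 < (2 / γ) ^ 14 by positivity]
  · have h1 : s ^ 140 ≤ g0 ^ 10 := by
      calc s ^ 140 = (s ^ 14) ^ 10 := by ring
        _ ≤ g0 ^ 10 := by gcongr
    have h2 : 1 ≤ (2 / γ) ^ 14 * d ^ 14 := by
      rw [← mul_pow]
      apply one_le_pow₀
      rw [div_mul_eq_mul_div, le_div_iff₀ hγ]; linarith
    calc s ^ 140 ≤ g0 ^ 10 * 1 := by linarith
      _ ≤ g0 ^ 10 * ((2 / γ) ^ 14 * d ^ 14) := by gcongr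
      _ = (2 / γ) ^ 14 * (d ^ 14 * g0 ^ 10) := by ring
      _ ≤ _ := by gcongr; linarith [show 0 < (2 / γ) ^ 10 by positivity]

set_option maxHeartbeats 2000000 in
lemma cross_line {P : Par} {p p1 p2 : ℝ → ℝ → ℝ} (S : Sol P p p1 p2) {G : ℝ} {Z : Set ℝ} {n : ℝ}
    (hZ : Slab P G p p1 p2 Z n) (hk0 : P.k0 = 0) (hk1 : P.V < P.k1)
    (hG : P.gL * P.V / (P.k1 - P.V) + 2 ≤ G) {v : ℝ} (hv : v ∈ Z) {ρ : ℝ} (hρ : 0 < ρ) :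
    ∃ C s0, 0 < s0 ∧ 0 ≤ C ∧ ∀ w ∈ Z, v < w → ∀ s, 0 < s → s ≤ s0 → w - v = s ^ 35 →
      ∀ g0, s ^ 14 ≤ g0 → g0 ≤ G - ρ → s ^ 10 ≤ |g0 - P.γ v| →
        (g0 - P.γ v) * (p v g0 - p w g0) ≤ C * (w - v) := by
  have hσ := P.hσ; have ha := P.ha; have hgi := P.hgin; have hgL := P.hgL; have hV := P.hV
  have hvV := hZ.sub hv
  obtain ⟨hγ0, hγ1⟩ := P.γ_lt hk1 hvV
  set γ := P.γ v with hγ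
  have hG0 : 0 < G := by linarith
  have hC2 : 0 < P.C2 G := by unfold Par.C2; positivity
  have hC1 : 0 < P.C1 G := by unfold Par.C1; positivity
  have hn : 0 < n := by linarith [hZ.n1]
  set κ0 := P.k1 - P.V with hκ0
  have hκ0p : 0 < κ0 := by linarith
  set κ := min 1 ρ / (2 * (1 + G) ^ 2) with hκ
  have hm : 0 < min 1 ρ := lt_min one_pos hρ
  have hκp : 0 < κ := by positivity
  have hκG : κ * (2 * (1 + G) ^ 2) = min 1 ρ := by rw [hκ]; field_simp
  set A := 480 * (4 * P.C2 G) ^ 5 * n with hA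
  set B := (2 / γ) ^ 10 + (2 / γ) ^ 14 with hB
  set C := 8 * P.C1 G * n / κ0 + A * ((4 / κ0) ^ 5 / κ ^ 10) * B with hC
  set s0 := min 1 (min (κ0 / (4 * (G + P.gL))) (κ0 * κ / (8 * P.C2 G))) with hs0
  have hGL : 0 < G + P.gL := by linarith
  refine ⟨C, s0, by positivity, by positivity, ?_⟩
  intro w hw hvw s hs hss hτ g0 hg0 hgρ hd
  have hwV := hZ.sub hw
  set d := |g0 - γ| with hdd
  have hs1 : s ≤ 1 := hss.trans (min_le_left _ _)
  have hs2 : (G + P.gL) * s ≤ κ0 / 4 := by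
    have : s ≤ κ0 / (4 * (G + P.gL)) := hss.trans ((min_le_right _ _).trans (min_le_left _ _))
    rw [le_div_iff₀ (by positivity)] at this
    linarith
  have hs3 : 2 * P.C2 G * s ≤ κ0 * κ / 4 := by
    have : s ≤ κ0 * κ / (8 * P.C2 G) := hss.trans ((min_le_right _ _).trans (min_le_right _ _))
    rw [le_div_iff₀ (by positivity)] at this
    linarith
  have hs10 : 0 < s ^ 10 := by positivity
  have hs14 : 0 < s ^ 14 := by positivity
  have hd0 : 0 < d := by linarith
  have hg00 : 0 < g0 := by linarith
  have hgG : g0 < G := by linarith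
  have hdG : d < G := by
    rw [hdd, abs_lt]; constructor <;> linarith
  set r := κ * d * g0 with hr
  have hr0 : 0 < r := by positivity
  have hrm : r ≤ min 1 ρ / 2 := by
    rw [← hκG]
    have : d * g0 ≤ G * G := by gcongr
    have h2 : G * G ≤ (1 + G) ^ 2 := by nlinarith
    calc r = κ * (d * g0) := by rw [hr]; ring
      _ ≤ κ * (1 + G) ^ 2 := by gcongr; linarith
      _ = _ := by ring
  have hκG2 : κ * G ≤ 1 / 2 := by
    have h1 : κ * (2 * (1 + G) ^ 2) ≤ 1 := by rw [hκG]; exact min_le_left _ _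
    nlinarith [mul_pos hκp hG0, mul_pos (mul_pos hκp hG0) hG0]
  have hrd : r ≤ d / 2 := by
    calc r = κ * g0 * d := by rw [hr]; ring
      _ ≤ κ * G * d := by gcongr
      _ ≤ 1 / 2 * d := by gcongr
      _ = _ := by ring
  have hrg : r ≤ g0 / 2 := by
    calc r ≤ κ * G * g0 := by rw [hr]; gcongr
      _ ≤ 1 / 2 * g0 := by gcongr
      _ = _ := by ring
  have hr1 : r ≤ 1 := by linarith [min_le_left 1 ρ]
  have hrρ : r ≤ ρ / 2 := by linarith [min_le_right 1 ρ]
  set j := κ0 * d / 4 with hj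
  have hj0 : 0 < j := by positivity
  have hτj : (G + P.gL) * (w - v) ≤ j := by
    rw [hτ]
    have h1 : s ^ 35 ≤ s * s ^ 10 := by
      rw [← pow_succ']; exact pow_le_pow_of_le_one hs.le hs1 (by norm_num)
    calc (G + P.gL) * s ^ 35 ≤ (G + P.gL) * (s * s ^ 10) := by gcongr
      _ = ((G + P.gL) * s) * s ^ 10 := by ring
      _ ≤ κ0 / 4 * d := by gcongr
      _ = j := by rw [hj]; ring
  have hsm : 2 * P.C2 G * (w - v) ≤ j * r := by
    rw [hτ]
    calc 2 * P.C2 G * s ^ 35 = (2 * P.C2 G * s) * ((s ^ 10) ^ 2 * s ^ 14) := by ring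
      _ ≤ κ0 * κ / 4 * (d ^ 2 * g0) := by gcongr
      _ = j * r := by rw [hj, hr]; ring
  set L := 2 * P.C1 G * n / j + A * (w - v) ^ 4 / (j * r ^ 2) ^ 5 with hL
  have hdL : d * L ≤ C := by
    have h1 : d * (2 * P.C1 G * n / j) = 8 * P.C1 G * n / κ0 := by
      rw [hj]; field_simp; norm_num
    have h2 : d * (A * (w - v) ^ 4 / (j * r ^ 2) ^ 5) =
        A * ((4 / κ0) ^ 5 / κ ^ 10) * (s ^ 140 / (d ^ 14 * g0 ^ 10)) := by
      rw [hτ, hj, hr]; field_simp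
    have h3 : s ^ 140 / (d ^ 14 * g0 ^ 10) ≤ B := by
      rw [div_le_iff₀ (by positivity)]
      refine pow_cmp hγ0 hs hd hg0 ?_
      rw [hdd]; linarith [neg_abs_le (g0 - γ)]
    rw [hL, mul_add, h1, h2, hC]
    gcongr
  have hτ0 : 0 < w - v := by linarith
  have hvk : v < P.k1 := by linarith [hvV.2]
  have hJv : ∀ t g, P.J t g = (P.k1 - v) * (g - γ) - (g + P.gL) * (t - v) := by
    intro t g
    have h1 := P.J_eq hk0 hvk g
    have h2 : P.J t g = P.J v g - (g + P.gL) * (t - v) := by unfold Par.J; ring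
    rw [h2, h1]
  rcases le_total γ g0 with hgg | hgg
  · have hd' : d = g0 - γ := abs_of_nonneg (by linarith)
    have := line_lemma S hZ hv hw hvw.le hr0 hr1 (g0 := g0) (by linarith) (by linarith) hj0 (by
      intro t ht g hg
      rw [hJv]
      have hg' := abs_le.1 hg
      have h1 : (g + P.gL) * (t - v) ≤ (G + P.gL) * (w - v) :=
        mul_le_mul (by linarith) (by linarith [ht.2]) (by linarith [ht.1]) (by linarith)
      have h2 : κ0 * (d / 2) ≤ (P.k1 - v) * (g - γ) :=
        mul_le_mul (by linarith [hvV.2]) (by linarith) (by positivity) (by linarith)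
      have : j + j = κ0 * (d / 2) := by rw [hj]; ring
      linarith) hsm
    rw [← hd']
    have h1 : p v g0 - p w g0 ≤ L * (w - v) := by linarith
    calc d * (p v g0 - p w g0) ≤ d * (L * (w - v)) := by gcongr
      _ = d * L * (w - v) := by ring
      _ ≤ _ := by gcongr
  · have hd' : d = γ - g0 := by rw [hdd, abs_of_nonpos (by linarith)]; ring
    have hv' : P.V - (P.V - v) ∈ Z := by simpa using hv
    have hw' : P.V - (P.V - w) ∈ Z := by simpa using hw
    have := line_lemma S.refl hZ.refl (v := P.V - w) (w := P.V - v) hw' hv' (by linarith) hr0 hr1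
      (g0 := g0) (by linarith) (by linarith) hj0 (by
      intro t ht g hg
      rw [P.refl_J, hJv]
      have hg' := abs_le.1 hg
      have h1 : 0 ≤ (g + P.gL) * (P.V - t - v) :=
        mul_nonneg (by linarith) (by linarith [ht.2])
      have h2 : κ0 * (d / 2) ≤ (P.k1 - v) * (γ - g) :=
        mul_le_mul (by linarith [hvV.2]) (by linarith) (by positivity) (by linarith)
      have : j + j = κ0 * (d / 2) := by rw [hj]; ring
      nlinarith) (by
        have e : P.V - v - (P.V - w) = w - v := by ring
        rw [e]; exact hsm)
    have e : P.V - v - (P.V - w) = w - v := by ring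
    rw [e] at this
    have e1 : rf P.V p (P.V - w) g0 = p w g0 := by simp [rf]
    have e2 : rf P.V p (P.V - v) g0 = p v g0 := by simp [rf]
    rw [e1, e2] at this
    have h1 : p w g0 - p v g0 ≤ L * (w - v) := by
      have e3 : P.refl.C1 G = P.C1 G := rfl
      have e4 : P.refl.C2 G = P.C2 G := rfl
      rw [e3, e4] at this
      linarith
    calc (g0 - γ) * (p v g0 - p w g0) = d * (p w g0 - p v g0) := by rw [hd']; ring
      _ ≤ d * (L * (w - v)) := by gcongr
      _ = d * L * (w - v) := by ring
      _ ≤ _ := by gcongr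

lemma Eta.mvt (H : Eta) {U B a b : ℝ} (hB0 : 0 ≤ B) (hB : ∀ u ∈ Icc (-U) U, H.f1 u ≤ B)
    (ha : a ∈ Icc (-U) U) (hb : b ∈ Icc (-U) U) :
    ∃ θ ∈ Icc 0 B, H.f a - H.f b = θ * (a - b) := by
  have key : ∀ x y, x ∈ Icc (-U) U → y ∈ Icc (-U) U → x < y →
      ∃ θ ∈ Icc 0 B, H.f y - H.f x = θ * (y - x) := by
    intro x y hx hy hxy
    obtain ⟨c, hc1, hc2⟩ := exists_hasDerivAt_eq_slope H.f H.f1 hxy H.c.continuousOn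
      (fun z _ => H.d1 z)
    refine ⟨H.f1 c, ⟨H.n1 c, hB c ⟨by linarith [hx.1, hc1.1], by linarith [hy.2, hc1.2]⟩⟩, ?_⟩
    rw [hc2, div_mul_cancel₀ _ (by linarith)]
  rcases lt_trichotomy a b with h | h | h
  · obtain ⟨θ, h1, h2⟩ := key a b ha hb h
    exact ⟨θ, h1, by linarith⟩
  · exact ⟨0, ⟨le_rfl, hB0⟩, by rw [h]; simp⟩
  · exact key b a hb ha h

/-- Bundle of bounds. -/
structure Bun (P : Par) {G : ℝ} (p p1 p2 : ℝ → ℝ → ℝ) (T : Tst G) (H : Eta) (Ψ : Psi) (Z : Set ℝ)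
    (v B : ℝ) : Prop where
  one : 1 ≤ B
  k1 : P.k1 ≤ B
  gG : G + P.gL ≤ B
  t0 : ∀ g ∈ Icc 0 G, |T.f g| ≤ B
  t1 : ∀ g ∈ Icc 0 G, |T.f1 g| ≤ B
  t2 : ∀ g ∈ Icc 0 G, |T.f2 g| ≤ B
  e0 : ∀ t ∈ Z, ∀ g ∈ Icc 0 G, |H.f (Ψ.f v g - p t g)| ≤ B
  e1 : ∀ t ∈ Z, ∀ g ∈ Icc 0 G, |H.f1 (Ψ.f v g - p t g)| ≤ B
  e2 : ∀ t ∈ Z, ∀ g ∈ Icc 0 G, |H.f2 (Ψ.f v g - p t g)| ≤ B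
  e3 : ∀ t ∈ Z, ∀ g ∈ Icc 0 G, |H.f (Ψ.f t g - p t g)| ≤ B
  p0 : ∀ t ∈ Z, ∀ g ∈ Icc 0 G, |p t g| ≤ B
  d1 : ∀ t ∈ Z, ∀ g ∈ Icc 0 G, |Ψ.f1 v g - p1 t g| ≤ B
  d2 : ∀ t ∈ Z, ∀ g ∈ Icc 0 G, |Ψ.f2 v g - p2 t g| ≤ B
  lip : ∀ t ∈ Z, ∀ g ∈ Icc 0 G, |H.f (Ψ.f t g - p t g) - H.f (Ψ.f v g - p t g)| ≤ B * B * |t - v|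
  mvt : ∀ t ∈ Z, ∀ g ∈ Icc 0 G, ∃ θ ∈ Icc 0 B,
    H.f (Ψ.f v g - p t g) - H.f (Ψ.f v g - p v g) = θ * (p v g - p t g)
  q2 : ∀ t ∈ Z, ∀ g ∈ Icc 0 G, |p2 t g| ≤ B

lemma bd2 {f : ℝ → ℝ → ℝ} (hf : Continuous fun x : ℝ × ℝ => f x.1 x.2) (V G : ℝ) :
    ∃ B, ∀ t ∈ Icc 0 V, ∀ g ∈ Icc 0 G, |f t g| ≤ B := by
  have hcomp : IsCompact (Icc 0 V ×ˢ Icc 0 G) := isCompact_Icc.prod isCompact_Icc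
  obtain ⟨M, hM⟩ := hcomp.exists_bound_of_continuousOn hf.continuousOn
  exact ⟨M, fun t ht g hg => hM (t, g) ⟨ht, hg⟩⟩

lemma bd1 {f : ℝ → ℝ} (hf : Continuous f) (x y : ℝ) :
    ∃ B, ∀ g ∈ Icc x y, |f g| ≤ B := by
  obtain ⟨M, hM⟩ := isCompact_Icc.exists_bound_of_continuousOn hf.continuousOn
  exact ⟨M, fun g hg => hM g hg⟩

lemma exists_bun {P : Par} {p p1 p2 : ℝ → ℝ → ℝ} {G : ℝ} {Z : Set ℝ} {n : ℝ}
    (hZ : Slab P G p p1 p2 Z n) (T : Tst G) (H : Eta) (Ψ : Psi) {v : ℝ} (hv : v ∈ Z) :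
    ∃ B, Bun P p p1 p2 T H Ψ Z v B := by
  obtain ⟨b1, hb1⟩ := bd2 Ψ.c P.V G
  obtain ⟨b2, hb2⟩ := bd2 Ψ.cv P.V G
  obtain ⟨b3, hb3⟩ := bd2 Ψ.c1 P.V G
  obtain ⟨b4, hb4⟩ := bd2 Ψ.c2 P.V G
  obtain ⟨b5, hb5⟩ := bd1 T.c 0 G
  obtain ⟨b6, hb6⟩ := bd1 T.c1 0 G
  obtain ⟨b7, hb7⟩ := bd1 T.c2 0 G
  set U := b1 + n with hU
  obtain ⟨c0, hc0⟩ := bd1 H.c (-U) U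
  obtain ⟨c1, hc1⟩ := bd1 H.c1 (-U) U
  obtain ⟨c2, hc2⟩ := bd1 H.c2 (-U) U
  have hsub : ∀ t ∈ Z, t ∈ Icc 0 P.V := fun t ht => ⟨(hZ.sub ht).1.le, (hZ.sub ht).2.le⟩
  have hu : ∀ t ∈ Z, ∀ s ∈ Z, ∀ g ∈ Icc 0 G, Ψ.f t g - p s g ∈ Icc (-U) U := by
    intro t ht s hs g hg
    have h1 := abs_le.1 (hb1 t (hsub t ht) g hg)
    have h2 := abs_le.1 (hZ.b0 s hs g hg)
    exact ⟨by linarith, by linarith⟩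
  set B := 1 + |P.k1| + |G + P.gL| + |b2| + |b3| + |b4| + |b5| + |b6| + |b7| + |c0| + |c1| + |c2|
    + |n| with hB
  have a1 := abs_nonneg P.k1; have a2 := abs_nonneg (G + P.gL); have a3 := abs_nonneg b2
  have a4 := abs_nonneg b3; have a5 := abs_nonneg b4; have a6 := abs_nonneg b5
  have a7 := abs_nonneg b6; have a8 := abs_nonneg b7; have a9 := abs_nonneg c0
  have a10 := abs_nonneg c1; have a11 := abs_nonneg c2; have a12 := abs_nonneg n
  have l1 := le_abs_self P.k1; have l2 := le_abs_self (G + P.gL); have l3 := le_abs_self b2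
  have l4 := le_abs_self b3; have l5 := le_abs_self b4; have l6 := le_abs_self b5
  have l7 := le_abs_self b6; have l8 := le_abs_self b7; have l9 := le_abs_self c0
  have l10 := le_abs_self c1; have l11 := le_abs_self c2; have l12 := le_abs_self n
  have hB0 : 0 ≤ B := by linarith
  have hB1 : ∀ u ∈ Icc (-U) U, H.f1 u ≤ B := fun u hu =>
    (le_abs_self _).trans ((hc1 u hu).trans (by linarith))
  refine ⟨B, ⟨by linarith, by linarith, by linarith, fun g hg => (hb5 g hg).trans (by linarith),
    fun g hg => (hb6 g hg).trans (by linarith), fun g hg => (hb7 g hg).trans (by linarith),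
    fun t ht g hg => (hc0 _ (hu v hv t ht g hg)).trans (by linarith),
    fun t ht g hg => (hc1 _ (hu v hv t ht g hg)).trans (by linarith),
    fun t ht g hg => (hc2 _ (hu v hv t ht g hg)).trans (by linarith),
    fun t ht g hg => (hc0 _ (hu t ht t ht g hg)).trans (by linarith),
    fun t ht g hg => (hZ.b0 t ht g hg).trans (by linarith), ?_, ?_, ?_, ?_,
    fun t ht g hg => (hZ.b2 t ht g hg).trans (by linarith)⟩⟩
  · intro t ht g hg
    have h1 := abs_le.1 (hb3 v (hsub v hv) g hg)
    have h2 := abs_le.1 (hZ.b1 t ht g hg)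
    exact abs_le.2 ⟨by linarith, by linarith⟩
  · intro t ht g hg
    have h1 := abs_le.1 (hb4 v (hsub v hv) g hg)
    have h2 := abs_le.1 (hZ.b2 t ht g hg)
    exact abs_le.2 ⟨by linarith, by linarith⟩
  · intro t ht g hg
    obtain ⟨θ, h1, h2⟩ := H.mvt hB0 hB1 (hu t ht t ht g hg) (hu v hv t ht g hg)
    rw [h2, abs_mul, abs_of_nonneg h1.1, mul_assoc]
    refine mul_le_mul h1.2 ?_ (abs_nonneg _) hB0
    have : Ψ.f t g - p t g - (Ψ.f v g - p t g) = Ψ.f t g - Ψ.f v g := by ring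
    rw [this]
    have := (convex_Icc (0:ℝ) P.V).norm_image_sub_le_of_norm_hasDerivWithin_le
      (f := fun t => Ψ.f t g) (f' := fun t => Ψ.fv t g) (C := B)
      (fun x _ => (Ψ.dv x g).hasDerivWithinAt)
      (fun x hx => (hb2 x hx g hg).trans (by linarith)) (hsub v hv) (hsub t ht)
    simpa [Real.norm_eq_abs] using this
  · intro t ht g hg
    obtain ⟨θ, h1, h2⟩ := H.mvt hB0 hB1 (hu v hv t ht g hg) (hu v hv v hv g hg)
    exact ⟨θ, h1, by rw [h2]; ring⟩

/-- the increment of the integrand of `Y` -/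
def Dw (P : Par) {G : ℝ} (T : Tst G) (H : Eta) (Ψ : Psi) (p : ℝ → ℝ → ℝ) (v w g : ℝ) : ℝ :=
  Yk P T H Ψ w g (p w g) - Yk P T H Ψ v g (p v g)

def Ew {G : ℝ} (T : Tst G) (H : Eta) (Ψ : Psi) (p : ℝ → ℝ → ℝ) (v w g : ℝ) : ℝ :=
  T.f g * (H.f (Ψ.f v g - p w g) - H.f (Ψ.f v g - p v g))

lemma Dw_cont {P : Par} {p p1 p2 : ℝ → ℝ → ℝ} (S : Sol P p p1 p2) {G : ℝ} (T : Tst G) (H : Eta)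
    (Ψ : Psi) {v w : ℝ} (hv : v ∈ Ioo 0 P.V) (hw : w ∈ Ioo 0 P.V) :
    Continuous (Dw P T H Ψ p v w) := by
  have h : ∀ t ∈ Ioo 0 P.V, Continuous fun g => Yk P T H Ψ t g (p t g) := fun t ht =>
    (Yk_cont P T H Ψ).comp (continuous_const.prodMk (continuous_id.prodMk (S.c0 t ht)))
  exact (h w hw).sub (h v hv)

lemma Ew_cont {P : Par} {p p1 p2 : ℝ → ℝ → ℝ} (S : Sol P p p1 p2) {G : ℝ} (T : Tst G) (H : Eta)
    (Ψ : Psi) {v w : ℝ} (hv : v ∈ Ioo 0 P.V) (hw : w ∈ Ioo 0 P.V) :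
    Continuous (Ew T H Ψ p v w) := by
  have := T.c; have := H.c; have := S.c0 v hv; have := S.c0 w hw
  have h4 : Continuous fun g => Ψ.f v g := Ψ.c.comp (continuous_const.prodMk continuous_id)
  unfold Ew
  fun_prop

lemma Dw_le {P : Par} {p p1 p2 : ℝ → ℝ → ℝ} (S : Sol P p p1 p2) {G : ℝ} {T : Tst G} {H : Eta}
    {Ψ : Psi} {Z : Set ℝ} {v B : ℝ} (hB : Bun P p p1 p2 T H Ψ Z v B) (hk0 : P.k0 = 0)
    (hk1 : P.V < P.k1) (hvV : v ∈ Ioo 0 P.V) (hγ : P.γ v ≤ G) {w : ℝ} (hw : w ∈ Z) (hvw : v ≤ w)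
    {g : ℝ} (hg : g ∈ Icc 0 G) :
    Dw P T H Ψ p v w g ≤ (B ^ 3 + B ^ 5) * (w - v) + (P.k1 - v) * ((g - P.γ v) * Ew T H Ψ p v w g) := by
  have hγ0 := (P.γ_lt hk1 hvV).1
  have h1 := P.J_eq hk0 (show v < P.k1 by linarith [hvV.2]) g
  have h2 : P.J w g = P.J v g - (g + P.gL) * (w - v) := by unfold Par.J; ring
  have hB1 := hB.one
  have hgB := hB.gG
  have hgL := P.hgL
  have hT0 := T.nonneg g
  have hTB := (le_abs_self _).trans (hB.t0 g hg)
  have e3 := abs_le.1 (hB.e3 w hw g hg)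
  have lip := abs_le.1 (hB.lip w hw g hg)
  have hn0 := H.n0 (Ψ.f w g - p w g)
  have hJB : |P.J v g| ≤ B * B := by
    rw [h1, abs_mul, abs_of_pos (by linarith [hvV.2])]
    refine mul_le_mul (by linarith [hvV.1, hB.k1]) ?_ (abs_nonneg _) (by linarith)
    rw [abs_le]; constructor <;> linarith [hg.1, hg.2]
  have hid : Dw P T H Ψ p v w g = -(T.f g * ((g + P.gL) * (w - v) * H.f (Ψ.f w g - p w g)))
      + T.f g * (P.J v g * (H.f (Ψ.f w g - p w g) - H.f (Ψ.f v g - p w g)))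
      + (P.k1 - v) * ((g - P.γ v) * Ew T H Ψ p v w g) := by
    unfold Dw Yk Ew
    rw [h2, h1]
    ring
  rw [hid]
  have hτ : 0 ≤ w - v := by linarith
  have i1 : 0 ≤ T.f g * ((g + P.gL) * (w - v) * H.f (Ψ.f w g - p w g)) :=
    mul_nonneg hT0 (mul_nonneg (mul_nonneg (by linarith [hg.1]) hτ) hn0)
  have i2 : T.f g * (P.J v g * (H.f (Ψ.f w g - p w g) - H.f (Ψ.f v g - p w g))) ≤
      B ^ 5 * (w - v) := by
    have hl := hB.lip w hw g hg
    rw [abs_of_nonneg hτ] at hl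
    have : P.J v g * (H.f (Ψ.f w g - p w g) - H.f (Ψ.f v g - p w g)) ≤
        (B * B) * (B * B * (w - v)) := by
      refine (le_abs_self _).trans ?_
      rw [abs_mul]
      exact mul_le_mul hJB hl (abs_nonneg _) (by positivity)
    have h0 : 0 ≤ (B * B) * (B * B * (w - v)) := by positivity
    calc _ ≤ T.f g * ((B * B) * (B * B * (w - v))) := by gcongr
      _ ≤ B * ((B * B) * (B * B * (w - v))) := by gcongr
      _ = _ := by ring
  have i3 : 0 ≤ B ^ 3 * (w - v) := by positivity
  linarith

lemma Ew_odd {P : Par} {p p1 p2 : ℝ → ℝ → ℝ} (S : Sol P p p1 p2) {G : ℝ} {T : Tst G} {H : Eta}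
    {Ψ : Psi} {Z : Set ℝ} {v B : ℝ} (hB : Bun P p p1 p2 T H Ψ Z v B) (hvZ : v ∈ Z)
    (hsub : Z ⊆ Ioo 0 P.V) {w γ j X : ℝ} (hw : w ∈ Z) (hj : 0 < j) (hX : 0 ≤ X)
    (h0 : 0 ≤ γ - j) (h1 : γ + j ≤ G)
    (hX1 : Ew T H Ψ p v w (γ + j) ≤ X) (hX2 : -X ≤ Ew T H Ψ p v w (γ - j)) :
    ∫ g in (γ - j)..(γ + j), (g - γ) * Ew T H Ψ p v w g ≤
      2 * X * j ^ 2 + 4 * (8 * B ^ 4 + 4 * B ^ 3) * j ^ 4 := by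
  have hv := hsub hvZ
  have hwV := hsub hw
  have i1 := T.c; have i2 := H.c; have i3 := H.c1; have i4 := S.c0 v hv; have i5 := S.c1 v hv
  have j4 := S.c0 w hwV; have j5 := S.c1 w hwV
  have i7 := T.c1
  have h4 : Continuous fun g => Ψ.f v g := Ψ.c.comp (continuous_const.prodMk continuous_id)
  have h5 : Continuous fun g => Ψ.f1 v g := Ψ.c1.comp (continuous_const.prodMk continuous_id)
  have hB1 := hB.one
  set U1 : ℝ → ℝ → ℝ := fun t g => H.f1 (Ψ.f v g - p t g) * (Ψ.f1 v g - p1 t g) with hU1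
  set U2 : ℝ → ℝ → ℝ := fun t g => H.f2 (Ψ.f v g - p t g) * (Ψ.f1 v g - p1 t g) ^ 2
    + H.f1 (Ψ.f v g - p t g) * (Ψ.f2 v g - p2 t g) with hU2
  have dU : ∀ t ∈ Z, ∀ g, 0 < g → HasDerivAt (fun g => H.f (Ψ.f v g - p t g)) (U1 t g) g := by
    intro t ht g hg
    exact (H.d1 _).comp g ((Ψ.d1 v g).sub (S.d1 t (hsub ht) g hg))
  have dU1 : ∀ t ∈ Z, ∀ g, 0 < g → HasDerivAt (U1 t) (U2 t g) g := by
    intro t ht g hg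
    have a := (H.d2 (Ψ.f v g - p t g)).comp g ((Ψ.d1 v g).sub (S.d1 t (hsub ht) g hg))
    have b := (Ψ.d2 v g).sub (S.d2 t (hsub ht) g hg)
    refine HasDerivAt.congr_deriv (a.mul b) ?_
    simp only [hU2, Function.comp, Pi.sub_apply]
    ring
  have bU : ∀ t ∈ Z, ∀ g ∈ Icc 0 G, |H.f (Ψ.f v g - p t g)| ≤ B := hB.e0
  have bU1 : ∀ t ∈ Z, ∀ g ∈ Icc 0 G, |U1 t g| ≤ B ^ 2 := by
    intro t ht g hg
    simp only [hU1]
    rw [abs_mul, sq]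
    exact mul_le_mul (hB.e1 t ht g hg) (hB.d1 t ht g hg) (abs_nonneg _) (by linarith)
  have bU2 : ∀ t ∈ Z, ∀ g ∈ Icc 0 G, |U2 t g| ≤ B ^ 3 + B ^ 2 := by
    intro t ht g hg
    simp only [hU2]
    refine (abs_add_le _ _).trans (add_le_add ?_ ?_)
    · rw [abs_mul, abs_pow, pow_succ' B 2]
      exact mul_le_mul (hB.e2 t ht g hg) (pow_le_pow_left₀ (abs_nonneg _) (hB.d1 t ht g hg) 2)
        (by positivity) (by linarith)
    · rw [abs_mul, sq]
      exact mul_le_mul (hB.e1 t ht g hg) (hB.d2 t ht g hg) (abs_nonneg _) (by linarith)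
  have hsubI : Ioo (γ - j) (γ + j) ⊆ Icc 0 G := fun z hz => ⟨by linarith [hz.1], by linarith [hz.2]⟩
  have hpos : ∀ z ∈ Ioo (γ - j) (γ + j), 0 < z := fun z hz => by linarith [hz.1]
  refine odd_interp (E := Ew T H Ψ p v w)
    (E1 := fun g => T.f1 g * (H.f (Ψ.f v g - p w g) - H.f (Ψ.f v g - p v g))
      + T.f g * (U1 w g - U1 v g))
    (E2 := fun g => T.f2 g * (H.f (Ψ.f v g - p w g) - H.f (Ψ.f v g - p v g))
      + T.f1 g * (U1 w g - U1 v g) + (T.f1 g * (U1 w g - U1 v g) + T.f g * (U2 w g - U2 v g)))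
    hj hX ?_ ?_ ?_ ?_ ?_ hX1 hX2
  · exact (Ew_cont S T H Ψ hv hwV).continuousOn
  · apply Continuous.continuousOn
    simp only [hU1]
    fun_prop
  · intro z hz
    exact (T.d1 z).mul ((dU w hw z (hpos z hz)).sub (dU v hvZ z (hpos z hz)))
  · intro z hz
    exact ((T.d2 z).mul ((dU w hw z (hpos z hz)).sub (dU v hvZ z (hpos z hz)))).add
      ((T.d1 z).mul ((dU1 w hw z (hpos z hz)).sub (dU1 v hvZ z (hpos z hz))))
  · intro z hz
    have hz' := hsubI hz
    have m1 : ∀ x y a b : ℝ, |x| ≤ B → |a| ≤ y → |b| ≤ y → |x * (a - b)| ≤ 2 * B * y := by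
      intro x y a b h1 h2 h3
      rw [abs_mul]
      have : |a - b| ≤ 2 * y := (abs_sub a b).trans (by linarith)
      calc |x| * |a - b| ≤ B * (2 * y) := mul_le_mul h1 this (abs_nonneg _) (by linarith)
        _ = _ := by ring
    have a1 := m1 _ _ _ _ (hB.t2 z hz') (bU w hw z hz') (bU v hvZ z hz')
    have a2 := m1 _ _ _ _ (hB.t1 z hz') (bU1 w hw z hz') (bU1 v hvZ z hz')
    have a3 := m1 _ _ _ _ (hB.t0 z hz') (bU2 w hw z hz') (bU2 v hvZ z hz')
    have hBB : B * B ≤ B ^ 3 := by nlinarith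
    have hBB2 : B ^ 3 ≤ B ^ 4 := by
      have : 0 ≤ B ^ 3 := by positivity
      nlinarith
    refine (abs_add_le _ _).trans ((add_le_add (abs_add_le _ _) (abs_add_le _ _)).trans ?_)
    have hsum : 2 * B * B + 2 * B * B ^ 2 + (2 * B * B ^ 2 + 2 * B * (B ^ 3 + B ^ 2))
        ≤ 8 * B ^ 4 + 4 * B ^ 3 := by nlinarith
    refine le_trans ?_ hsum
    linarith

set_option maxHeartbeats 2000000 in
lemma cross_est {P : Par} {p p1 p2 : ℝ → ℝ → ℝ} (S : Sol P p p1 p2) {G : ℝ} {Z : Set ℝ} {n : ℝ}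
    (hZ : Slab P G p p1 p2 Z n) (hk0 : P.k0 = 0) (hk1 : P.V < P.k1)
    (hG : P.gL * P.V / (P.k1 - P.V) + 2 ≤ G) {v : ℝ} (hv : v ∈ Z) (T : Tst G) (H : Eta) (Ψ : Psi) :
    ∃ C s0, 0 < s0 ∧ s0 ≤ 1 ∧ 0 ≤ C ∧ ∀ w ∈ Z, v < w → ∀ s, 0 < s → s ≤ s0 → w - v = s ^ 35 →
      (∀ g ∈ Icc (s ^ 14) G, s ^ 10 ≤ |g - P.γ v| → Dw P T H Ψ p v w g ≤ C * (w - v)) ∧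
      (∫ g in (0:ℝ)..(s ^ 14), Dw P T H Ψ p v w g ≤ C * s * (w - v)) ∧
      (∫ g in (P.γ v - s ^ 10)..(P.γ v + s ^ 10), Dw P T H Ψ p v w g ≤ C * s * (w - v)) ∧
      s ^ 14 ≤ P.γ v - s ^ 10 ∧ P.γ v + s ^ 10 ≤ G := by
  obtain ⟨B, hB⟩ := exists_bun hZ T H Ψ hv
  obtain ⟨ρ0, hρ0, hsupp0⟩ := T.supp
  set ρ := min ρ0 1 with hρd
  have hρ : 0 < ρ := lt_min hρ0 one_pos
  have hρ1 : ρ ≤ 1 := min_le_right _ _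
  have hsupp : ∀ g, G - ρ ≤ g → T.f g = 0 := fun g hg => hsupp0 g (by
    linarith [min_le_left ρ0 1])
  obtain ⟨C0, s1, hs1, hC0, hline⟩ := cross_line S hZ hk0 hk1 hG hv hρ
  have hvV := hZ.sub hv
  obtain ⟨hγ0, hγ1⟩ := P.γ_lt hk1 hvV
  set γ := P.γ v with hγ
  have hγG : γ ≤ G - 2 := by linarith
  have hB1 := hB.one
  have hkv : 0 < P.k1 - v := by linarith [hvV.2]
  have hkB : P.k1 - v ≤ B := by linarith [hvV.1, hB.k1]
  have hgL := P.hgL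
  have hGB : G ≤ B := by linarith [hB.gG]
  set M2 := B * B * C0 with hM2
  set M3 := 2 * B ^ 2 * C0 + 2 * B ^ 4 with hM3
  set K := 8 * B ^ 4 + 4 * B ^ 3 with hK
  set C := 2 * (B ^ 3 + B ^ 5) + B * M2 + 2 * B * M3 + B * (2 * M2 + 4 * K) with hC
  have hM20 : 0 ≤ M2 := by positivity
  have hM30 : 0 ≤ M3 := by positivity
  have hK0 : 0 ≤ K := by positivity
  have hC00 : 0 ≤ C := by positivity
  refine ⟨C, min s1 (min 1 (γ / 2)), by positivity, (min_le_right _ _).trans (min_le_left _ _),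
    hC00, ?_⟩
  intro w hw hvw s hs hss hτ
  have hsa : s ≤ s1 := hss.trans (min_le_left _ _)
  have hsb : s ≤ 1 := hss.trans ((min_le_right _ _).trans (min_le_left _ _))
  have hsc : s ≤ γ / 2 := hss.trans ((min_le_right _ _).trans (min_le_right _ _))
  have hp10 : s ^ 10 ≤ s := by
    simpa using pow_le_pow_of_le_one hs.le hsb (show 1 ≤ 10 by norm_num)
  have hp14 : s ^ 14 ≤ s := by
    simpa using pow_le_pow_of_le_one hs.le hsb (show 1 ≤ 14 by norm_num)
  have hs10 : 0 < s ^ 10 := by positivity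
  have hs14 : 0 < s ^ 14 := by positivity
  have hl := hline w hw hvw s hs hsa hτ
  set τ := w - v with hτd
  have hτ0 : 0 < τ := by linarith
  have hwV := hZ.sub hw
  have hDc := Dw_cont S T H Ψ hvV hwV
  have hEc := Ew_cont S T H Ψ hvV hwV
  have hDle : ∀ g ∈ Icc 0 G, Dw P T H Ψ p v w g ≤
      (B ^ 3 + B ^ 5) * τ + (P.k1 - v) * ((g - γ) * Ew T H Ψ p v w g) := fun g hg =>
    Dw_le S hB hk0 hk1 hvV (by linarith) hw hvw.le hg
  -- the good region
  have hE : ∀ g ∈ Icc (s ^ 14) G, s ^ 10 ≤ |g - γ| → (g - γ) * Ew T H Ψ p v w g ≤ M2 * τ := by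
    intro g hg hgd
    rcases le_total (G - ρ) g with h | h
    · have : (g - γ) * Ew T H Ψ p v w g = 0 := by simp [Ew, hsupp g h]
      rw [this]; positivity
    · have h1 := hl g hg.1 h hgd
      have hgI : g ∈ Icc 0 G := ⟨by linarith [hg.1], hg.2⟩
      obtain ⟨θ, hθ, hθe⟩ := hB.mvt w hw g hgI
      have : (g - γ) * Ew T H Ψ p v w g = T.f g * θ * ((g - γ) * (p v g - p w g)) := by
        unfold Ew; rw [hθe]; ring
      rw [this]
      have hT0 := T.nonneg g
      have hTB := (le_abs_self _).trans (hB.t0 g hgI)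
      have hθ0 := hθ.1
      calc _ ≤ T.f g * θ * (C0 * τ) := by gcongr
        _ ≤ B * B * (C0 * τ) := by
          gcongr
          exact hθ.2
        _ = _ := by rw [hM2]; ring
  refine ⟨?_, ?_, ?_, by linarith, by linarith⟩
  · intro g hg hgd
    have h1 := hDle g ⟨by linarith [hg.1], hg.2⟩
    have h2 := hE g hg hgd
    have h3 : (P.k1 - v) * ((g - γ) * Ew T H Ψ p v w g) ≤ B * (M2 * τ) :=
      (mul_le_mul_of_nonneg_left h2 hkv.le).trans (mul_le_mul_of_nonneg_right hkB (by positivity))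
    have h4 : ((B ^ 3 + B ^ 5) + B * M2) * τ ≤ C * τ := by
      apply mul_le_mul_of_nonneg_right _ hτ0.le
      have : 0 ≤ (B ^ 3 + B ^ 5) + 2 * B * M3 + B * (2 * M2 + 4 * K) := by positivity
      rw [hC]; linarith
    linarith
  · -- near zero
    have hx0G : s ^ 14 ≤ G := by linarith
    have hpt : ∀ g ∈ Icc 0 (s ^ 14), Dw P T H Ψ p v w g ≤
        (B ^ 3 + B ^ 5) * τ + B * (M3 * (τ + s ^ 28)) := by
      intro g hg
      have hgI : g ∈ Icc 0 G := ⟨hg.1, hg.2.trans hx0G⟩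
      have hX1 : p w (s ^ 14) - p v (s ^ 14) ≤ 2 * C0 * τ / γ := by
        have h1 := hl (s ^ 14) le_rfl (by linarith) (by
          rw [abs_of_nonpos (by linarith)]; linarith)
        rw [le_div_iff₀ hγ0]
        rcases le_total (p w (s ^ 14) - p v (s ^ 14)) 0 with h | h
        · have : 0 ≤ 2 * C0 * τ := by positivity
          nlinarith
        · nlinarith
      have hrb := robin_bound (e := fun g => p w g - p v g) (e1 := fun g => p1 w g - p1 v g)
        (e2 := fun g => p2 w g - p2 v g) (x0 := s ^ 14) (n := 2 * B) (X := 2 * C0 * τ / γ)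
        (k := P.gin / P.a) hs14 (by have := P.hgin; have := P.ha; positivity) (by linarith)
        (by positivity) ((S.c0 w hwV).sub (S.c0 v hvV)).continuousOn
        ((S.c1 w hwV).sub (S.c1 v hvV)).continuousOn
        (fun z hz => (S.d1 w hwV z hz.1).sub (S.d1 v hvV z hz.1))
        (fun z hz => (S.d2 w hwV z hz.1).sub (S.d2 v hvV z hz.1))
        (fun z hz => by
          have hzI : z ∈ Icc 0 G := ⟨hz.1.le, by linarith [hz.2]⟩
          have a1 := hB.q2 w hw z hzI
          have a2 := hB.q2 v hv z hzI
          exact (abs_sub _ _).trans (by linarith))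
        (by
          have a1 := S.robin w hwV; have a2 := S.robin v hvV
          have := P.ha
          field_simp
          linarith)
        hX1 g hg
      obtain ⟨θ, hθ, hθe⟩ := hB.mvt w hw g hgI
      have hid : (g - γ) * Ew T H Ψ p v w g = T.f g * θ * ((γ - g) * (p w g - p v g)) := by
        unfold Ew; rw [hθe]; ring
      have hT0 := T.nonneg g
      have hTB := (le_abs_self _).trans (hB.t0 g hgI)
      have hθ0 := hθ.1
      set XX := 2 * C0 * τ / γ + 2 * B * (s ^ 14) ^ 2 with hXX
      have hXX0 : 0 ≤ XX := by positivity
      have hγg : 0 ≤ γ - g := by linarith [hg.2]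
      have h2 : (g - γ) * Ew T H Ψ p v w g ≤ M3 * (τ + s ^ 28) := by
        rw [hid]
        calc _ ≤ T.f g * θ * ((γ - g) * XX) := by gcongr
          _ ≤ B * B * (γ * XX) := by
            gcongr
            · exact hθ.2
            · linarith [hg.1]
          _ = 2 * B ^ 2 * C0 * τ + 2 * B ^ 3 * γ * s ^ 28 := by
            rw [hXX]; field_simp
          _ ≤ 2 * B ^ 2 * C0 * τ + 2 * B ^ 3 * B * s ^ 28 := by
            gcongr; linarith
          _ ≤ M3 * (τ + s ^ 28) := by
            rw [hM3]
            have q1 : 0 ≤ 2 * B ^ 2 * C0 * s ^ 28 := by positivity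
            have q2 : 0 ≤ 2 * B ^ 4 * τ := by positivity
            nlinarith
      have h1 := hDle g hgI
      have h3 : (P.k1 - v) * ((g - γ) * Ew T H Ψ p v w g) ≤ B * (M3 * (τ + s ^ 28)) :=
        (mul_le_mul_of_nonneg_left h2 hkv.le).trans (mul_le_mul_of_nonneg_right hkB (by positivity))
      linarith
    have hint : ∫ g in (0:ℝ)..(s ^ 14), Dw P T H Ψ p v w g ≤
        ∫ g in (0:ℝ)..(s ^ 14), ((B ^ 3 + B ^ 5) * τ + B * (M3 * (τ + s ^ 28))) :=
      intervalIntegral.integral_mono_on hs14.le (hDc.intervalIntegrable _ _)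
        intervalIntegrable_const hpt
    rw [intervalIntegral.integral_const, smul_eq_mul, sub_zero] at hint
    refine hint.trans ?_
    have q1 : s ^ 14 * τ ≤ s * τ := by gcongr
    have q2 : s ^ 14 * s ^ 28 ≤ s * τ := by
      rw [hτ, ← pow_add, ← pow_succ']
      exact pow_le_pow_of_le_one hs.le hsb (by norm_num)
    calc s ^ 14 * ((B ^ 3 + B ^ 5) * τ + B * (M3 * (τ + s ^ 28)))
        = (B ^ 3 + B ^ 5 + B * M3) * (s ^ 14 * τ) + B * M3 * (s ^ 14 * s ^ 28) := by ring
      _ ≤ (B ^ 3 + B ^ 5 + B * M3) * (s * τ) + B * M3 * (s * τ) := by gcongr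
      _ = (B ^ 3 + B ^ 5 + 2 * B * M3) * (s * τ) := by ring
      _ ≤ C * (s * τ) := by
        apply mul_le_mul_of_nonneg_right _ (by positivity)
        have : 0 ≤ (B ^ 3 + B ^ 5) + B * M2 + B * (2 * M2 + 4 * K) := by positivity
        rw [hC]; linarith
      _ = _ := by ring
  · -- near γ
    have hX0 : 0 ≤ M2 * τ / s ^ 10 := by positivity
    have hodd := Ew_odd S hB hv hZ.sub hw hs10 hX0 (γ := γ) (by linarith) (by linarith) (by
      have := hE (γ + s ^ 10) ⟨by linarith, by linarith⟩ (by
        rw [show γ + s ^ 10 - γ = s ^ 10 by ring, abs_of_pos hs10])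
      rw [le_div_iff₀ hs10]
      linarith) (by
      have := hE (γ - s ^ 10) ⟨by linarith, by linarith⟩ (by
        rw [show γ - s ^ 10 - γ = -s ^ 10 by ring, abs_neg, abs_of_pos hs10])
      rw [neg_le, le_div_iff₀ hs10]
      linarith)
    have hint : ∫ g in (γ - s ^ 10)..(γ + s ^ 10), Dw P T H Ψ p v w g ≤
        ∫ g in (γ - s ^ 10)..(γ + s ^ 10),
          ((B ^ 3 + B ^ 5) * τ + (P.k1 - v) * ((g - γ) * Ew T H Ψ p v w g)) :=
      intervalIntegral.integral_mono_on (by linarith) (hDc.intervalIntegrable _ _)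
        ((by fun_prop : Continuous fun g => ((B ^ 3 + B ^ 5) * τ + (P.k1 - v) *
          ((g - γ) * Ew T H Ψ p v w g))).intervalIntegrable _ _)
        (fun g hg => hDle g ⟨by linarith [hg.1], by linarith [hg.2]⟩)
    rw [intervalIntegral.integral_add intervalIntegrable_const
      ((by fun_prop : Continuous fun g => (P.k1 - v) *
          ((g - γ) * Ew T H Ψ p v w g)).intervalIntegrable _ _),
      intervalIntegral.integral_const, intervalIntegral.integral_const_mul, smul_eq_mul] at hint
    refine hint.trans ?_
    have q0 : 2 * (M2 * τ / s ^ 10) * (s ^ 10) ^ 2 = 2 * M2 * (s ^ 10 * τ) := by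
      field_simp
    rw [q0] at hodd
    have q1 : s ^ 10 * τ ≤ s * τ := by gcongr
    have q2 : (s ^ 10) ^ 4 ≤ s * τ := by
      rw [hτ, ← pow_mul, ← pow_succ']
      exact pow_le_pow_of_le_one hs.le hsb (by norm_num)
    have hR : 2 * M2 * (s ^ 10 * τ) + 4 * K * (s ^ 10) ^ 4 ≤ (2 * M2 + 4 * K) * (s * τ) := by
      have a1 : 2 * M2 * (s ^ 10 * τ) ≤ 2 * M2 * (s * τ) := by gcongr
      have a2 : 4 * K * (s ^ 10) ^ 4 ≤ 4 * K * (s * τ) := by gcongr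
      linarith
    have h3 := (mul_le_mul_of_nonneg_left (hodd.trans hR) hkv.le).trans
      (mul_le_mul_of_nonneg_right hkB (by positivity))
    have h4 : (γ + s ^ 10 - (γ - s ^ 10)) * ((B ^ 3 + B ^ 5) * τ) ≤
        2 * (B ^ 3 + B ^ 5) * (s * τ) := by
      calc _ = 2 * (B ^ 3 + B ^ 5) * (s ^ 10 * τ) := by ring
        _ ≤ _ := by gcongr
    calc _ ≤ 2 * (B ^ 3 + B ^ 5) * (s * τ) + B * ((2 * M2 + 4 * K) * (s * τ)) := add_le_add h4 h3
      _ = (2 * (B ^ 3 + B ^ 5) + B * (2 * M2 + 4 * K)) * (s * τ) := by ring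
      _ ≤ C * (s * τ) := by
        apply mul_le_mul_of_nonneg_right _ (by positivity)
        have : 0 ≤ B * M2 + 2 * B * M3 := by positivity
        rw [hC]; linarith
      _ = _ := by ring

lemma Yk_hasDeriv {P : Par} {p p1 p2 : ℝ → ℝ → ℝ} (S : Sol P p p1 p2) {G : ℝ} (T : Tst G) (H : Eta)
    (Ψ : Psi) {v : ℝ} (hv : v ∈ Ioo 0 P.V) {g : ℝ} (hg : 0 < g) :
    HasDerivAt (fun t => Yk P T H Ψ t g (p t g)) (qd P T H Ψ p p1 p2 v g) v := by
  obtain ⟨d, hd, he⟩ := S.pde v hv g hg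
  have h1 : HasDerivAt (fun t => P.J t g) (-(g + P.gL)) v := by
    have := ((hasDerivAt_id v).const_mul (g + P.gL)).const_sub (P.k1 * g + P.k0)
    refine HasDerivAt.congr_deriv this ?_
    ring
  have h2 := (H.d1 (Ψ.f v g - p v g)).comp v ((Ψ.dv v g).sub hd)
  have h3 := (h1.mul_const (T.f g)).mul h2
  refine HasDerivAt.congr_deriv h3 ?_
  simp only [qd, Function.comp, Pi.sub_apply]
  linear_combination (-(T.f g * H.f1 (Ψ.f v g - p v g))) * he

set_option maxHeartbeats 2000000 in
lemma cross_step {P : Par} {p p1 p2 : ℝ → ℝ → ℝ} (S : Sol P p p1 p2) {G : ℝ} {Z : Set ℝ} {n : ℝ}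
    (hZ : Slab P G p p1 p2 Z n) (hk0 : P.k0 = 0) (hk1 : P.V < P.k1)
    (hG : P.gL * P.V / (P.k1 - P.V) + 2 ≤ G) {v : ℝ} (hv : v ∈ Z)
    (hacc : ∀ δ > 0, ∃ z ∈ Z, v < z ∧ z < v + δ) (T : Tst G) (H : Eta) (Ψ : Psi)
    {ε δ : ℝ} (hε : 0 < ε) (hδ : 0 < δ) :
    ∃ w, v < w ∧ w < v + δ ∧ Df P T H Ψ p w ≤ Df P T H Ψ p v + ε * (w - v) := by
  have hvV := hZ.sub hv
  have hG0 : 0 ≤ G := by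
    have := P.hgL; have := P.hV
    have : 0 ≤ P.gL * P.V / (P.k1 - P.V) := div_nonneg (by positivity) (by linarith)
    linarith
  obtain ⟨C, s0, hs0, hs1, hC, hest⟩ := cross_est S hZ hk0 hk1 hG hv T H Ψ
  choose w hwZ hvw hwδ using fun n : ℕ => hacc (1 / ((n:ℝ) + 1)) (by positivity)
  have hwlim : Tendsto w atTop (nhds v) := by
    have h1 : Tendsto (fun n : ℕ => v + 1 / ((n:ℝ) + 1)) atTop (nhds v) := by
      simpa using (tendsto_one_div_add_atTop_nhds_zero_nat (𝕜 := ℝ)).const_add v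
    exact tendsto_of_tendsto_of_tendsto_of_le_of_le tendsto_const_nhds h1
      (fun n => (hvw n).le) (fun n => (hwδ n).le)
  set s : ℕ → ℝ := fun n => (w n - v) ^ (((35:ℕ):ℝ)⁻¹) with hs
  have hspos : ∀ n, 0 < s n := fun n => Real.rpow_pos_of_pos (by linarith [hvw n]) _
  have hs35 : ∀ n, w n - v = s n ^ 35 := fun n =>
    (Real.rpow_inv_natCast_pow (by linarith [hvw n]) (by norm_num)).symm
  have hslim : Tendsto s atTop (nhds 0) := by
    have h1 : Tendsto (fun n => w n - v) atTop (nhds 0) := by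
      simpa using hwlim.sub_const v
    have h2 := ((Real.continuous_rpow_const (q := (((35:ℕ):ℝ)⁻¹)) (by positivity)).tendsto 0).comp h1
    rw [Real.zero_rpow (by norm_num)] at h2
    exact h2
  set Q : ℝ → ℝ := qd P T H Ψ p p1 p2 v with hQ
  have cQ : Continuous Q := qd_cont S T H Ψ hvV
  obtain ⟨B0, hB0⟩ := (isCompact_Icc (a := (0:ℝ)) (b := G)).exists_bound_of_continuousOn
    cQ.continuousOn
  have hB00 : 0 ≤ B0 := (norm_nonneg _).trans (hB0 0 ⟨le_rfl, hG0⟩)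
  set Bh := C + B0 + 1 with hBh
  set h : ℕ → ℝ → ℝ := fun n g => max (min (Dw P T H Ψ p v (w n) g / (w n - v)) C) (Q g - 1) with hh
  have ch : ∀ n, Continuous (h n) := by
    intro n
    have := Dw_cont S T H Ψ hvV (hZ.sub (hwZ n))
    simp only [hh]
    exact ((this.div_const _).min continuous_const).max (cQ.sub continuous_const)
  have bh : ∀ n, ∀ g ∈ Icc 0 G, |h n g| ≤ Bh := by
    intro n g hg
    have := hB0 g hg
    rw [Real.norm_eq_abs, abs_le] at this
    rw [abs_le]
    refine ⟨?_, ?_⟩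
    · have := le_max_right (min (Dw P T H Ψ p v (w n) g / (w n - v)) C) (Q g - 1)
      simp only [hh]
      linarith
    · simp only [hh]
      refine max_le ?_ (by linarith)
      exact (min_le_right _ _).trans (by linarith)
  set hl : ℝ → ℝ := fun g => max (min (Q g) C) (Q g - 1) with hhl
  have chl : Continuous hl := (cQ.min continuous_const).max (cQ.sub continuous_const)
  have hlim : Tendsto (fun n => ∫ g in (0:ℝ)..G, h n g) atTop (nhds (∫ g in (0:ℝ)..G, hl g)) := by
    apply intervalIntegral.tendsto_integral_filter_of_dominated_convergence (fun _ => Bh)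
    · exact Eventually.of_forall fun n => (ch n).aestronglyMeasurable
    · refine Eventually.of_forall fun n => Eventually.of_forall fun g hg => ?_
      rw [uIoc_of_le hG0] at hg
      exact bh n g ⟨hg.1.le, hg.2⟩
    · exact intervalIntegrable_const
    · refine Eventually.of_forall fun g hg => ?_
      rw [uIoc_of_le hG0] at hg
      have hd := (Yk_hasDeriv S T H Ψ hvV hg.1).tendsto_slope
      have hw' : Tendsto w atTop (nhdsWithin v {v}ᶜ) := by
        refine tendsto_nhdsWithin_iff.2 ⟨hwlim, Eventually.of_forall fun n => ?_⟩
        exact (hvw n).ne'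
      have hd2 := hd.comp hw'
      have hd3 : Tendsto (fun n => Dw P T H Ψ p v (w n) g / (w n - v)) atTop (nhds (Q g)) := by
        refine hd2.congr fun n => ?_
        simp only [Function.comp, slope_def_field, Dw]
      exact (hd3.min tendsto_const_nhds).max tendsto_const_nhds
  have hle : ∫ g in (0:ℝ)..G, hl g ≤ Af P T H Ψ p v := by
    refine le_trans ?_ (slice_le S hG0 T H Ψ hvV)
    refine intervalIntegral.integral_mono_on hG0 (chl.intervalIntegrable _ _)
      (cQ.intervalIntegrable _ _) fun g _ => ?_
    exact max_le (min_le_left _ _) (by linarith)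
  have hfin : Tendsto (fun n => (∫ g in (0:ℝ)..G, h n g) + Bh * (s n ^ 14 + 2 * s n ^ 10)
      + 2 * C * s n) atTop (nhds (∫ g in (0:ℝ)..G, hl g)) := by
    have := (hlim.add (((hslim.pow 14).add ((hslim.pow 10).const_mul 2)).const_mul Bh)).add
      (hslim.const_mul (2 * C))
    simpa using this
  have e1 : ∀ᶠ n in atTop, (∫ g in (0:ℝ)..G, h n g) + Bh * (s n ^ 14 + 2 * s n ^ 10)
      + 2 * C * s n < Af P T H Ψ p v + ε / 2 :=
    hfin.eventually_lt_const (by linarith)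
  have e2 : ∀ᶠ n in atTop, s n < s0 := hslim.eventually_lt_const hs0
  have e3 : ∀ᶠ n in atTop, w n < v + δ := hwlim.eventually_lt_const (by linarith)
  have cA := Af_cont S hG0 T H Ψ
  obtain ⟨ρ, hρ, hρA⟩ := Metric.continuousAt_iff.1 (cA.continuousAt (x := v)) (ε / 2) (by linarith)
  have e4 : ∀ᶠ n in atTop, w n < v + ρ := hwlim.eventually_lt_const (by linarith)
  obtain ⟨n, h1, h2, h3, h4⟩ := (e1.and (e2.and (e3.and e4))).exists
  refine ⟨w n, hvw n, h3, ?_⟩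
  have hτ : 0 < w n - v := by linarith [hvw n]
  obtain ⟨f1, f2, f3, f4, f5⟩ := hest (w n) (hwZ n) (hvw n) (s n) (hspos n) h2.le (hs35 n)
  have hsub := Df_sub S hG0 T H Ψ v (w n)
  have hAlow : (w n - v) * (Af P T H Ψ p v - ε / 2) ≤ ∫ t in v..(w n), Af P T H Ψ p t := by
    have : ∫ t in v..(w n), (Af P T H Ψ p v - ε / 2) ≤ ∫ t in v..(w n), Af P T H Ψ p t := by
      refine intervalIntegral.integral_mono_on (hvw n).le intervalIntegrable_const
        (cA.intervalIntegrable _ _) fun t ht => ?_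
      have := hρA (x := t) (by rw [Real.dist_eq, abs_lt]; constructor <;> linarith [ht.1, ht.2])
      rw [Real.dist_eq, abs_lt] at this
      linarith
    rw [intervalIntegral.integral_const, smul_eq_mul] at this
    exact this
  have cD := Dw_cont S T H Ψ hvV (hZ.sub (hwZ n))
  set D := Dw P T H Ψ p v (w n) with hD
  have iD : ∀ x y, IntervalIntegrable D volume x y := fun x y => cD.intervalIntegrable x y
  have ih : ∀ x y, IntervalIntegrable (h n) volume x y := fun x y => (ch n).intervalIntegrable x y
  have hYD : Yf P T H Ψ p (w n) - Yf P T H Ψ p v = ∫ g in (0:ℝ)..G, D g := by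
    have hc : ∀ t ∈ Ioo 0 P.V, Continuous fun g => Yk P T H Ψ t g (p t g) := fun t ht =>
      (Yk_cont P T H Ψ).comp (continuous_const.prodMk (continuous_id.prodMk (S.c0 t ht)))
    simp only [hD, Dw, Yf]
    rw [intervalIntegral.integral_sub ((hc _ (hZ.sub (hwZ n))).intervalIntegrable _ _)
      ((hc _ hvV).intervalIntegrable _ _)]
  have p14 : 0 < s n ^ 14 := pow_pos (hspos n) _
  have p10 : 0 < s n ^ 10 := pow_pos (hspos n) _
  have split : ∀ f : ℝ → ℝ, (∀ x y, IntervalIntegrable f volume x y) → ∫ g in (0:ℝ)..G, f g =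
      (∫ g in (0:ℝ)..(s n ^ 14), f g) + (∫ g in (s n ^ 14)..(P.γ v - s n ^ 10), f g)
      + (∫ g in (P.γ v - s n ^ 10)..(P.γ v + s n ^ 10), f g)
      + (∫ g in (P.γ v + s n ^ 10)..G, f g) := by
    intro f hf
    rw [intervalIntegral.integral_add_adjacent_intervals (hf _ _) (hf _ _),
      intervalIntegral.integral_add_adjacent_intervals (hf _ _) (hf _ _),
      intervalIntegral.integral_add_adjacent_intervals (hf _ _) (hf _ _)]
  have hgood : ∀ x y, s n ^ 14 ≤ x → x ≤ y → y ≤ G →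
      (∀ g ∈ Icc x y, s n ^ 10 ≤ |g - P.γ v|) →
      ∫ g in x..y, D g ≤ (w n - v) * ∫ g in x..y, h n g := by
    intro x y hx hxy hy hg
    rw [← intervalIntegral.integral_const_mul]
    refine intervalIntegral.integral_mono_on hxy (iD _ _) ((ih _ _).const_mul _) fun g hg' => ?_
    have hb := f1 g ⟨hx.trans hg'.1, hg'.2.trans hy⟩ (hg g hg')
    have hb2 : D g / (w n - v) ≤ C := by rw [div_le_iff₀ hτ]; exact hb
    have hb3 : D g / (w n - v) ≤ h n g := by
      simp only [hh]
      refine le_max_of_le_left (le_min ?_ hb2)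
      exact le_rfl
    rw [div_le_iff₀ hτ] at hb3
    linarith
  have g1 := hgood _ _ le_rfl f4 (by linarith) (fun g hg => by
    rw [abs_of_nonpos (by linarith [hg.2])]; linarith [hg.2])
  have g2 := hgood (P.γ v + s n ^ 10) G (by linarith) f5 le_rfl (fun g hg => by
    rw [abs_of_nonneg (by linarith [hg.1])]; linarith [hg.1])
  have hlow : ∀ x y, 0 ≤ x → x ≤ y → y ≤ G → - (Bh * (y - x)) ≤ ∫ g in x..y, h n g := by
    intro x y hx hxy hy
    have : ∫ g in x..y, (-Bh) ≤ ∫ g in x..y, h n g := by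
      refine intervalIntegral.integral_mono_on hxy intervalIntegrable_const (ih _ _) fun g hg => ?_
      exact (abs_le.1 (bh n g ⟨hx.trans hg.1, hg.2.trans hy⟩)).1
    rw [intervalIntegral.integral_const, smul_eq_mul] at this
    linarith
  have l1 := hlow 0 (s n ^ 14) le_rfl p14.le (by linarith)
  have l2 := hlow (P.γ v - s n ^ 10) (P.γ v + s n ^ 10) (by linarith) (by linarith) f5
  have sD := split D iD
  have sh := split (h n) ih
  have hall : ∫ g in (0:ℝ)..G, D g ≤ (w n - v) * (Af P T H Ψ p v + ε / 2) := by
    have : ∫ g in (0:ℝ)..G, D g ≤ (w n - v) * ((∫ g in (0:ℝ)..G, h n g)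
        + Bh * (s n ^ 14 + 2 * s n ^ 10) + 2 * C * s n) := by
      have k1 := mul_le_mul_of_nonneg_left l1 hτ.le
      have k2 := mul_le_mul_of_nonneg_left l2 hτ.le
      rw [sD, sh]
      nlinarith [k1, k2, g1, g2, f2, f3]
    exact this.trans (mul_le_mul_of_nonneg_left h1.le hτ.le)
  nlinarith [hall, hAlow, hsub, hYD]

lemma lip_of_deriv {f f' : ℝ → ℝ} {A B K : ℝ} (hc : ContinuousOn f (Icc A B))
    (hd : ∀ z ∈ Ioo A B, HasDerivAt f (f' z) z) (hb : ∀ z ∈ Ioo A B, |f' z| ≤ K) {x y : ℝ}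
    (hx : x ∈ Icc A B) (hy : y ∈ Icc A B) : |f x - f y| ≤ K * |x - y| := by
  have key : ∀ x y : ℝ, x ∈ Icc A B → y ∈ Icc A B → x ≤ y → |f x - f y| ≤ K * |x - y| := by
    intro x y hx hy hxy
    have hI : Icc x y ⊆ Icc A B := Icc_subset_Icc hx.1 hy.2
    have hO : Ioo x y ⊆ Ioo A B := Ioo_subset_Ioo hx.1 hy.2
    have h1 := mv_bound hxy (hc.mono hI) (fun z hz => hd z (hO hz))
      (fun z hz => (le_abs_self _).trans (hb z (hO hz)))
    have h2 := mv_bound_below (K := -K) hxy (hc.mono hI) (fun z hz => hd z (hO hz))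
      (fun z hz => by linarith [neg_abs_le (f' z), hb z (hO hz)])
    rw [abs_sub_comm x y, abs_of_nonneg (by linarith : 0 ≤ y - x), abs_le]
    constructor <;> linarith
  rcases le_total x y with h | h
  · exact key x y hx hy h
  · rw [abs_sub_comm, abs_sub_comm x]
    exact key y x hy hx h

/-- uniformly regular slices, closed formulation -/
def En (G : ℝ) (p : ℝ → ℝ → ℝ) (n : ℝ) : Set ℝ :=
  {v | (∀ g ∈ Icc 0 G, |p v g| ≤ n) ∧ (∀ x ∈ Icc 0 G, ∀ y ∈ Icc 0 G, |p v x - p v y| ≤ n * |x - y|) ∧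
    ∀ x y k : ℝ, x ∈ Icc 0 G → y ∈ Icc 0 G → x + k ∈ Icc 0 G → y + k ∈ Icc 0 G →
      |p v (x + k) - p v x - (p v (y + k) - p v y)| ≤ n * |k| * |x - y|}

lemma En_closed {p : ℝ → ℝ → ℝ} (hp : ∀ g, Continuous fun v => p v g) (G n : ℝ) :
    IsClosed (En G p n) := by
  unfold En
  simp only [ofPred_and, ofPred_forall]
  refine IsClosed.inter ?_ (IsClosed.inter ?_ ?_)
  · refine isClosed_iInter fun g => isClosed_iInter fun _ => ?_
    exact isClosed_le (hp g).abs continuous_const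
  · refine isClosed_iInter fun x => isClosed_iInter fun _ => isClosed_iInter fun y =>
      isClosed_iInter fun _ => ?_
    exact isClosed_le ((hp x).sub (hp y)).abs continuous_const
  · refine isClosed_iInter fun x => isClosed_iInter fun y => isClosed_iInter fun k =>
      isClosed_iInter fun _ => isClosed_iInter fun _ => isClosed_iInter fun _ =>
      isClosed_iInter fun _ => ?_
    exact isClosed_le (((hp _).sub (hp _)).sub ((hp _).sub (hp _))).abs continuous_const

lemma En_cover {P : Par} {p p1 p2 : ℝ → ℝ → ℝ} (S : Sol P p p1 p2) (G : ℝ) {v : ℝ}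
    (hv : v ∈ Ioo 0 P.V) : ∃ n : ℕ, v ∈ En G p n := by
  have h0 := S.c0 v hv; have h1 := S.c1 v hv; have h2 := S.c2 v hv
  obtain ⟨B0, hB0⟩ := (isCompact_Icc (a := (0:ℝ)) (b := G)).exists_bound_of_continuousOn h0.continuousOn
  obtain ⟨B1, hB1⟩ := (isCompact_Icc (a := (0:ℝ)) (b := G)).exists_bound_of_continuousOn h1.continuousOn
  obtain ⟨B2, hB2⟩ := (isCompact_Icc (a := (0:ℝ)) (b := G)).exists_bound_of_continuousOn h2.continuousOn
  obtain ⟨n, hn⟩ := exists_nat_ge (max B0 (max B1 B2))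
  have n0 : B0 ≤ n := (le_max_left _ _).trans hn
  have n1 : B1 ≤ n := ((le_max_left _ _).trans (le_max_right _ _)).trans hn
  have n2 : B2 ≤ n := ((le_max_right _ _).trans (le_max_right _ _)).trans hn
  have L1 : ∀ x ∈ Icc 0 G, ∀ y ∈ Icc 0 G, |p1 v x - p1 v y| ≤ n * |x - y| := fun x hx y hy =>
    lip_of_deriv h1.continuousOn (fun z hz => S.d2 v hv z hz.1)
      (fun z hz => (hB2 z (Ioo_subset_Icc_self hz)).trans n2) hx hy
  refine ⟨n, fun g hg => (hB0 g hg).trans n0, fun x hx y hy => ?_, ?_⟩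
  · exact lip_of_deriv h0.continuousOn (fun z hz => S.d1 v hv z hz.1)
      (fun z hz => (hB1 z (Ioo_subset_Icc_self hz)).trans n1) hx hy
  · intro x y k hx hy hxk hyk
    set A := max 0 (-k)
    set B := min G (G - k)
    have hAB : ∀ z, z ∈ Icc 0 G → z + k ∈ Icc 0 G → z ∈ Icc A B := fun z h1 h2 =>
      ⟨max_le h1.1 (by linarith [h2.1]), le_min h1.2 (by linarith [h2.2])⟩
    have hAB2 : ∀ z ∈ Ioo A B, 0 < z ∧ z < G ∧ 0 < z + k ∧ z + k < G := by
      intro z hz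
      have a := (max_lt_iff.1 hz.1); have b := lt_min_iff.1 hz.2
      exact ⟨a.1, b.1, by linarith [a.2], by linarith [b.2]⟩
    refine lip_of_deriv (f := fun z => p v (z + k) - p v z) (f' := fun z => p1 v (z + k) - p1 v z)
      (A := A) (B := B) ?_ ?_ ?_ (hAB x hx hxk) (hAB y hy hyk)
    · exact Continuous.continuousOn (by fun_prop)
    · intro z hz
      obtain ⟨a, b, c, d⟩ := hAB2 z hz
      exact ((S.d1 v hv (z + k) c).comp_add_const z k).sub (S.d1 v hv z a)
    · intro z hz
      obtain ⟨a, b, c, d⟩ := hAB2 z hz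
      have := L1 (z + k) ⟨c.le, d.le⟩ z ⟨a.le, b.le⟩
      simpa using this

lemma bound_closure {f : ℝ → ℝ} (hf : Continuous f) {G n : ℝ} (hG : 0 < G)
    (h : ∀ g ∈ Ioo 0 G, |f g| ≤ n) : ∀ g ∈ Icc 0 G, |f g| ≤ n := by
  have hcl : IsClosed {g | |f g| ≤ n} := isClosed_le hf.abs continuous_const
  have := closure_minimal (s := Ioo 0 G) (fun g hg => h g hg) hcl
  rw [closure_Ioo hG.ne] at this
  exact fun g hg => this hg

lemma En_bounds {P : Par} {p p1 p2 : ℝ → ℝ → ℝ} (S : Sol P p p1 p2) {G n : ℝ} (hG : 0 < G)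
    (hn : 0 ≤ n) {v : ℝ} (hv : v ∈ Ioo 0 P.V) (h : v ∈ En G p n) :
    (∀ g ∈ Icc 0 G, |p v g| ≤ n) ∧ (∀ g ∈ Icc 0 G, |p1 v g| ≤ n) ∧ (∀ g ∈ Icc 0 G, |p2 v g| ≤ n) := by
  obtain ⟨a, b, c⟩ := h
  refine ⟨a, bound_closure (S.c1 v hv) hG fun g hg => ?_, bound_closure (S.c2 v hv) hG fun g hg => ?_⟩
  · refine (S.d1 v hv g hg.1).le_of_lip' hn ?_
    filter_upwards [Ioo_mem_nhds hg.1 hg.2] with x hx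
    exact b x (Ioo_subset_Icc_self hx) g (Ioo_subset_Icc_self hg)
  · refine (S.d2 v hv g hg.1).le_of_lip' hn ?_
    filter_upwards [Ioo_mem_nhds hg.1 hg.2] with x hx
    have hd : HasDerivAt (fun z => p v (z + (x - g)) - p v z) (p1 v x - p1 v g) g := by
      have h1 : HasDerivAt (p v) (p1 v x) (g + (x - g)) := by
        have := S.d1 v hv x hx.1
        rwa [show g + (x - g) = x by ring]
      exact (h1.comp_add_const g (x - g)).sub (S.d1 v hv g hg.1)
    refine hd.le_of_lip' (mul_nonneg hn (norm_nonneg _)) ?_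
    have hx' : g + (x - g) ∈ Ioo 0 G := by rwa [show g + (x - g) = x by ring]
    have hcont : ContinuousAt (fun y => y + (x - g)) g := by fun_prop
    filter_upwards [Ioo_mem_nhds hg.1 hg.2, hcont.preimage_mem_nhds (Ioo_mem_nhds hx'.1 hx'.2)]
      with y hy hy2
    exact c y g (x - g) (Ioo_subset_Icc_self hy) (Ioo_subset_Icc_self hg)
      (Ioo_subset_Icc_self hy2) (Ioo_subset_Icc_self hx')

lemma Pr.mono {P : Par} {G : ℝ} {p : ℝ → ℝ → ℝ} {c d c' d' : ℝ} (h : Pr P G p c d) (hc : c ≤ c')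
    (hd : d' ≤ d) : Pr P G p c' d' :=
  fun T H Ψ v w h1 h2 h3 => h T H Ψ v w (by linarith) h2 (by linarith)

def Good (P : Par) (G : ℝ) (p : ℝ → ℝ → ℝ) (v : ℝ) : Prop := ∃ ε > 0, Pr P G p (v - ε) (v + ε)

lemma Good.step {P : Par} {p p1 p2 : ℝ → ℝ → ℝ} (S : Sol P p p1 p2) {G : ℝ} (hG : 0 ≤ G) {s : ℝ}
    (h : Good P G p s) (T : Tst G) (H : Eta) (Ψ : Psi) {w ε : ℝ} (hw : s < w) (hε : 0 < ε) :
    ∃ t, s < t ∧ t ≤ w ∧ Df P T H Ψ p t ≤ Df P T H Ψ p s + ε * (t - s) := by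
  obtain ⟨r, hr, h⟩ := h
  have hst : s < min w (s + r / 2) := lt_min hw (by linarith)
  refine ⟨min w (s + r / 2), hst, min_le_left _ _, ?_⟩
  have h1 := h T H Ψ s (min w (s + r / 2)) (by linarith) hst.le
    (by linarith [min_le_right w (s + r / 2)])
  have h2 := Df_sub S hG T H Ψ s (min w (s + r / 2))
  have : 0 ≤ ε * (min w (s + r / 2) - s) := mul_nonneg hε.le (by linarith)
  linarith

lemma Pr_of_good {P : Par} {p p1 p2 : ℝ → ℝ → ℝ} (S : Sol P p p1 p2) {G : ℝ} (hG : 0 ≤ G) {c d : ℝ}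
    (h : ∀ s, c < s → s < d → Good P G p s) : Pr P G p c d :=
  Pr_of_step S hG fun T H Ψ _ _ _ hcs hsw hwd hε =>
    (h _ hcs (by linarith)).step S hG T H Ψ hsw hε

lemma Good_open (P : Par) (G : ℝ) (p : ℝ → ℝ → ℝ) : IsOpen {v | Good P G p v} := by
  rw [Metric.isOpen_iff]
  rintro v ⟨ε, hε, h⟩
  refine ⟨ε / 2, by linarith, fun w hw => ?_⟩
  rw [Metric.mem_ball, Real.dist_eq, abs_lt] at hw
  exact ⟨ε / 2, by linarith, h.mono (by linarith) (by linarith)⟩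

lemma Pr_slab {P : Par} {p p1 p2 : ℝ → ℝ → ℝ} (S : Sol P p p1 p2) {G : ℝ} {n α β : ℝ}
    (hk0 : P.k0 = 0) (hk1 : P.V < P.k1)
    (hG : P.gL * P.V / (P.k1 - P.V) + 2 ≤ G) (hG0 : 0 < G)
    (hα : 0 ≤ α) (hβ : β ≤ P.V) (hn : 1 ≤ n)
    (hb : ∀ v ∈ Ioo α β, ¬ Good P G p v → v ∈ En G p n) : Pr P G p α β := by
  set Z : Set ℝ := {v | v ∈ Ioo α β ∧ ¬ Good P G p v} with hZd
  have hsub : Z ⊆ Ioo 0 P.V := fun v hv => ⟨by linarith [hv.1.1], by linarith [hv.1.2]⟩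
  have hbd := fun v (hv : v ∈ Z) => En_bounds S hG0 (by linarith) (hsub hv) (hb v hv.1 hv.2)
  have hZ : Slab P G p p1 p2 Z n :=
    { n1 := hn
      cl := by
        intro v w hv hw
        have : Z ∩ Icc v w = {v | Good P G p v}ᶜ ∩ Icc v w := by
          ext t
          constructor
          · rintro ⟨a, b⟩; exact ⟨a.2, b⟩
          · rintro ⟨a, b⟩
            exact ⟨⟨⟨by linarith [hv.1.1, b.1], by linarith [hw.1.2, b.2]⟩, a⟩, b⟩
        rw [this]
        exact (Good_open P G p).isClosed_compl.inter isClosed_Icc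
      sub := hsub
      b0 := fun v hv => (hbd v hv).1
      b1 := fun v hv => (hbd v hv).2.1
      b2 := fun v hv => (hbd v hv).2.2
      gap := by
        intro c hc d hd hcd hno
        refine Pr_of_good S hG0.le fun s hs1 hs2 => ?_
        by_contra hcon
        have := hno s ⟨⟨by linarith [hc.1.1], by linarith [hd.1.2]⟩, hcon⟩ hs1
        linarith }
  refine Pr_of_step S hG0.le fun T H Ψ s w ε hs hsw hw hε => ?_
  by_cases hgood : Good P G p s
  · exact hgood.step S hG0.le T H Ψ hsw hε
  have hsZ : s ∈ Z := ⟨⟨hs, by linarith⟩, hgood⟩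
  by_cases hacc : ∀ δ > 0, ∃ z ∈ Z, s < z ∧ z < s + δ
  · obtain ⟨t, h1, h2, h3⟩ := cross_step S hZ hk0 hk1 hG hsZ hacc T H Ψ hε
      (show 0 < w - s by linarith)
    exact ⟨t, h1, by linarith, h3⟩
  · push Not at hacc
    obtain ⟨δ, hδ, hno⟩ := hacc
    have hst : s < min w (s + δ) := lt_min hsw (by linarith)
    have hpr : Pr P G p s (min w (s + δ)) := by
      refine Pr_of_good S hG0.le fun t ht1 ht2 => ?_
      by_contra hcon
      have := hno t ⟨⟨by linarith, by linarith [min_le_left w (s + δ)]⟩, hcon⟩ ht1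
      linarith [min_le_right w (s + δ)]
    have h1 := hpr.closed S hG0.le T H Ψ le_rfl hst.le le_rfl
    have h2 := Df_sub S hG0.le T H Ψ s (min w (s + δ))
    have : 0 ≤ ε * (min w (s + δ) - s) := mul_nonneg hε.le (by linarith)
    exact ⟨_, hst, min_le_left _ _, by linarith⟩

theorem Pr_all {P : Par} {p p1 p2 : ℝ → ℝ → ℝ} (S : Sol P p p1 p2) {G : ℝ}
    (hk0 : P.k0 = 0) (hk1 : P.V < P.k1)
    (hG : P.gL * P.V / (P.k1 - P.V) + 2 ≤ G) : Pr P G p 0 P.V := by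
  have hG0 : 0 < G := by
    have := P.hgL; have := P.hV
    have : 0 ≤ P.gL * P.V / (P.k1 - P.V) := div_nonneg (by positivity) (by linarith)
    linarith
  refine Pr_of_good S hG0.le fun z0 hz0 hz0' => ?_
  by_contra hbad
  obtain ⟨r, hr, hr1, hr2⟩ : ∃ r > 0, 0 < z0 - r ∧ z0 + r < P.V := by
    refine ⟨min z0 (P.V - z0) / 2, by have := lt_min hz0 (show 0 < P.V - z0 by linarith); linarith,
      ?_, ?_⟩
    · linarith [min_le_left z0 (P.V - z0)]
    · linarith [min_le_right z0 (P.V - z0)]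
  set K : Set ℝ := {v | Good P G p v}ᶜ ∩ Icc (z0 - r) (z0 + r) with hK
  have hKc : IsClosed K := (Good_open P G p).isClosed_compl.inter isClosed_Icc
  have : CompleteSpace K := hKc.completeSpace_coe
  have hz0K : z0 ∈ K := ⟨hbad, by linarith, by linarith⟩
  have hdense : Dense (⋃ n : ℕ, interior ((fun x : K => (x:ℝ)) ⁻¹' En G p n)) := by
    refine dense_iUnion_interior_of_closed
      (fun n => (En_closed S.contv G n).preimage continuous_subtype_val) ?_
    refine eq_univ_of_forall fun x => ?_
    obtain ⟨n, hn⟩ := En_cover S G (v := x)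
      ⟨by linarith [x.2.2.1], by linarith [x.2.2.2]⟩
    exact mem_iUnion.2 ⟨n, hn⟩
  have hO : IsOpen ((fun x : K => (x:ℝ)) ⁻¹' Ioo (z0 - r) (z0 + r)) :=
    isOpen_Ioo.preimage continuous_subtype_val
  obtain ⟨x, hx1, hx2⟩ := hdense.inter_open_nonempty _ hO
    ⟨⟨z0, hz0K⟩, show z0 ∈ Ioo (z0 - r) (z0 + r) from ⟨by linarith, by linarith⟩⟩
  obtain ⟨n, hn⟩ := mem_iUnion.1 hx2
  have hN := (hO.inter isOpen_interior).mem_nhds ⟨hx1, hn⟩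
  obtain ⟨η, hη, hball⟩ := Metric.mem_nhds_iff.1 hN
  have hx1' : (x:ℝ) ∈ Ioo (z0 - r) (z0 + r) := hx1
  set α := max (x - η) (z0 - r)
  set β := min (x + η) (z0 + r)
  have hPr : Pr P G p α β := by
    refine Pr_slab S (n := (n:ℝ) + 1) hk0 hk1 hG hG0 (by linarith [le_max_right (x - η) (z0 - r)])
      (by linarith [min_le_right (x + η) (z0 + r)]) (by linarith [n.cast_nonneg (α := ℝ)]) ?_
    intro v hv hvb
    have a := max_lt_iff.1 hv.1; have b := lt_min_iff.1 hv.2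
    have hvK : v ∈ K := ⟨hvb, by linarith, by linarith⟩
    have : (⟨v, hvK⟩ : K) ∈ Metric.ball x η := by
      rw [Metric.mem_ball, Subtype.dist_eq, Real.dist_eq, abs_lt]
      constructor <;> simp only <;> linarith
    have h2 := interior_subset (hball this).2
    obtain ⟨h3, h4, h5⟩ : v ∈ En G p n := h2
    refine ⟨fun g hg => (h3 g hg).trans (by linarith), fun x hx y hy => (h4 x hx y hy).trans ?_,
      fun x y k hx hy hxk hyk => (h5 x y k hx hy hxk hyk).trans ?_⟩
    · exact mul_le_mul_of_nonneg_right (by linarith) (abs_nonneg _)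
    · exact mul_le_mul_of_nonneg_right
        (mul_le_mul_of_nonneg_right (by linarith) (abs_nonneg _)) (abs_nonneg _)
  have hxα : α < x := max_lt (by linarith) hx1'.1
  have hxβ : x < β := lt_min (by linarith) hx1'.2
  refine x.2.1 ⟨min (x - α) (β - x), lt_min (by linarith) (by linarith), hPr.mono ?_ ?_⟩
  · linarith [min_le_left (x - α) (β - x)]
  · linarith [min_le_right (x - α) (β - x)]

/-- constant barrier -/
def Psi.const (N : ℝ) : Psi where
  f := fun _ _ => N
  fv := fun _ _ => 0
  f1 := fun _ _ => 0
  f2 := fun _ _ => 0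
  dv := fun v _ => hasDerivAt_const v N
  d1 := fun _ g => hasDerivAt_const g N
  d2 := fun _ g => hasDerivAt_const g 0
  c := continuous_const
  cv := continuous_const
  c1 := continuous_const
  c2 := continuous_const

/-- concave bounded nonlinearity attached to a convex one -/
def tht (H : Eta) (N s : ℝ) : ℝ := H.f N - H.f (N - s)
def thd (H : Eta) (N s : ℝ) : ℝ := s * H.f1 (N - s) - tht H N s

lemma Eta.mono1 (H : Eta) : Monotone H.f1 :=
  monotone_of_deriv_nonneg (fun u => (H.d2 u).differentiableAt)
    (fun u => by rw [(H.d2 u).deriv]; exact H.n2 u)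

lemma Eta.convex (H : Eta) : ConvexOn ℝ univ H.f := by
  have h : deriv H.f = H.f1 := funext fun u => (H.d1 u).deriv
  exact Monotone.convexOn_univ_of_deriv (fun u => (H.d1 u).differentiableAt) (h ▸ H.mono1)

lemma tht_zero (H : Eta) (N : ℝ) : tht H N 0 = 0 := by simp [tht]

lemma tht_nonneg (H : Eta) (N : ℝ) {s : ℝ} (hs : 0 ≤ s) : 0 ≤ tht H N s := by
  have := H.mono (show N - s ≤ N by linarith)
  unfold tht; linarith

lemma tht_scale (H : Eta) (N : ℝ) {s l : ℝ} (h0 : 0 ≤ l) (h1 : l ≤ 1) :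
    l * tht H N s ≤ tht H N (l * s) := by
  have := H.convex.2 (mem_univ N) (mem_univ (N - s)) (show 0 ≤ 1 - l by linarith) h0 (by ring)
  simp only [smul_eq_mul] at this
  rw [show (1 - l) * N + l * (N - s) = N - l * s by ring] at this
  unfold tht; linarith

lemma tht_ge (H : Eta) (N : ℝ) {s : ℝ} (hs : 0 ≤ s) : s * H.f1 (N - s) ≤ tht H N s := by
  have := mv_bound_below (f := H.f) (f' := H.f1) (K := H.f1 (N - s)) (show N - s ≤ N by linarith)
    H.c.continuousOn (fun z _ => H.d1 z) (fun z hz => H.mono1 hz.1.le)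
  unfold tht
  linarith

lemma tht_le (H : Eta) (N : ℝ) {s : ℝ} (hs : 0 ≤ s) : tht H N s ≤ s * H.f1 N := by
  have := mv_bound (f := H.f) (f' := H.f1) (K := H.f1 N) (show N - s ≤ N by linarith)
    H.c.continuousOn (fun z _ => H.d1 z) (fun z hz => H.mono1 hz.2.le)
  unfold tht
  linarith

lemma thd_nonpos (H : Eta) (N : ℝ) {s : ℝ} (hs : 0 ≤ s) : thd H N s ≤ 0 := by
  have := tht_ge H N hs
  unfold thd; linarith

lemma thd_ge (H : Eta) (N : ℝ) {s : ℝ} (hs : 0 ≤ s) : -(s * H.f1 N) ≤ thd H N s := by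
  have := tht_le H N hs
  have := mul_nonneg hs (H.n1 (N - s))
  unfold thd; linarith

lemma tht_cont (H : Eta) (N : ℝ) : Continuous (tht H N) := by
  have := H.c; unfold tht; fun_prop

lemma thd_cont (H : Eta) (N : ℝ) : Continuous (thd H N) := by
  have := H.c1; have := tht_cont H N; unfold thd; fun_prop

def Par.cc (P : Par) (g : ℝ) : ℝ := P.gL + g + 1 / P.σ

def Xf (P : Par) {G : ℝ} (T : Tst G) (H : Eta) (N : ℝ) (p : ℝ → ℝ → ℝ) (v : ℝ) : ℝ :=
  ∫ g in (0:ℝ)..G, P.J v g * T.f g * tht H N (p v g)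

/-- bulk part of the source -/
def Ic (P : Par) {G : ℝ} (T : Tst G) (H : Eta) (N : ℝ) (p : ℝ → ℝ → ℝ) (v : ℝ) : ℝ :=
  ∫ g in (0:ℝ)..G, (T.f g * P.cc g * thd H N (p v g) + tht H N (p v g) * T.Ls P g)

def Ac (P : Par) {G : ℝ} (T : Tst G) (H : Eta) (N : ℝ) (p : ℝ → ℝ → ℝ) (v : ℝ) : ℝ :=
  Ic P T H N p v
    + 1 / P.σ * (P.a * T.f1 0 * tht H N (p v 0) - P.gin * T.f 0 * thd H N (p v 0))

lemma ii_of_bdd {f : ℝ → ℝ} (hf : Measurable f) {G M : ℝ} (hG : 0 ≤ G)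
    (hb : ∀ g, 0 ≤ g → g ≤ G → |f g| ≤ M) : IntervalIntegrable f volume 0 G := by
  rw [intervalIntegrable_iff_integrableOn_Ioc_of_le hG]
  refine Measure.integrableOn_of_bounded (M := M) (by simp) hf.aestronglyMeasurable ?_
  filter_upwards [ae_restrict_mem measurableSet_Ioc] with g hg
  exact hb g hg.1.le hg.2

lemma Sol.msec {P : Par} {p p1 p2 : ℝ → ℝ → ℝ} (S : Sol P p p1 p2) (v : ℝ) : Measurable (p v) :=
  S.meas.comp (measurable_const.prodMk measurable_id)

lemma K_ii {P : Par} {p p1 p2 : ℝ → ℝ → ℝ} (S : Sol P p p1 p2) {G : ℝ} (hG : 0 ≤ G)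
    {K : ℝ → ℝ → ℝ → ℝ} (hK : Continuous fun x : ℝ × ℝ × ℝ => K x.1 x.2.1 x.2.2)
    (hz : ∀ R, ∃ B, ∀ v g s, |v| ≤ R → 0 ≤ g → g ≤ G → B ≤ s → K v g s = 0) (v : ℝ) :
    IntervalIntegrable (fun g => K v g (p v g)) volume 0 G := by
  obtain ⟨M, hM⟩ := (cont_int hG S.nonneg S.contv S.meas hK hz).1 |v|
  refine ii_of_bdd ?_ hG fun g h0 h1 => hM v g _ le_rfl h0 h1 (S.nonneg v g)
  exact hK.measurable.comp (measurable_const.prodMk (measurable_id.prodMk (S.msec v)))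

lemma int_Ls (P : Par) {G : ℝ} (hG : 0 ≤ G) (T : Tst G) : ∫ g in (0:ℝ)..G, T.Ls P g =
    1 / P.σ * (-(P.a * T.f1 0) - P.gin * T.f 0 + ∫ g in (0:ℝ)..G, T.f g) := by
  have h1 := T.c; have h2 := T.c1; have h3 := T.c2
  have hσ := P.hσ
  set F : ℝ → ℝ := fun g => 1 / P.σ * (P.a * T.f1 g - (g - P.gin) * T.f g) with hF
  have hd : ∀ g ∈ uIcc 0 G, HasDerivAt F (T.Ls P g - 1 / P.σ * T.f g) g := by
    intro g _
    have := (((T.d2 g).const_mul P.a).sub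
      (((hasDerivAt_id g).sub_const P.gin).mul (T.d1 g))).const_mul (1 / P.σ)
    refine HasDerivAt.congr_deriv this ?_
    simp only [Tst.Ls, id]
    field_simp
    ring
  have hc1 := T.cLs P
  have hc : Continuous fun g => T.Ls P g - 1 / P.σ * T.f g := by fun_prop
  have hi := intervalIntegral.integral_eq_sub_of_hasDerivAt hd (hc.intervalIntegrable _ _)
  rw [intervalIntegral.integral_sub (hc1.intervalIntegrable _ _)
    ((h1.const_mul _).intervalIntegrable _ _), intervalIntegral.integral_const_mul] at hi
  have hFG : F G = 0 := by simp [hF, T.zero_end.1, T.zero_end.2]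
  have hF0 : F 0 = 1 / P.σ * (P.a * T.f1 0 + P.gin * T.f 0) := by simp only [hF]; ring
  rw [hFG, hF0] at hi
  linear_combination hi

lemma Xf_eq {P : Par} {p p1 p2 : ℝ → ℝ → ℝ} (S : Sol P p p1 p2) {G : ℝ} (hG : 0 ≤ G)
    (T : Tst G) (H : Eta) (N v : ℝ) :
    IntervalIntegrable (fun g => P.J v g * T.f g * tht H N (p v g)) volume 0 G ∧
    Xf P T H N p v = H.f N * (∫ g in (0:ℝ)..G, P.J v g * T.f g) - Yf P T H (Psi.const N) p v := by
  have i1 := K_ii S hG (Yk_cont P T H (Psi.const N)) (Yk_z P T H (Psi.const N)) v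
  have h1 := T.c
  have hc : Continuous fun g => H.f N * (P.J v g * T.f g) := by unfold Par.J; fun_prop
  have e : (fun g => P.J v g * T.f g * tht H N (p v g)) =
      fun g => H.f N * (P.J v g * T.f g) - Yk P T H (Psi.const N) v g (p v g) := by
    funext g; simp only [tht, Yk, Psi.const]; ring
  refine ⟨?_, ?_⟩
  · rw [e]; exact (hc.intervalIntegrable _ _).sub i1
  · unfold Xf Yf
    rw [e, intervalIntegral.integral_sub (hc.intervalIntegrable _ _) i1,
      intervalIntegral.integral_const_mul]

lemma Ac_eq {P : Par} {p p1 p2 : ℝ → ℝ → ℝ} (S : Sol P p p1 p2) {G : ℝ} (hG : 0 ≤ G)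
    (T : Tst G) (H : Eta) (N v : ℝ) :
    IntervalIntegrable (fun g => T.f g * P.cc g * thd H N (p v g) + tht H N (p v g) * T.Ls P g)
      volume 0 G ∧
    Ac P T H N p v = - (H.f N * ∫ g in (0:ℝ)..G, (P.gL + g) * T.f g)
      - Af P T H (Psi.const N) p v := by
  have i1 := K_ii S hG (Ak_cont P T H (Psi.const N)) (Ak_z P T H (Psi.const N)) v
  have h1 := T.c; have h2 := T.cLs P
  have hσ := P.hσ
  set C : ℝ → ℝ := fun g => H.f N * (T.Ls P g - ((P.gL + g) * T.f g + 1 / P.σ * T.f g)) with hC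
  have hc : Continuous C := by simp only [hC]; fun_prop
  have e : (fun g => T.f g * P.cc g * thd H N (p v g) + tht H N (p v g) * T.Ls P g) =
      fun g => C g - Ak P T H (Psi.const N) v g (p v g) := by
    funext g
    simp only [hC, tht, thd, Ak, Psi.const, Psi.R, Par.Lop, Par.cc]
    field_simp
    ring
  refine ⟨?_, ?_⟩
  · rw [e]; exact (hc.intervalIntegrable _ _).sub i1
  · have c1 : Continuous fun g => (P.gL + g) * T.f g := by fun_prop
    have c2 : Continuous fun g => 1 / P.σ * T.f g := by fun_prop
    have c3 : Continuous fun g => (P.gL + g) * T.f g + 1 / P.σ * T.f g := by fun_prop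
    have e2 : Ic P T H N p v = (∫ g in (0:ℝ)..G, C g) - ∫ g in (0:ℝ)..G,
        Ak P T H (Psi.const N) v g (p v g) := by
      unfold Ic
      rw [e, intervalIntegral.integral_sub (hc.intervalIntegrable _ _) i1]
    have e3 : ∫ g in (0:ℝ)..G, C g = H.f N * ((∫ g in (0:ℝ)..G, T.Ls P g) -
        ((∫ g in (0:ℝ)..G, (P.gL + g) * T.f g) + 1 / P.σ * ∫ g in (0:ℝ)..G, T.f g)) := by
      simp only [hC]
      rw [intervalIntegral.integral_const_mul, intervalIntegral.integral_sub
        (h2.intervalIntegrable _ _) (c3.intervalIntegrable _ _),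
        intervalIntegral.integral_add (c1.intervalIntegrable _ _) (c2.intervalIntegrable _ _),
        intervalIntegral.integral_const_mul]
    unfold Ac Af
    rw [e2, e3, int_Ls P hG T]
    simp only [Bk, tht, thd, Psi.const]
    ring

lemma Xf_cont {P : Par} {p p1 p2 : ℝ → ℝ → ℝ} (S : Sol P p p1 p2) {G : ℝ} (hG : 0 ≤ G)
    (T : Tst G) (H : Eta) (N : ℝ) : Continuous (Xf P T H N p) := by
  have h1 := Yf_cont S hG T H (Psi.const N)
  have h2 : Continuous fun v => ∫ g in (0:ℝ)..G, P.J v g * T.f g := by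
    have := T.c
    apply intervalIntegral.continuous_parametric_intervalIntegral_of_continuous'
    unfold Par.J Function.uncurry
    fun_prop
  have : Xf P T H N p = fun v => H.f N * (∫ g in (0:ℝ)..G, P.J v g * T.f g)
      - Yf P T H (Psi.const N) p v := funext fun v => (Xf_eq S hG T H N v).2
  rw [this]
  fun_prop

lemma Ac_cont {P : Par} {p p1 p2 : ℝ → ℝ → ℝ} (S : Sol P p p1 p2) {G : ℝ} (hG : 0 ≤ G)
    (T : Tst G) (H : Eta) (N : ℝ) : Continuous (Ac P T H N p) := by
  have h1 := Af_cont S hG T H (Psi.const N)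
  have : Ac P T H N p = fun v => - (H.f N * ∫ g in (0:ℝ)..G, (P.gL + g) * T.f g)
      - Af P T H (Psi.const N) p v := funext fun v => (Ac_eq S hG T H N v).2
  rw [this]
  fun_prop

lemma Ic_cont {P : Par} {p p1 p2 : ℝ → ℝ → ℝ} (S : Sol P p p1 p2) {G : ℝ} (hG : 0 ≤ G)
    (T : Tst G) (H : Eta) (N : ℝ) : Continuous (Ic P T H N p) := by
  have h1 := Ac_cont S hG T H N
  have h2 := tht_cont H N; have h3 := thd_cont H N; have h4 := S.contv 0
  have : Ic P T H N p = fun v => Ac P T H N p v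
    - 1 / P.σ * (P.a * T.f1 0 * tht H N (p v 0) - P.gin * T.f 0 * thd H N (p v 0)) := by
    funext v; simp only [Ac]; ring
  rw [this]
  fun_prop

/-- defect -/
def Dd (P : Par) {G : ℝ} (T : Tst G) (H : Eta) (N : ℝ) (p : ℝ → ℝ → ℝ) (v w : ℝ) : ℝ :=
  Xf P T H N p w - Xf P T H N p v - ∫ t in v..w, Ac P T H N p t

lemma Dd_nonneg {P : Par} {p p1 p2 : ℝ → ℝ → ℝ} (S : Sol P p p1 p2) {G : ℝ}
    (hk0 : P.k0 = 0) (hk1 : P.V < P.k1) (hG : P.gL * P.V / (P.k1 - P.V) + 2 ≤ G) (hG0 : 0 ≤ G)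
    (T : Tst G) (H : Eta) (N : ℝ) {v w : ℝ} (hv : 0 ≤ v) (hvw : v ≤ w) (hw : w ≤ P.V) :
    0 ≤ Dd P T H N p v w := by
  have h := (Pr_all S hk0 hk1 hG).closed S hG0 T H (Psi.const N) hv hvw hw
  have cA := Af_cont S hG0 T H (Psi.const N)
  have e1 : ∫ t in v..w, Ac P T H N p t = - ((w - v) * (H.f N * ∫ g in (0:ℝ)..G, (P.gL + g) * T.f g))
      - ∫ t in v..w, Af P T H (Psi.const N) p t := by
    simp only [(Ac_eq S hG0 T H N _).2]
    rw [intervalIntegral.integral_sub intervalIntegrable_const (cA.intervalIntegrable _ _),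
      intervalIntegral.integral_const, smul_eq_mul]
    ring
  have h1 := T.c
  have e2 : (∫ g in (0:ℝ)..G, P.J w g * T.f g) - (∫ g in (0:ℝ)..G, P.J v g * T.f g)
      = - ((w - v) * ∫ g in (0:ℝ)..G, (P.gL + g) * T.f g) := by
    have c : ∀ t, Continuous fun g => P.J t g * T.f g := fun t => by unfold Par.J; fun_prop
    rw [← intervalIntegral.integral_sub ((c w).intervalIntegrable _ _)
      ((c v).intervalIntegrable _ _), ← intervalIntegral.integral_const_mul,
      ← intervalIntegral.integral_neg]
    congr 1
    funext g
    unfold Par.J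
    ring
  unfold Dd
  rw [(Xf_eq S hG0 T H N w).2, (Xf_eq S hG0 T H N v).2, e1]
  linear_combination h + (-(H.f N)) * e2

/-- boundary conditions in `v` -/
structure BC (P : Par) (p : ℝ → ℝ → ℝ) : Prop where
  low : ∀ g, 0 < g → g < P.gL * P.V / (P.k1 - P.V) → p 0 g = 0 ∧ p P.V g = 0
  high : ∀ g, P.gL * P.V / (P.k1 - P.V) ≤ g → P.J 0 g * p 0 g = P.J P.V g * p P.V g

lemma bc_pt {P : Par} {p p1 p2 : ℝ → ℝ → ℝ} (S : Sol P p p1 p2) (B : BC P p)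
    (hk0 : P.k0 = 0) (hk1 : P.V < P.k1) (H : Eta) (N : ℝ) {g : ℝ} (hg : 0 < g) :
    P.J P.V g * tht H N (p P.V g) ≤ P.J 0 g * tht H N (p 0 g) := by
  have hV := P.hV; have hgL := P.hgL
  rcases lt_or_ge g (P.gL * P.V / (P.k1 - P.V)) with h | h
  · obtain ⟨a, b⟩ := B.low g hg h
    rw [a, b, tht_zero]; simp
  · have hb := B.high g h
    have hJ0 : 0 < P.J 0 g := by
      simp only [Par.J, hk0]
      have : 0 < P.k1 * g := mul_pos (by linarith) hg
      linarith
    have hJV : 0 ≤ P.J P.V g := by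
      rw [div_le_iff₀ (by linarith)] at h
      simp only [Par.J, hk0]; nlinarith
    have hle : P.J P.V g ≤ P.J 0 g := by
      simp only [Par.J]
      have : 0 ≤ (g + P.gL) * P.V := by positivity
      linarith
    have hp0 : p 0 g = P.J P.V g / P.J 0 g * p P.V g := by
      field_simp; linarith
    have := tht_scale H N (s := p P.V g) (div_nonneg hJV hJ0.le) ((div_le_one hJ0).2 hle)
    rw [hp0]
    calc P.J P.V g * tht H N (p P.V g)
        = P.J 0 g * (P.J P.V g / P.J 0 g * tht H N (p P.V g)) := by field_simp
      _ ≤ _ := mul_le_mul_of_nonneg_left this hJ0.le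

def Tst.comb {G : ℝ} (C : ℝ) (T0 T : Tst G) (h : ∀ g, T.f g ≤ C * T0.f g) : Tst G where
  f := fun g => C * T0.f g - T.f g
  f1 := fun g => C * T0.f1 g - T.f1 g
  f2 := fun g => C * T0.f2 g - T.f2 g
  nonneg := fun g => by linarith [h g]
  d1 := fun g => ((T0.d1 g).const_mul C).sub (T.d1 g)
  d2 := fun g => ((T0.d2 g).const_mul C).sub (T.d2 g)
  c2 := (T0.c2.const_mul C).sub T.c2
  supp := by
    obtain ⟨r, hr, h1⟩ := T0.supp
    obtain ⟨r', hr', h2⟩ := T.supp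
    refine ⟨min r r', lt_min hr hr', fun g hg => ?_⟩
    rw [h1 g (by linarith [min_le_left r r']), h2 g (by linarith [min_le_right r r'])]
    simp

lemma Xf_comb {P : Par} {p p1 p2 : ℝ → ℝ → ℝ} (S : Sol P p p1 p2) {G : ℝ} (hG : 0 ≤ G) {C : ℝ}
    (T0 T : Tst G) (h : ∀ g, T.f g ≤ C * T0.f g) (H : Eta) (N v : ℝ) :
    Xf P (Tst.comb C T0 T h) H N p v = C * Xf P T0 H N p v - Xf P T H N p v := by
  unfold Xf
  rw [← intervalIntegral.integral_const_mul, ← intervalIntegral.integral_sub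
    (((Xf_eq S hG T0 H N v).1).const_mul C) (Xf_eq S hG T H N v).1]
  congr 1
  funext g
  simp only [Tst.comb]
  ring

lemma Ac_comb {P : Par} {p p1 p2 : ℝ → ℝ → ℝ} (S : Sol P p p1 p2) {G : ℝ} (hG : 0 ≤ G) {C : ℝ}
    (T0 T : Tst G) (h : ∀ g, T.f g ≤ C * T0.f g) (H : Eta) (N v : ℝ) :
    Ac P (Tst.comb C T0 T h) H N p v = C * Ac P T0 H N p v - Ac P T H N p v := by
  have e : Ic P (Tst.comb C T0 T h) H N p v = C * Ic P T0 H N p v - Ic P T H N p v := by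
    unfold Ic
    rw [← intervalIntegral.integral_const_mul, ← intervalIntegral.integral_sub
      (((Ac_eq S hG T0 H N v).1).const_mul C) (Ac_eq S hG T H N v).1]
    congr 1
    funext g
    simp only [Tst.comb, Tst.Ls]
    ring
  unfold Ac
  rw [e]
  simp only [Tst.comb]
  ring

lemma Dd_comb {P : Par} {p p1 p2 : ℝ → ℝ → ℝ} (S : Sol P p p1 p2) {G : ℝ} (hG : 0 ≤ G) {C : ℝ}
    (T0 T : Tst G) (h : ∀ g, T.f g ≤ C * T0.f g) (H : Eta) (N v w : ℝ) :
    Dd P (Tst.comb C T0 T h) H N p v w = C * Dd P T0 H N p v w - Dd P T H N p v w := by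
  unfold Dd
  have c0 := Ac_cont S hG T0 H N
  have c1 := Ac_cont S hG T H N
  simp only [Xf_comb S hG, Ac_comb S hG]
  rw [intervalIntegral.integral_sub ((c0.intervalIntegrable _ _).const_mul C)
    (c1.intervalIntegrable _ _), intervalIntegral.integral_const_mul]
  ring

lemma Xf_bc {P : Par} {p p1 p2 : ℝ → ℝ → ℝ} (S : Sol P p p1 p2) (B : BC P p)
    (hk0 : P.k0 = 0) (hk1 : P.V < P.k1) {G : ℝ} (hG : 0 ≤ G) (T : Tst G) (H : Eta) (N : ℝ) :
    Xf P T H N p P.V ≤ Xf P T H N p 0 := by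
  unfold Xf
  refine intervalIntegral.integral_mono_on_of_le_Ioo hG (Xf_eq S hG T H N P.V).1
    (Xf_eq S hG T H N 0).1 fun g hg => ?_
  have := mul_le_mul_of_nonneg_left (bc_pt S B hk0 hk1 H N hg.1) (T.nonneg g)
  linarith

/-- the mass error -/
def ee (P : Par) {G : ℝ} (T : Tst G) (H : Eta) (N : ℝ) (p : ℝ → ℝ → ℝ) : ℝ :=
  - ∫ t in (0:ℝ)..P.V, Ic P T H N p t

lemma mass_facts {P : Par} {p p1 p2 : ℝ → ℝ → ℝ} (S : Sol P p p1 p2) (B : BC P p) {G : ℝ}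
    (hk0 : P.k0 = 0) (hk1 : P.V < P.k1) (hG : P.gL * P.V / (P.k1 - P.V) + 2 ≤ G) (hG0 : 0 ≤ G)
    (T : Tst G) (hT0 : T.f 0 = 1) (hT1 : T.f1 0 = 0) (H : Eta) (N : ℝ) :
    Dd P T H N p 0 P.V ≤ ee P T H N p ∧
    P.gin / P.σ * (∫ t in (0:ℝ)..P.V, -thd H N (p t 0)) ≤ ee P T H N p ∧
    -ee P T H N p ≤ Xf P T H N p P.V - Xf P T H N p 0 ∧ 0 ≤ ee P T H N p := by
  have hV := P.hV; have hgin := P.hgin; have hσ := P.hσ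
  have h0 := Dd_nonneg S hk0 hk1 hG hG0 T H N le_rfl hV.le le_rfl
  have hb := Xf_bc S B hk0 hk1 hG0 T H N
  have c1 := Ic_cont S hG0 T H N
  have c2 := thd_cont H N
  have c3 := S.contv 0
  have c4 : Continuous fun t => -thd H N (p t 0) := by fun_prop
  have hn : 0 ≤ ∫ t in (0:ℝ)..P.V, -thd H N (p t 0) :=
    intervalIntegral.integral_nonneg hV.le fun t _ => by
      linarith [thd_nonpos H N (S.nonneg t 0)]
  have hn2 : 0 ≤ P.gin / P.σ * (∫ t in (0:ℝ)..P.V, -thd H N (p t 0)) := by positivity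
  have e : ∫ t in (0:ℝ)..P.V, Ac P T H N p t = - ee P T H N p
      + P.gin / P.σ * (∫ t in (0:ℝ)..P.V, -thd H N (p t 0)) := by
    have : ∀ t, Ac P T H N p t = Ic P T H N p t + P.gin / P.σ * (-thd H N (p t 0)) := by
      intro t
      unfold Ac
      rw [hT0, hT1]
      ring
    simp only [this]
    rw [intervalIntegral.integral_add (c1.intervalIntegrable _ _)
      ((c4.const_mul _).intervalIntegrable _ _), intervalIntegral.integral_const_mul]
    unfold ee
    ring
  have hd : Dd P T H N p 0 P.V = Xf P T H N p P.V - Xf P T H N p 0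
    - ∫ t in (0:ℝ)..P.V, Ac P T H N p t := rfl
  refine ⟨by linarith, by linarith, by linarith, by linarith⟩

lemma Dd_le {P : Par} {p p1 p2 : ℝ → ℝ → ℝ} (S : Sol P p p1 p2) {G : ℝ}
    (hk0 : P.k0 = 0) (hk1 : P.V < P.k1) (hG : P.gL * P.V / (P.k1 - P.V) + 2 ≤ G) (hG0 : 0 ≤ G)
    (T : Tst G) (H : Eta) (N : ℝ) {v w : ℝ} (hv : 0 ≤ v) (hvw : v ≤ w) (hw : w ≤ P.V) :
    Dd P T H N p v w ≤ Dd P T H N p 0 P.V := by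
  have h1 := Dd_nonneg S hk0 hk1 hG hG0 T H N le_rfl hv (hvw.trans hw)
  have h2 := Dd_nonneg S hk0 hk1 hG hG0 T H N (hv.trans hvw) hw le_rfl
  have cA := Ac_cont S hG0 T H N
  have i : ∀ a b, IntervalIntegrable (Ac P T H N p) volume a b := fun a b =>
    cA.intervalIntegrable a b
  have e1 := intervalIntegral.integral_add_adjacent_intervals (i 0 v) (i v w)
  have e2 := intervalIntegral.integral_add_adjacent_intervals (i 0 w) (i w P.V)
  unfold Dd at *
  linarith

lemma osc_level {P : Par} {p p1 p2 : ℝ → ℝ → ℝ} (S : Sol P p p1 p2) (B : BC P p) {G : ℝ}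
    (hk0 : P.k0 = 0) (hk1 : P.V < P.k1) (hG : P.gL * P.V / (P.k1 - P.V) + 2 ≤ G) (hG0 : 0 ≤ G)
    (T0 T : Tst G) (hT0 : T0.f 0 = 1) (hT1 : T0.f1 0 = 0) {C : ℝ} (hC : 0 ≤ C)
    (hTT : ∀ g, T.f g ≤ C * T0.f g) (hTd : T.f1 0 ≤ 0) (H Hτ : Eta) (N M : ℝ) {Λ : ℝ} (hΛ : 0 ≤ Λ)
    (hβ : ∀ s, 0 ≤ s → tht H N s ≤ Λ * tht Hτ M s) {W : ℝ → ℝ}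
    (hW : IntervalIntegrable W volume 0 P.V) (hW0 : ∀ t, 0 ≤ W t)
    (hWb : ∀ t ∈ Ioo 0 P.V, Λ * Ic P T Hτ M p t - Ic P T H N p t ≤ W t)
    {v w : ℝ} (hv : 0 ≤ v) (hvw : v ≤ w) (hw : w ≤ P.V) :
    |(Λ * Xf P T Hτ M p w - Xf P T H N p w) - (Λ * Xf P T Hτ M p v - Xf P T H N p v)| ≤
      2 * (∫ t in (0:ℝ)..P.V, W t) + 5 * C * Λ * ee P T0 Hτ M p := by
  have hV := P.hV; have hgin := P.hgin; have hσ := P.hσ; have ha := P.ha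
  obtain ⟨m1, m2, m3, m4⟩ := mass_facts S B hk0 hk1 hG hG0 T0 hT0 hT1 Hτ M
  set e := ee P T0 Hτ M p with he
  have c2 := thd_cont Hτ M
  have c3 := S.contv 0
  set th : ℝ → ℝ := fun t => -thd Hτ M (p t 0) with hth
  have cth : Continuous th := by simp only [hth]; fun_prop
  have th0 : ∀ t, 0 ≤ th t := fun t => by
    have := thd_nonpos Hτ M (S.nonneg t 0)
    simp only [hth]; linarith
  have hTf0 : T.f 0 ≤ C := by have := hTT 0; rw [hT0] at this; linarith
  have hup : ∀ v w, 0 ≤ v → v ≤ w → w ≤ P.V →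
      (Λ * Xf P T Hτ M p w - Xf P T H N p w) - (Λ * Xf P T Hτ M p v - Xf P T H N p v)
      ≤ (∫ t in (0:ℝ)..P.V, W t) + 2 * C * Λ * e := by
    intro v w hv hvw hw
    have d1 := Dd_nonneg S hk0 hk1 hG hG0 T H N hv hvw hw
    have d2 := Dd_nonneg S hk0 hk1 hG hG0 (Tst.comb C T0 T hTT) Hτ M hv hvw hw
    rw [Dd_comb S hG0] at d2
    have d3 := Dd_le S hk0 hk1 hG hG0 T0 Hτ M hv hvw hw
    have d4 : Dd P T Hτ M p v w ≤ C * e := by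
      have := mul_le_mul_of_nonneg_left (d3.trans m1) hC
      linarith
    have cA := Ac_cont S hG0 T H N
    have cA' := Ac_cont S hG0 T Hτ M
    have hpt : ∀ t ∈ Ioo v w, Λ * Ac P T Hτ M p t - Ac P T H N p t ≤
        W t + C * Λ * (P.gin / P.σ) * th t := by
      intro t ht
      have w1 := hWb t ⟨by linarith [ht.1], by linarith [ht.2]⟩
      have b1 := hβ _ (S.nonneg t 0)
      have b2 := thd_nonpos H N (S.nonneg t 0)
      have k1 : 0 ≤ 1 / P.σ * P.a * (-T.f1 0) * (Λ * tht Hτ M (p t 0) - tht H N (p t 0)) :=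
        mul_nonneg (mul_nonneg (by positivity) (by linarith)) (by linarith)
      have k2 : 0 ≤ P.gin / P.σ * T.f 0 * (- thd H N (p t 0)) :=
        mul_nonneg (mul_nonneg (by positivity) (T.nonneg 0)) (by linarith)
      have k3 : 0 ≤ (C - T.f 0) * (Λ * (P.gin / P.σ) * th t) :=
        mul_nonneg (by linarith) (mul_nonneg (by positivity) (th0 t))
      have e1 : Λ * Ac P T Hτ M p t - Ac P T H N p t = (Λ * Ic P T Hτ M p t - Ic P T H N p t)
        - 1 / P.σ * P.a * (-T.f1 0) * (Λ * tht Hτ M (p t 0) - tht H N (p t 0))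
        + T.f 0 * (Λ * (P.gin / P.σ) * th t) - P.gin / P.σ * T.f 0 * (- thd H N (p t 0)) := by
        simp only [Ac, hth]
        ring
      rw [e1]
      linarith
    have iW : IntervalIntegrable W volume v w := hW.mono_set (by
      rw [uIcc_of_le hvw, uIcc_of_le hV.le]; exact Icc_subset_Icc hv hw)
    have ith : ∀ x y, IntervalIntegrable (fun t => C * Λ * (P.gin / P.σ) * th t) volume x y :=
      fun x y => (cth.const_mul _).intervalIntegrable _ _
    have hint : Λ * (∫ t in v..w, Ac P T Hτ M p t) - (∫ t in v..w, Ac P T H N p t) ≤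
        (∫ t in (0:ℝ)..P.V, W t) + C * Λ * (P.gin / P.σ * ∫ t in (0:ℝ)..P.V, th t) := by
      rw [← intervalIntegral.integral_const_mul, ← intervalIntegral.integral_sub
        ((cA'.intervalIntegrable _ _).const_mul Λ) (cA.intervalIntegrable _ _)]
      have s1 := intervalIntegral.integral_mono_on_of_le_Ioo hvw
        (((cA'.intervalIntegrable v w).const_mul Λ).sub (cA.intervalIntegrable v w))
        (iW.add (ith v w)) hpt
      have s2 : ∫ t in v..w, (W t + C * Λ * (P.gin / P.σ) * th t) ≤
          ∫ t in (0:ℝ)..P.V, (W t + C * Λ * (P.gin / P.σ) * th t) := by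
        refine intervalIntegral.integral_mono_interval hv hvw hw ?_ (hW.add (ith _ _))
        refine Eventually.of_forall fun t => ?_
        exact add_nonneg (hW0 t) (mul_nonneg (by positivity) (th0 t))
      rw [intervalIntegral.integral_add hW (ith _ _), intervalIntegral.integral_const_mul] at s2
      refine s1.trans (s2.trans (le_of_eq ?_))
      ring
    have m2' := mul_le_mul_of_nonneg_left m2 (mul_nonneg hC hΛ)
    have d4' := mul_le_mul_of_nonneg_left d4 hΛ
    unfold Dd at d1 d4'
    linarith
  have hlow : -(C * Λ * e) ≤ (Λ * Xf P T Hτ M p P.V - Xf P T H N p P.V)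
      - (Λ * Xf P T Hτ M p 0 - Xf P T H N p 0) := by
    have b1 := Xf_bc S B hk0 hk1 hG0 T H N
    have b2 := Xf_bc S B hk0 hk1 hG0 (Tst.comb C T0 T hTT) Hτ M
    rw [Xf_comb S hG0, Xf_comb S hG0] at b2
    have b3 := mul_le_mul_of_nonneg_left m3 hC
    have b4 : -(C * e) ≤ Xf P T Hτ M p P.V - Xf P T Hτ M p 0 := by linarith
    have b5 := mul_le_mul_of_nonneg_left b4 hΛ
    linarith
  have u1 := hup v w hv hvw hw
  have u2 := hup 0 v le_rfl hv (hvw.trans hw)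
  have u3 := hup w P.V (hv.trans hvw) hw le_rfl
  have hWn : 0 ≤ ∫ t in (0:ℝ)..P.V, W t :=
    intervalIntegral.integral_nonneg hV.le fun t _ => hW0 t
  have hCe : 0 ≤ C * Λ * e := by positivity
  rw [abs_le]
  constructor <;> linarith

/-- normalised truncation nonlinearity -/
def tauEta : Eta := Eta.ofB (fun u => 6 * max 0 (u * (1 - u))) (by fun_prop) (fun u => by positivity)
  (fun u hu => by
    have : u * (1 - u) ≤ 0 := mul_nonpos_of_nonpos_of_nonneg hu (by linarith)
    simp [max_eq_left this])

lemma tauEta_f1_one : tauEta.f1 1 = 1 := by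
  show ∫ t in (0:ℝ)..1, 6 * max 0 (t * (1 - t)) = _
  rw [intervalIntegral.integral_congr (g := fun t => 6 * t - 6 * t ^ 2)]
  · rw [intervalIntegral.integral_sub, intervalIntegral.integral_const_mul,
      intervalIntegral.integral_const_mul, integral_id, integral_pow]
    · norm_num
    · exact Continuous.intervalIntegrable (by fun_prop) _ _
    · exact Continuous.intervalIntegrable (by fun_prop) _ _
  · intro t ht
    rw [uIcc_of_le zero_le_one] at ht
    have : 0 ≤ t * (1 - t) := mul_nonneg ht.1 (by linarith [ht.2])
    simp only [max_eq_right this]; ring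

lemma tauEta_f1 {u : ℝ} (hu : 1 ≤ u) : tauEta.f1 u = 1 := by
  have hc := tauEta.c1
  have h1 := mv_bound (f := tauEta.f1) (f' := tauEta.f2) (K := 0) hu hc.continuousOn
    (fun z _ => tauEta.d2 z) (fun z hz => by
      show 6 * max 0 (z * (1 - z)) ≤ 0
      have : z * (1 - z) ≤ 0 := mul_nonpos_of_nonneg_of_nonpos (by linarith [hz.1]) (by linarith [hz.1])
      simp [max_eq_left this])
  have h2 := tauEta.mono1 hu
  rw [tauEta_f1_one] at h1 h2
  linarith

lemma tau_eq {M s : ℝ} (hs : 0 ≤ s) (hM : s ≤ M - 1) : tht tauEta M s = s := by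
  have h1 := tht_le tauEta M hs
  have h2 := tht_ge tauEta M hs
  rw [tauEta_f1 (by linarith)] at h1 h2
  linarith

lemma taud_eq {M s : ℝ} (hs : 0 ≤ s) (hM : s ≤ M - 1) : thd tauEta M s = 0 := by
  rw [thd, tau_eq hs hM, tauEta_f1 (by linarith)]; ring

lemma tau_f1_le (u : ℝ) : tauEta.f1 u ≤ 1 := by
  rcases le_total u 1 with h | h
  · have := tauEta.mono1 h; rw [tauEta_f1_one] at this; exact this
  · exact (tauEta_f1 h).le

lemma tau_le {M s : ℝ} (hs : 0 ≤ s) : tht tauEta M s ≤ s := by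
  have h1 := tht_le tauEta M hs
  have := mul_le_mul_of_nonneg_left (tau_f1_le M) hs
  linarith

lemma taud_ge {M s : ℝ} (hs : 0 ≤ s) : -s ≤ thd tauEta M s := by
  have h1 := thd_ge tauEta M hs
  have := mul_le_mul_of_nonneg_left (tau_f1_le M) hs
  linarith

lemma tht_mono (H : Eta) (N : ℝ) {s t : ℝ} (h : s ≤ t) : tht H N s ≤ tht H N t := by
  have := H.mono (show N - t ≤ N - s by linarith)
  unfold tht; linarith

lemma tht_le_tau (H : Eta) {N M s : ℝ} (hN : 0 ≤ N) (hM : N ≤ M - 1) (hs : 0 ≤ s) :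
    tht H N s ≤ H.f1 N * tht tauEta M s := by
  rcases le_total s (M - 1) with h | h
  · rw [tau_eq hs h, mul_comm]; exact tht_le H N hs
  · have h1 : tht H N s ≤ tht H N N := by
      have := H.n0 (N - s)
      have h2 := H.z0 0 le_rfl
      unfold tht; rw [sub_self, h2]; linarith
    have h2 := tht_le H N hN
    have h3 := tht_mono tauEta M h
    rw [tau_eq (by linarith) le_rfl] at h3
    have h4 := mul_le_mul_of_nonneg_left (hM.trans h3) (H.n1 N)
    linarith

section beta
variable {H : Eta} {N q δ : ℝ}

/-- derivative of `q s^(q-1)` -/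
lemma hasDeriv_qpow (hq : 1 < q) {s : ℝ} (hs : 0 < s) :
    HasDerivAt (fun s : ℝ => q * s ^ (q - 1)) (q * (q - 1) * s ^ (q - 2)) s := by
  have := (Real.hasDerivAt_rpow_const (p := q - 1) (Or.inl hs.ne')).const_mul q
  refine this.congr_deriv ?_
  rw [show q - 1 - 1 = q - 2 by ring]; ring

lemma beta_bounds (hq : 1 < q) (h1 : ∀ s, 0 < s → H.f2 (N - s) ≤ q * (q - 1) * s ^ (q - 2)) {s : ℝ}
    (hs : 0 ≤ s) : 0 ≤ H.f1 N * s - tht H N s ∧ H.f1 N * s - tht H N s ≤ s ^ q ∧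
      -thd H N s ≤ (q - 1) * s ^ q := by
  have c0 := H.c; have c1 := H.c1; have c2 := tht_cont H N
  have cq : Continuous fun s : ℝ => s ^ q := Real.continuous_rpow_const (by linarith)
  have cq1 : Continuous fun s : ℝ => s ^ (q - 1) := Real.continuous_rpow_const (by linarith)
  have d1 : ∀ s, HasDerivAt (fun s => H.f1 (N - s)) (-(H.f2 (N - s))) s := fun s => by
    have := (H.d2 (N - s)).comp s ((hasDerivAt_id s).const_sub N)
    refine this.congr_deriv ?_; ring
  have d0 : ∀ s, HasDerivAt (fun s => tht H N s) (H.f1 (N - s)) s := fun s => by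
    have := ((H.d1 (N - s)).comp s ((hasDerivAt_id s).const_sub N)).const_sub (H.f N)
    refine this.congr_deriv ?_; ring
  have dq : ∀ s, HasDerivAt (fun s : ℝ => s ^ q) (q * s ^ (q - 1)) s := fun s =>
    Real.hasDerivAt_rpow_const (Or.inr hq.le)
  have e1 : ∀ s, 0 ≤ s → H.f1 N - H.f1 (N - s) ≤ q * s ^ (q - 1) := fun s hs => by
    have := mv_bound (f := fun s => - H.f1 (N - s) - q * s ^ (q - 1))
      (f' := fun s => H.f2 (N - s) - q * (q - 1) * s ^ (q - 2)) (K := 0) hs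
      (Continuous.continuousOn (by fun_prop))
      (fun z hz => by
        refine ((d1 z).neg.sub (hasDeriv_qpow hq hz.1)).congr_deriv ?_; ring)
      (fun z hz => by have := h1 z hz.1; linarith)
    simp only [sub_zero] at this
    rw [Real.zero_rpow (by linarith)] at this
    linarith
  refine ⟨by have := tht_le H N hs; linarith, ?_, ?_⟩
  · have := mv_bound (f := fun s => H.f1 N * s - tht H N s - s ^ q)
      (f' := fun s => H.f1 N - H.f1 (N - s) - q * s ^ (q - 1)) (K := 0) hs
      (Continuous.continuousOn (by fun_prop))
      (fun z hz => by
        refine ((((hasDerivAt_id z).const_mul (H.f1 N)).sub (d0 z)).sub (dq z)).congr_deriv ?_; ring)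
      (fun z hz => by have := e1 z hz.1.le; linarith)
    simp only [sub_zero, tht_zero] at this
    rw [Real.zero_rpow (by linarith)] at this
    linarith
  · have := mv_bound (f := fun s => -(s * H.f1 (N - s)) + tht H N s - (q - 1) * s ^ q)
      (f' := fun s => s * H.f2 (N - s) - (q - 1) * (q * s ^ (q - 1))) (K := 0) hs
      (Continuous.continuousOn (by fun_prop))
      (fun z hz => by
        refine ((((hasDerivAt_id z).mul (d1 z)).neg.add (d0 z)).sub
          ((dq z).const_mul (q - 1))).congr_deriv ?_
        simp)
      (fun z hz => by
        have h2 := mul_le_mul_of_nonneg_left (h1 z hz.1) hz.1.le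
        have h3 : z ^ (q - 1) = z * z ^ (q - 2) := by
          rw [show q - 1 = 1 + (q - 2) by ring, Real.rpow_add hz.1, Real.rpow_one]
        rw [h3]; linarith)
    simp only [sub_zero, tht_zero] at this
    rw [Real.zero_rpow (by linarith)] at this
    unfold thd; linarith

lemma beta_lower (hq : 1 < q) (hδ : 0 < δ)
    (h2 : ∀ s, δ < s → s < N - 1 → H.f2 (N - s) = q * (q - 1) * s ^ (q - 2)) {s : ℝ}
    (hs : 0 ≤ s) (hN : s ≤ N - 1) :
    s ^ q - (H.f1 N * s - tht H N s) ≤ δ ^ q + q * δ ^ (q - 1) * s := by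
  have c0 := H.c; have c1 := H.c1; have c2 := tht_cont H N
  have cq : Continuous fun s : ℝ => s ^ q := Real.continuous_rpow_const (by linarith)
  have cq1 : Continuous fun s : ℝ => s ^ (q - 1) := Real.continuous_rpow_const (by linarith)
  have d1 : ∀ s, HasDerivAt (fun s => H.f1 (N - s)) (-(H.f2 (N - s))) s := fun s => by
    have := (H.d2 (N - s)).comp s ((hasDerivAt_id s).const_sub N)
    refine this.congr_deriv ?_; ring
  have d0 : ∀ s, HasDerivAt (fun s => tht H N s) (H.f1 (N - s)) s := fun s => by
    have := ((H.d1 (N - s)).comp s ((hasDerivAt_id s).const_sub N)).const_sub (H.f N)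
    refine this.congr_deriv ?_; ring
  have dq : ∀ s, HasDerivAt (fun s : ℝ => s ^ q) (q * s ^ (q - 1)) s := fun s =>
    Real.hasDerivAt_rpow_const (Or.inr hq.le)
  have hp : 0 < δ ^ (q - 1) := Real.rpow_pos_of_pos hδ _
  have hb : ∀ s, 0 ≤ s → 0 ≤ H.f1 N * s - tht H N s := fun s hs => by
    have := tht_le H N hs; linarith
  have hqp : 0 ≤ q * δ ^ (q - 1) * s := by have : 0 < q := by linarith
                                           positivity
  rcases le_total s δ with h | h
  · have h3 := Real.rpow_le_rpow hs h (show 0 ≤ q by linarith)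
    have := hb s hs
    linarith
  · have e1 : ∀ z, δ ≤ z → z ≤ N - 1 → q * z ^ (q - 1) - (H.f1 N - H.f1 (N - z)) ≤ q * δ ^ (q - 1) := by
      intro z hz hz2
      have := mv_bound (f := fun s => q * s ^ (q - 1) + H.f1 (N - s))
        (f' := fun s => q * (q - 1) * s ^ (q - 2) - H.f2 (N - s)) (K := 0) hz
        (Continuous.continuousOn (by fun_prop))
        (fun y hy => by
          refine ((hasDeriv_qpow hq (hδ.trans hy.1)).add (d1 y)).congr_deriv ?_; ring)
        (fun y hy => by have := h2 y hy.1 (hy.2.trans_le hz2); linarith)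
      have h4 := H.mono1 (show N - δ ≤ N by linarith)
      linarith
    have := mv_bound (f := fun s => s ^ q - (H.f1 N * s - tht H N s))
      (f' := fun s => q * s ^ (q - 1) - (H.f1 N - H.f1 (N - s))) (K := q * δ ^ (q - 1)) h
      (Continuous.continuousOn (by fun_prop))
      (fun z hz => by
        refine ((dq z).sub (((hasDerivAt_id z).const_mul (H.f1 N)).sub (d0 z))).congr_deriv ?_; ring)
      (fun z hz => e1 z hz.1.le (hz.2.le.trans hN))
    have h5 := hb δ hδ.le
    have h6 : 0 ≤ q * δ ^ (q - 1) * δ := by have : 0 < q := by linarith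
                                            positivity
    linarith
end beta

lemma exists_beta {q : ℝ} (hq : 1 < q) {n : ℝ} (hn : 1 ≤ n) : ∃ H : Eta,
    (∀ s, 0 ≤ s → 0 ≤ H.f1 n * s - tht H n s ∧ H.f1 n * s - tht H n s ≤ s ^ q ∧
      -thd H n s ≤ (q - 1) * s ^ q) ∧
    (∀ s, 0 ≤ s → s ≤ n - 1 →
      s ^ q - (H.f1 n * s - tht H n s) ≤ (2 / n) ^ q + q * (2 / n) ^ (q - 1) * s) := by
  have hn0 : 0 < n := by linarith
  have hq1 : 0 < q * (q - 1) := mul_pos (by linarith) (by linarith)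
  set κ : ℝ → ℝ := fun s => max 0 (min 1 (min (n * s - 1) (n - s))) with hκ
  have hκ0 : ∀ s, 0 ≤ κ s := fun s => le_max_left _ _
  have hκ1 : ∀ s, κ s ≤ 1 := fun s => max_le zero_le_one (min_le_left _ _)
  have hpos : ∀ u, 0 < max (n - u) (1 / n) := fun u => lt_max_of_lt_right (by positivity)
  have hc : Continuous fun u => κ (n - u) * (q * (q - 1) * (max (n - u) (1 / n)) ^ (q - 2)) := by
    have : Continuous fun u => (max (n - u) (1 / n)) ^ (q - 2) :=
      Continuous.rpow_const (by fun_prop) (fun u => Or.inl (hpos u).ne')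
    have h2 : Continuous κ := by simp only [hκ]; fun_prop
    fun_prop
  refine ⟨Eta.ofB _ hc (fun u => ?_) (fun u hu => ?_), fun s hs => ?_, fun s hs hs2 => ?_⟩
  · have := hκ0 (n - u)
    have := Real.rpow_pos_of_pos (hpos u) (q - 2)
    positivity
  · have : κ (n - u) = 0 := by
      simp only [hκ]
      exact max_eq_left ((min_le_right _ _).trans ((min_le_right _ _).trans (by linarith)))
    simp only [this, zero_mul]
  · refine beta_bounds hq (fun s hs => ?_) hs
    show κ (n - (n - s)) * (q * (q - 1) * (max (n - (n - s)) (1 / n)) ^ (q - 2)) ≤ _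
    rw [sub_sub_cancel]
    have hsp := Real.rpow_pos_of_pos hs (q - 2)
    rcases le_total s (1 / n) with h | h
    · have : κ s = 0 := by
        simp only [hκ]
        refine max_eq_left ((min_le_right _ _).trans ((min_le_left _ _).trans ?_))
        have := mul_le_mul_of_nonneg_left h hn0.le
        rw [mul_one_div_cancel hn0.ne'] at this
        linarith
      rw [this, zero_mul]; positivity
    · rw [max_eq_left h]
      exact mul_le_of_le_one_left (by positivity) (hκ1 s)
  · refine beta_lower hq (by positivity) (fun s h1 h2 => ?_) hs hs2
    show κ (n - (n - s)) * (q * (q - 1) * (max (n - (n - s)) (1 / n)) ^ (q - 2)) = _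
    rw [sub_sub_cancel]
    have h3 : 2 < n * s := by
      have := mul_lt_mul_of_pos_left h1 hn0
      rwa [mul_div_cancel₀ _ hn0.ne'] at this
    have h4 : κ s = 1 := by
      simp only [hκ]
      rw [min_eq_left (le_min (by linarith) (by linarith))]
      exact max_eq_right zero_le_one
    have h5 : 1 / n ≤ s := by
      have : 1 / n ≤ 2 / n := by gcongr; norm_num
      linarith
    rw [h4, max_eq_left h5, one_mul]

/-- profiles for the test functions -/
structure HF where
  h : ℝ → ℝ
  h1 : ℝ → ℝ
  h2 : ℝ → ℝ
  d1 : ∀ g, HasDerivAt h (h1 g) g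
  d2 : ∀ g, HasDerivAt h1 (h2 g) g
  c2 : Continuous h2
  nn : ∀ g, 0 ≤ h g
  up : ∀ g, 0 ≤ g → h g ≤ 3 * (1 + g)
  left : ∀ g, g ≤ 0 → h g ≤ 3 * (1 + tauEta.f (-g))
  b1 : ∀ g, |h1 g| ≤ 1
  b2 : ∀ g, |h2 g| ≤ 2
  z : h1 0 ≤ 0

lemma tau_f2_le (u : ℝ) : |tauEta.f2 u| ≤ 2 := by
  rw [abs_of_nonneg (tauEta.n2 u)]
  show 6 * max 0 (u * (1 - u)) ≤ 2
  have : max 0 (u * (1 - u)) ≤ 1 / 4 := max_le (by norm_num) (by nlinarith [sq_nonneg (u - 1/2)])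
  linarith

lemma tau_f1_abs (u : ℝ) : |tauEta.f1 u| ≤ 1 := by
  rw [abs_of_nonneg (tauEta.n1 u)]; exact tau_f1_le u

lemma tau_f_le {u : ℝ} (hu : 0 ≤ u) : tauEta.f u ≤ u := by
  have := mv_bound (f := tauEta.f) (f' := tauEta.f1) (K := 1) hu tauEta.c.continuousOn
    (fun z _ => tauEta.d1 z) (fun z _ => tau_f1_le z)
  rw [tauEta.z0 0 le_rfl] at this
  linarith

lemma tau_f_ge (u : ℝ) : u - 1 ≤ tauEta.f u := by
  rcases le_total u 1 with h | h
  · have := tauEta.n0 u; linarith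
  · have := mv_bound_below (f := tauEta.f) (f' := tauEta.f1) (K := 1) h tauEta.c.continuousOn
      (fun z _ => tauEta.d1 z) (fun z hz => (tauEta_f1 hz.1.le).ge)
    have h2 := tauEta.n0 1
    linarith

lemma tau_refl_d1 (c g : ℝ) : HasDerivAt (fun g => tauEta.f (c - g)) (-tauEta.f1 (c - g)) g := by
  refine ((tauEta.d1 (c - g)).comp g ((hasDerivAt_id g).const_sub c)).congr_deriv ?_
  ring

lemma tau_refl_d2 (c g : ℝ) : HasDerivAt (fun g => -tauEta.f1 (c - g)) (tauEta.f2 (c - g)) g := by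
  refine ((tauEta.d2 (c - g)).comp g ((hasDerivAt_id g).const_sub c)).neg.congr_deriv ?_
  ring

def hfB : HF where
  h := fun g => tauEta.f (2 - g)
  h1 := fun g => -tauEta.f1 (2 - g)
  h2 := fun g => tauEta.f2 (2 - g)
  d1 := tau_refl_d1 2
  d2 := tau_refl_d2 2
  c2 := by have := tauEta.c2; fun_prop
  nn := fun g => tauEta.n0 _
  up := fun g hg => by
    have h1 := tauEta.mono (show 2 - g ≤ 2 by linarith)
    have := tau_f_le (u := 2) (by norm_num)
    linarith
  left := fun g hg => by
    have h1 := tau_f_le (u := 2 - g) (by linarith)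
    have h2 := tau_f_ge (-g)
    have := tauEta.n0 (-g)
    linarith
  b1 := fun g => by rw [abs_neg]; exact tau_f1_abs _
  b2 := fun g => tau_f2_le _
  z := by rw [neg_nonpos]; exact tauEta.n1 _

def hfA : HF where
  h := fun g => g + tauEta.f (2 - g)
  h1 := fun g => 1 + -tauEta.f1 (2 - g)
  h2 := fun g => tauEta.f2 (2 - g)
  d1 := fun g => (hasDerivAt_id g).add (tau_refl_d1 2 g)
  d2 := fun g => (tau_refl_d2 2 g).const_add 1
  c2 := by have := tauEta.c2; fun_prop
  nn := fun g => by
    have := tau_f_ge (2 - g)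
    linarith
  up := fun g hg => by
    have h1 := tauEta.mono (show 2 - g ≤ 2 by linarith)
    have := tau_f_le (u := 2) (by norm_num)
    linarith
  left := fun g hg => by
    have h1 := tau_f_le (u := 2 - g) (by linarith)
    have := tauEta.n0 (-g)
    linarith
  b1 := fun g => by
    have h1 := tauEta.n1 (2 - g)
    have h2 := tau_f1_le (2 - g)
    rw [abs_le]; constructor <;> linarith
  b2 := fun g => tau_f2_le _
  z := by rw [tauEta_f1 (by norm_num)]; norm_num

def hfC : HF where
  h := fun _ => 1
  h1 := fun _ => 0
  h2 := fun _ => 0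
  d1 := fun g => hasDerivAt_const g 1
  d2 := fun g => hasDerivAt_const g 0
  c2 := continuous_const
  nn := fun g => zero_le_one
  up := fun g hg => by linarith
  left := fun g hg => by
    have := tauEta.n0 (-g)
    linarith
  b1 := fun g => by simp
  b2 := fun g => by simp
  z := le_rfl

def hfD : HF where
  h := fun g => 1 + tauEta.f (0 - g)
  h1 := fun g => -tauEta.f1 (0 - g)
  h2 := fun g => tauEta.f2 (0 - g)
  d1 := fun g => (tau_refl_d1 0 g).const_add 1
  d2 := tau_refl_d2 0
  c2 := by have := tauEta.c2; fun_prop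
  nn := fun g => by have := tauEta.n0 (0 - g); linarith
  up := fun g hg => by rw [tauEta.z0 (0 - g) (by linarith)]; linarith
  left := fun g hg => by
    rw [zero_sub]
    have := tauEta.n0 (-g); linarith
  b1 := fun g => by rw [abs_neg]; exact tau_f1_abs _
  b2 := fun g => tau_f2_le _
  z := by rw [neg_nonpos]; exact tauEta.n1 _

/-- the reference cutoff -/
def chi0 : Tst 1 := (exists_cutoff (A := 0) (B := 1/2) (G := 1) (by norm_num) (by norm_num)).choose

lemma chi0_spec : (∀ g, g ≤ 0 → chi0.f g = 1) ∧ (∀ g, g < 0 → chi0.f1 g = 0 ∧ chi0.f2 g = 0) :=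
  (exists_cutoff (A := 0) (B := 1/2) (G := 1) (by norm_num) (by norm_num)).choose_spec

lemma chi0_right : ∀ g, 1 ≤ g → chi0.f g = 0 ∧ chi0.f1 g = 0 ∧ chi0.f2 g = 0 := by
  intro g hg
  obtain ⟨r, hr, h⟩ := chi0.supp
  have e0 : ∀ z, 1 - r < z → chi0.f =ᶠ[nhds z] fun _ => 0 := fun z hz => by
    filter_upwards [lt_mem_nhds hz] with y hy using h y hy.le
  have e1 : ∀ z, 1 - r < z → chi0.f1 z = 0 := fun z hz => by
    have := (e0 z hz).deriv_eq
    rw [(chi0.d1 z).deriv] at this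
    simpa using this
  have e2 : chi0.f2 g = 0 := by
    have : chi0.f1 =ᶠ[nhds g] fun _ => 0 := by
      filter_upwards [lt_mem_nhds (show 1 - r < g by linarith)] with y hy using e1 y hy
    have := this.deriv_eq
    rw [(chi0.d2 g).deriv] at this
    simpa using this
  exact ⟨h g (by linarith), e1 g (by linarith), e2⟩

lemma exists_K0 : ∃ K, 1 ≤ K ∧ ∀ g, chi0.f g ≤ K ∧ |chi0.f1 g| ≤ K ∧ |chi0.f2 g| ≤ K := by
  have c0 := chi0.c; have c1 := chi0.c1; have c2 := chi0.c2
  obtain ⟨x, -, hx⟩ := (isCompact_Icc (a := (0:ℝ)) (b := 1)).exists_isMaxOn ⟨0, by simp⟩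
    (f := fun g => |chi0.f g| + |chi0.f1 g| + |chi0.f2 g|) (Continuous.continuousOn (by fun_prop))
  refine ⟨1 + (|chi0.f x| + |chi0.f1 x| + |chi0.f2 x|), by
    have := abs_nonneg (chi0.f x); have := abs_nonneg (chi0.f1 x); have := abs_nonneg (chi0.f2 x)
    linarith, fun g => ?_⟩
  have h0 := abs_nonneg (chi0.f x); have h1 := abs_nonneg (chi0.f1 x)
  have h2 := abs_nonneg (chi0.f2 x)
  rcases lt_or_ge g 0 with h | h
  · rw [chi0_spec.1 g h.le, (chi0_spec.2 g h).1, (chi0_spec.2 g h).2]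
    simp only [abs_zero]
    refine ⟨?_, ?_, ?_⟩ <;> linarith
  rcases lt_or_ge 1 g with h' | h'
  · obtain ⟨e0, e1, e2⟩ := chi0_right g h'.le
    rw [e0, e1, e2]
    simp only [abs_zero]
    refine ⟨?_, ?_, ?_⟩ <;> linarith
  have := hx (show g ∈ Icc (0:ℝ) 1 from ⟨h, h'⟩)
  simp only [mem_ofPred_eq] at this
  have a0 := abs_nonneg (chi0.f g); have a1 := abs_nonneg (chi0.f1 g)
  have a2 := abs_nonneg (chi0.f2 g)
  have := le_abs_self (chi0.f g)
  refine ⟨?_, ?_, ?_⟩ <;> linarith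

def K0 : ℝ := exists_K0.choose
lemma K0_ge : 1 ≤ K0 := exists_K0.choose_spec.1
lemma K0_spec : ∀ g, chi0.f g ≤ K0 ∧ |chi0.f1 g| ≤ K0 ∧ |chi0.f2 g| ≤ K0 := exists_K0.choose_spec.2

/-- test function with profile `h` and cutoff at `R` -/
def HF.tst (h : HF) (R : ℝ) {G : ℝ} (hR : R + 1 < G) : Tst G where
  f := fun g => h.h g * chi0.f (g - R)
  f1 := fun g => h.h1 g * chi0.f (g - R) + h.h g * chi0.f1 (g - R)
  f2 := fun g => h.h2 g * chi0.f (g - R) + 2 * (h.h1 g * chi0.f1 (g - R)) + h.h g * chi0.f2 (g - R)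
  nonneg := fun g => mul_nonneg (h.nn g) (chi0.nonneg _)
  d1 := fun g => (h.d1 g).mul ((chi0.d1 (g - R)).comp_sub_const g R)
  d2 := fun g => by
    refine (((h.d2 g).mul ((chi0.d1 (g - R)).comp_sub_const g R)).add
      ((h.d1 g).mul ((chi0.d2 (g - R)).comp_sub_const g R))).congr_deriv ?_
    ring
  c2 := by
    have c0 := chi0.c; have c1 := chi0.c1; have c2 := chi0.c2
    have d0 : Continuous h.h := continuous_iff_continuousAt.2 fun g => (h.d1 g).continuousAt
    have d1 : Continuous h.h1 := continuous_iff_continuousAt.2 fun g => (h.d2 g).continuousAt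
    have d2 := h.c2
    fun_prop
  supp := ⟨G - (R + 1), by linarith, fun g hg => by
    rw [(chi0_right (g - R) (by linarith)).1, mul_zero]⟩

/-- constant in the estimates for the tests -/
def Par.K1 (P : Par) : ℝ :=
  3 * K0 * (P.gL + 1 / P.σ + 1) + (7 * K0 * P.a / P.σ + 4 * K0 * (1 + P.gin) / P.σ)

lemma Par.K1_pos (P : Par) : 0 < P.K1 := by
  have := P.hgL; have := P.hσ; have := P.ha; have := P.hgin; have := K0_ge
  have : 0 < K0 := by linarith
  unfold Par.K1; positivity

lemma HF.tst_cc (P : Par) (h : HF) {R G : ℝ} (hR : R + 1 < G) {g : ℝ} (hg : 0 ≤ g) :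
    (h.tst R hR).f g * P.cc g ≤ P.K1 * (1 + g) ^ 2 := by
  have := P.hgL; have := P.hσ; have := P.ha; have := P.hgin; have hK := K0_ge
  have : 0 < K0 := by linarith
  have h1 : (h.tst R hR).f g ≤ 3 * (1 + g) * K0 :=
    mul_le_mul (h.up g hg) (K0_spec _).1 (chi0.nonneg _) (by positivity)
  have h2 : P.cc g ≤ (P.gL + 1 / P.σ + 1) * (1 + g) := by
    unfold Par.cc
    have : 0 ≤ (P.gL + 1 / P.σ) * g := by positivity
    linarith
  have h3 := mul_le_mul h1 h2 (by unfold Par.cc; positivity) (by positivity)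
  have h4 : 0 ≤ (7 * K0 * P.a / P.σ + 4 * K0 * (1 + P.gin) / P.σ) * (1 + g) ^ 2 := by positivity
  unfold Par.K1
  linarith

lemma HF.tst_Ls (P : Par) (h : HF) {R G : ℝ} (hR : R + 1 < G) {g : ℝ} (hg : 0 ≤ g) :
    |(h.tst R hR).Ls P g| ≤ P.K1 * (1 + g) ^ 2 := by
  have := P.hgL; have hσ := P.hσ; have := P.ha; have := P.hgin; have hK := K0_ge
  have : 0 < K0 := by linarith
  have k0 : |chi0.f (g - R)| ≤ K0 := by
    rw [abs_of_nonneg (chi0.nonneg _)]; exact (K0_spec _).1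
  have k1 := (K0_spec (g - R)).2.1
  have k2 := (K0_spec (g - R)).2.2
  have hh : |h.h g| ≤ 3 * (1 + g) := by rw [abs_of_nonneg (h.nn g)]; exact h.up g hg
  have m : ∀ {x y A B : ℝ}, |x| ≤ A → |y| ≤ B → |x * y| ≤ A * B := fun hx hy => by
    rw [abs_mul]; exact mul_le_mul hx hy (abs_nonneg _) ((abs_nonneg _).trans hx)
  have f1 : |(h.tst R hR).f1 g| ≤ 4 * K0 * (1 + g) := by
    have := abs_add_le (h.h1 g * chi0.f (g - R)) (h.h g * chi0.f1 (g - R))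
    have a1 := m (h.b1 g) k0
    have a2 := m hh k1
    have : 0 ≤ K0 * g := by positivity
    show |h.h1 g * chi0.f (g - R) + h.h g * chi0.f1 (g - R)| ≤ _
    linarith
  have f2 : |(h.tst R hR).f2 g| ≤ 7 * K0 * (1 + g) := by
    have b1 := abs_add_le (h.h2 g * chi0.f (g - R) + 2 * (h.h1 g * chi0.f1 (g - R)))
      (h.h g * chi0.f2 (g - R))
    have b2 := abs_add_le (h.h2 g * chi0.f (g - R)) (2 * (h.h1 g * chi0.f1 (g - R)))
    have a1 := m (h.b2 g) k0
    have a2 := m hh k2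
    have a3 := m (h.b1 g) k1
    have a4 := m (show |(2:ℝ)| ≤ 2 by norm_num) a3
    have a5 := m (show |(2:ℝ)| ≤ 2 by norm_num) (le_refl |h.h1 g * chi0.f1 (g - R)|)
    have : 0 ≤ K0 * g := by positivity
    show |h.h2 g * chi0.f (g - R) + 2 * (h.h1 g * chi0.f1 (g - R)) + h.h g * chi0.f2 (g - R)| ≤ _
    linarith
  have s1 : |P.a / P.σ| ≤ P.a / P.σ := by rw [abs_of_nonneg (by positivity)]
  have s2 : |(g - P.gin) / P.σ| ≤ (1 + P.gin) / P.σ * (1 + g) := by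
    rw [abs_div, abs_of_pos hσ, div_mul_eq_mul_div]
    gcongr
    have : 0 ≤ P.gin * g := by positivity
    rw [abs_le]; constructor <;> linarith
  have t1 := m s1 f2
  have t2 := m s2 f1
  have t3 := abs_sub (P.a / P.σ * (h.tst R hR).f2 g) ((g - P.gin) / P.σ * (h.tst R hR).f1 g)
  have q1 : P.a / P.σ * (7 * K0 * (1 + g)) ≤ 7 * K0 * P.a / P.σ * (1 + g) ^ 2 := by
    have : 0 ≤ 7 * K0 * P.a / P.σ * ((1 + g) * g) := by positivity
    have e : P.a / P.σ * (7 * K0 * (1 + g)) = 7 * K0 * P.a / P.σ * (1 + g) := by ring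
    rw [e]
    linarith
  have q2 : (1 + P.gin) / P.σ * (1 + g) * (4 * K0 * (1 + g)) =
    4 * K0 * (1 + P.gin) / P.σ * (1 + g) ^ 2 := by ring
  have q3 : 0 ≤ 3 * K0 * (P.gL + 1 / P.σ + 1) * (1 + g) ^ 2 := by positivity
  unfold Tst.Ls Par.K1
  linarith

lemma HF.tst_d0 (h : HF) {R G : ℝ} (hR : R + 1 < G) (hR0 : 0 < R) : (h.tst R hR).f1 0 ≤ 0 := by
  show h.h1 0 * chi0.f (0 - R) + h.h 0 * chi0.f1 (0 - R) ≤ 0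
  rw [chi0_spec.1 _ (by linarith), (chi0_spec.2 (0 - R) (by linarith)).1]
  have := h.z
  linarith

lemma hfD_d0 {R G : ℝ} (hR : R + 1 < G) (hR0 : 0 < R) :
    (hfD.tst R hR).f 0 = 1 ∧ (hfD.tst R hR).f1 0 = 0 := by
  constructor
  · show (1 + tauEta.f (0 - 0)) * chi0.f (0 - R) = 1
    rw [chi0_spec.1 _ (by linarith), tauEta.z0 (0 - 0) (by simp)]; norm_num
  · show -tauEta.f1 (0 - 0) * chi0.f (0 - R) + (1 + tauEta.f (0 - 0)) * chi0.f1 (0 - R) = 0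
    rw [(chi0_spec.2 (0 - R) (by linarith)).1, tauEta.z1 (0 - 0) (by simp)]; norm_num

lemma hfD_Ls (P : Par) {R G : ℝ} (hR : R + 1 < G) {g : ℝ} (hg : 0 ≤ g) (hgR : g < R ∨ R + 1 ≤ g) :
    (hfD.tst R hR).Ls P g = 0 := by
  have e2 : chi0.f2 (g - R) = 0 ∧ chi0.f1 (g - R) = 0 := by
    rcases hgR with h | h
    · exact ⟨(chi0_spec.2 _ (by linarith)).2, (chi0_spec.2 _ (by linarith)).1⟩
    · exact ⟨(chi0_right _ (by linarith)).2.2, (chi0_right _ (by linarith)).2.1⟩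
  have e1 : hfD.h1 g = 0 := by
    show -tauEta.f1 (0 - g) = 0
    rw [tauEta.z1 _ (by linarith)]; simp
  have e3 : hfD.h2 g = 0 := by
    show 6 * max 0 ((0 - g) * (1 - (0 - g))) = 0
    have : (0 - g) * (1 - (0 - g)) ≤ 0 :=
      mul_nonpos_of_nonpos_of_nonneg (by linarith) (by linarith)
    simp only [max_eq_left this, mul_zero]
  show P.a / P.σ * (hfD.h2 g * chi0.f (g - R) + 2 * (hfD.h1 g * chi0.f1 (g - R)) +
    hfD.h g * chi0.f2 (g - R)) -
    (g - P.gin) / P.σ * (hfD.h1 g * chi0.f (g - R) + hfD.h g * chi0.f1 (g - R)) = 0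
  rw [e2.1, e2.2, e1, e3]; ring

lemma HF.tst_le (h : HF) {R R' G : ℝ} (hR : R + 1 < G) (hR' : R' + 1 < G) (h0 : 0 < R)
    (hRR : R + 1 ≤ R') (g : ℝ) :
    (h.tst R hR).f g ≤ 3 * K0 * (2 + R) * (hfD.tst R' hR').f g := by
  have hK := K0_ge
  have : 0 < K0 := by linarith
  rcases le_total (R + 1) g with hg | hg
  · have : (h.tst R hR).f g = 0 := by
      show h.h g * chi0.f (g - R) = 0
      rw [(chi0_right _ (by linarith)).1, mul_zero]
    rw [this]
    have := (hfD.tst R' hR').nonneg g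
    positivity
  · have e : (hfD.tst R' hR').f g = 1 + tauEta.f (-g) := by
      show (1 + tauEta.f (0 - g)) * chi0.f (g - R') = _
      rw [chi0_spec.1 _ (by linarith), zero_sub, mul_one]
    rw [e]
    have hn := tauEta.n0 (-g)
    have h1 : h.h g ≤ 3 * (2 + R) * (1 + tauEta.f (-g)) := by
      rcases le_total g 0 with h2 | h2
      · have := h.left g h2
        nlinarith
      · have := h.up g h2
        nlinarith
    have h3 : (h.tst R hR).f g ≤ h.h g * K0 :=
      mul_le_mul_of_nonneg_left (K0_spec _).1 (h.nn g)
    have h4 := mul_le_mul_of_nonneg_right h1 (show 0 ≤ K0 by linarith)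
    linarith

/-- weight comparison constant -/
def Par.cw (P : Par) : ℝ := (1 + 1 / P.gL) ^ 2

lemma Par.cw_pos (P : Par) : 0 < P.cw := by
  have := P.hgL; unfold Par.cw; positivity

lemma Par.cw_le (P : Par) {g : ℝ} (hg : 0 ≤ g) : (1 + g) ^ 2 ≤ P.cw * (g + P.gL) ^ 2 := by
  have := P.hgL
  unfold Par.cw
  rw [← mul_pow]
  have e : (1 + 1 / P.gL) * (g + P.gL) = 1 + g + (P.gL + g / P.gL) := by field_simp; ring
  have h2 : 0 ≤ P.gL + g / P.gL := by positivity
  rw [e]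
  exact pow_le_pow_left₀ (by positivity) (by linarith) 2

/-- weighted power -/
def Fq (P : Par) (p : ℝ → ℝ → ℝ) (q : ℝ) (x : ℝ × ℝ) : ℝ := (x.2 + P.gL) ^ 2 * (p x.1 x.2) ^ q

section
variable {P : Par} {p p1 p2 : ℝ → ℝ → ℝ}

lemma Fq_nonneg (S : Sol P p p1 p2) (q : ℝ) (x : ℝ × ℝ) : 0 ≤ Fq P p q x :=
  mul_nonneg (sq_nonneg _) (Real.rpow_nonneg (S.nonneg _ _) _)

lemma pq_meas (S : Sol P p p1 p2) (q : ℝ) : Measurable fun x : ℝ × ℝ => (p x.1 x.2) ^ q :=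
  S.meas.pow_const q

lemma box_int {F : ℝ × ℝ → ℝ} {V G : ℝ} (hF : IntegrableOn F (Ioc 0 V ×ˢ Ioc 0 G)) :
    Integrable F ((volume.restrict (Ioc 0 V)).prod (volume.restrict (Ioc 0 G))) := by
  rw [Measure.prod_restrict]
  exact hF

lemma box_eq {F : ℝ × ℝ → ℝ} {V G : ℝ} (hV : 0 ≤ V) (hG : 0 ≤ G)
    (hF : IntegrableOn F (Ioc 0 V ×ˢ Ioc 0 G)) :
    IntervalIntegrable (fun t => ∫ g in (0:ℝ)..G, F (t, g)) volume 0 V ∧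
    ∫ t in (0:ℝ)..V, ∫ g in (0:ℝ)..G, F (t, g) = ∫ x in Ioc 0 V ×ˢ Ioc 0 G, F x := by
  have h := box_int hF
  constructor
  · rw [intervalIntegrable_iff_integrableOn_Ioc_of_le hV]
    simp only [intervalIntegral.integral_of_le hG]
    exact h.integral_prod_left
  · simp only [intervalIntegral.integral_of_le hG, intervalIntegral.integral_of_le hV]
    rw [← integral_prod _ h, Measure.prod_restrict]
    rfl

lemma W_facts (S : Sol P p p1 p2) {q : ℝ} (hI : IntegrableOn (Fq P p q) (Ioc 0 P.V ×ˢ Ioi 0))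
    {G : ℝ} (hG : 0 ≤ G) :
    IntervalIntegrable (fun t => ∫ g in (0:ℝ)..G, (1 + g) ^ 2 * (p t g) ^ q) volume 0 P.V ∧
    ∫ t in (0:ℝ)..P.V, ∫ g in (0:ℝ)..G, (1 + g) ^ 2 * (p t g) ^ q ≤
      P.cw * ∫ x in Ioc 0 P.V ×ˢ Ioi 0, Fq P p q x := by
  have hV := P.hV
  have hms : MeasurableSet (Ioc 0 P.V ×ˢ Ioi (0:ℝ)) := measurableSet_Ioc.prod measurableSet_Ioi
  have hsub : Ioc 0 P.V ×ˢ Ioc 0 G ⊆ Ioc 0 P.V ×ˢ Ioi (0:ℝ) :=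
    prod_mono subset_rfl fun x hx => hx.1
  have hm : Measurable fun x : ℝ × ℝ => (1 + x.2) ^ 2 * (p x.1 x.2) ^ q := by
    have := pq_meas S q
    fun_prop
  have hle : ∀ x ∈ Ioc 0 P.V ×ˢ Ioi (0:ℝ), (1 + x.2) ^ 2 * (p x.1 x.2) ^ q ≤ P.cw * Fq P p q x := by
    intro x hx
    have := mul_le_mul_of_nonneg_right (P.cw_le (le_of_lt hx.2)) (Real.rpow_nonneg (S.nonneg x.1 x.2) q)
    unfold Fq; linarith
  have hn : ∀ x : ℝ × ℝ, 0 ≤ (1 + x.2) ^ 2 * (p x.1 x.2) ^ q := fun x =>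
    mul_nonneg (sq_nonneg _) (Real.rpow_nonneg (S.nonneg _ _) _)
  have hi : IntegrableOn (fun x : ℝ × ℝ => (1 + x.2) ^ 2 * (p x.1 x.2) ^ q) (Ioc 0 P.V ×ˢ Ioi 0) := by
    refine Integrable.mono' (hI.const_mul P.cw) hm.aestronglyMeasurable ?_
    filter_upwards [ae_restrict_mem hms] with x hx
    rw [Real.norm_of_nonneg (hn x)]
    exact hle x hx
  obtain ⟨b1, b2⟩ := box_eq hV.le hG (hi.mono_set hsub)
  refine ⟨b1, ?_⟩
  rw [b2, ← integral_const_mul]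
  refine (setIntegral_mono_set hi (Eventually.of_forall hn) hsub.eventuallyLE).trans ?_
  exact setIntegral_mono_on hi (hI.const_mul _) hms hle

lemma p_int (S : Sol P p p1 p2) {q : ℝ} (hq : 1 ≤ q)
    (hI : IntegrableOn (Fq P p q) (Ioc 0 P.V ×ˢ Ioi 0)) (G : ℝ) :
    IntegrableOn (fun x : ℝ × ℝ => p x.1 x.2) (Ioc 0 P.V ×ˢ Ioc 0 G) := by
  have hgL := P.hgL
  have hms : MeasurableSet (Ioc 0 P.V ×ˢ Ioc (0:ℝ) G) := measurableSet_Ioc.prod measurableSet_Ioc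
  have hsub : Ioc 0 P.V ×ˢ Ioc 0 G ⊆ Ioc 0 P.V ×ˢ Ioi (0:ℝ) :=
    prod_mono subset_rfl fun x hx => hx.1
  have hfin : volume (Ioc 0 P.V ×ˢ Ioc (0:ℝ) G) ≠ ⊤ := by
    rw [Measure.volume_eq_prod, Measure.prod_prod, Real.volume_Ioc, Real.volume_Ioc]
    exact ENNReal.mul_ne_top ENNReal.ofReal_ne_top ENNReal.ofReal_ne_top
  have h1 : IntegrableOn (fun x : ℝ × ℝ => 1 + (1 / P.gL ^ 2) * Fq P p q x) (Ioc 0 P.V ×ˢ Ioc 0 G) :=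
    (integrableOn_const hfin).add ((hI.mono_set hsub).const_mul _)
  refine Integrable.mono' h1 S.meas.aestronglyMeasurable ?_
  filter_upwards [ae_restrict_mem hms] with x hx
  have hs := S.nonneg x.1 x.2
  rw [Real.norm_of_nonneg hs]
  have h2 : p x.1 x.2 ≤ 1 + (p x.1 x.2) ^ q := by
    rcases le_total (p x.1 x.2) 1 with h | h
    · have := Real.rpow_nonneg hs q; linarith
    · have := Real.rpow_le_rpow_of_exponent_le h hq
      rw [Real.rpow_one] at this; linarith
  have h3 : (p x.1 x.2) ^ q ≤ (1 / P.gL ^ 2) * Fq P p q x := by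
    unfold Fq
    rw [← mul_assoc]
    refine le_mul_of_one_le_left (Real.rpow_nonneg hs q) ?_
    rw [one_div_mul_eq_div, one_le_div (by positivity)]
    have := hx.2.1
    gcongr
    linarith
  linarith

lemma taud_tendsto (S : Sol P p p1 p2) {q : ℝ} (hq : 1 ≤ q)
    (hI : IntegrableOn (Fq P p q) (Ioc 0 P.V ×ˢ Ioi 0)) (G : ℝ) :
    Tendsto (fun M : ℝ => ∫ x in Ioc 0 P.V ×ˢ Ioc 0 G, -thd tauEta M (p x.1 x.2)) atTop (nhds 0) := by
  have h := tendsto_integral_filter_of_dominated_convergence (l := (atTop : Filter ℝ))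
    (F := fun M (x : ℝ × ℝ) => -thd tauEta M (p x.1 x.2)) (f := fun _ => (0:ℝ))
    (μ := volume.restrict (Ioc 0 P.V ×ˢ Ioc (0:ℝ) G)) (fun x => p x.1 x.2) ?_ ?_ (p_int S hq hI G) ?_
  · simpa using h
  · refine Eventually.of_forall fun M => ?_
    exact (((thd_cont tauEta M).measurable.comp S.meas).neg).aestronglyMeasurable
  · refine Eventually.of_forall fun M => Eventually.of_forall fun x => ?_
    have h1 := thd_nonpos tauEta M (S.nonneg x.1 x.2)
    have h2 := taud_ge (M := M) (S.nonneg x.1 x.2)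
    rw [Real.norm_of_nonneg (by linarith)]; linarith
  · refine Eventually.of_forall fun x => ?_
    refine tendsto_const_nhds.congr' ?_
    filter_upwards [eventually_ge_atTop (p x.1 x.2 + 1)] with M hM
    rw [taud_eq (S.nonneg x.1 x.2) (by linarith)]; simp

lemma taud_int (S : Sol P p p1 p2) {q : ℝ} (hq : 1 ≤ q)
    (hI : IntegrableOn (Fq P p q) (Ioc 0 P.V ×ˢ Ioi 0)) (G M : ℝ) :
    IntegrableOn (fun x : ℝ × ℝ => -thd tauEta M (p x.1 x.2)) (Ioc 0 P.V ×ˢ Ioc 0 G) := by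
  refine Integrable.mono' (p_int S hq hI G)
    (((thd_cont tauEta M).measurable.comp S.meas).neg).aestronglyMeasurable ?_
  refine Eventually.of_forall fun x => ?_
  have h1 := thd_nonpos tauEta M (S.nonneg x.1 x.2)
  have h2 := taud_ge (M := M) (S.nonneg x.1 x.2)
  rw [Real.norm_of_nonneg (by linarith)]; linarith

set_option maxHeartbeats 1000000 in
lemma ee_small (S : Sol P p p1 p2) {q : ℝ} (hq : 1 ≤ q)
    (hI : IntegrableOn (Fq P p q) (Ioc 0 P.V ×ˢ Ioi 0))
    (hdec : ∀ ε > 0, ∃ G0 : ℝ, ∀ g, G0 ≤ g → ∀ v ∈ Ioo 0 P.V, g ^ 2 * p v g < ε)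
    {ε : ℝ} (hε : 0 < ε) :
    ∃ R0, ∀ R', R0 ≤ R' → ∀ {G : ℝ} (hG : R' + 1 < G), ∀ᶠ M in atTop,
      ee P (hfD.tst R' hG) tauEta M p ≤ ε := by
  have hV := P.hV
  have hK := P.K1_pos
  set ε' := ε / (2 * (4 * P.K1 * P.V)) with hε'
  have hε0 : 0 < ε' := by positivity
  obtain ⟨G0, hG0⟩ := hdec ε' hε0
  refine ⟨max G0 1, fun R' hR' G hG => ?_⟩
  have hR1 : 1 ≤ R' := (le_max_right _ _).trans hR'
  have hRG : G0 ≤ R' := (le_max_left _ _).trans hR'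
  have hGp : 0 ≤ G := by linarith
  set A := P.K1 * (1 + G) ^ 2 with hA
  have hA0 : 0 < A := by positivity
  have ht := taud_tendsto S hq hI G
  filter_upwards [ht.eventually_lt_const (show (0:ℝ) < ε / (2 * A) by positivity)] with M hM
  set T := hfD.tst R' hG with hT
  obtain ⟨b1, b2⟩ := box_eq hV.le hGp (taud_int S hq hI G M)
  have cI := Ic_cont S hGp T tauEta M
  have key : ∀ t ∈ Ioo 0 P.V, -Ic P T tauEta M p t ≤
      A * (∫ g in (0:ℝ)..G, -thd tauEta M (p t g)) + 4 * P.K1 * ε' := by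
    intro t ht
    have c0 := S.c0 t ht
    have ct := thd_cont tauEta M
    have cth : Continuous fun g => -thd tauEta M (p t g) := by fun_prop
    set ψ : ℝ → ℝ := (Ioc (R') (R' + 1)).indicator fun _ => 4 * P.K1 * ε' with hψ
    have iψ : IntervalIntegrable ψ volume 0 G := by
      rw [intervalIntegrable_iff]
      exact (integrableOn_const (by simp)).indicator measurableSet_Ioc
    have eψ : ∫ g in (0:ℝ)..G, ψ g = 4 * P.K1 * ε' := by
      rw [intervalIntegral.integral_of_le hGp, hψ, setIntegral_indicator measurableSet_Ioc,
        inter_eq_self_of_subset_right (Ioc_subset_Ioc (by linarith) hG.le)]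
      simp
    rw [← eψ, ← intervalIntegral.integral_const_mul, ← intervalIntegral.integral_add
      ((cth.intervalIntegrable _ _).const_mul A) iψ]
    unfold Ic
    rw [← intervalIntegral.integral_neg]
    refine intervalIntegral.integral_mono_ae_restrict hGp (Ac_eq S hGp T tauEta M t).1.neg
      (((cth.intervalIntegrable _ _).const_mul A).add iψ) ?_
    have hne : ∀ᵐ g ∂(volume.restrict (Icc 0 G)), g ≠ R' := by
      refine ae_restrict_of_ae ?_
      exact Measure.ae_ne volume R'
    filter_upwards [ae_restrict_mem measurableSet_Icc, hne] with g hg hgR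
    have hs := S.nonneg t g
    have t0 := thd_nonpos tauEta M hs
    have t1 : T.f g * P.cc g * (-thd tauEta M (p t g)) ≤ A * (-thd tauEta M (p t g)) := by
      refine mul_le_mul_of_nonneg_right ((hfD.tst_cc P hG hg.1).trans ?_) (by linarith)
      rw [hA]
      have := hg.1; have := hg.2
      gcongr
    have t2 : -(tht tauEta M (p t g) * T.Ls P g) ≤ ψ g := by
      by_cases hm : g ∈ Ioc R' (R' + 1)
      · rw [hψ, indicator_of_mem hm]
        have l1 := hfD.tst_Ls P hG hg.1
        have l2 := tau_le (M := M) hs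
        have l3 := tht_nonneg tauEta M hs
        have l4 := hG0 g (by linarith [hm.1]) t ht
        have l5 : tht tauEta M (p t g) * |T.Ls P g| ≤ p t g * (P.K1 * (1 + g) ^ 2) :=
          mul_le_mul l2 l1 (abs_nonneg _) hs
        have l6 : p t g * (P.K1 * (1 + g) ^ 2) ≤ p t g * (P.K1 * (4 * g ^ 2)) := by
          gcongr
          have : 1 ≤ g := by linarith [hm.1]
          nlinarith
        have l7 : p t g * (P.K1 * (4 * g ^ 2)) = 4 * P.K1 * (g ^ 2 * p t g) := by ring
        have l8 : 4 * P.K1 * (g ^ 2 * p t g) ≤ 4 * P.K1 * ε' := by gcongr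
        have l9 := mul_le_mul_of_nonneg_left (neg_abs_le (T.Ls P g)) l3
        linarith
      · rw [hψ, indicator_of_notMem hm]
        have : T.Ls P g = 0 := by
          refine hfD_Ls P hG hg.1 ?_
          by_contra hcon
          push Not at hcon
          exact hm ⟨lt_of_le_of_ne hcon.1 (Ne.symm hgR), hcon.2.le⟩
        rw [this]; simp
    linarith
  have hmono := intervalIntegral.integral_mono_on_of_le_Ioo hV.le (cI.neg.intervalIntegrable 0 P.V)
    ((b1.const_mul A).add (intervalIntegrable_const (c := 4 * P.K1 * ε'))) key
  have e1 : ee P T tauEta M p = ∫ t in (0:ℝ)..P.V, (-Ic P T tauEta M p t) := by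
    unfold ee; rw [intervalIntegral.integral_neg]
  rw [e1]
  refine hmono.trans ?_
  rw [intervalIntegral.integral_add (b1.const_mul A) intervalIntegrable_const,
    intervalIntegral.integral_const_mul, b2, intervalIntegral.integral_const]
  have h1 : A * (∫ x in Ioc 0 P.V ×ˢ Ioc 0 G, -thd tauEta M (p x.1 x.2)) ≤ ε / 2 := by
    have := mul_le_mul_of_nonneg_left hM.le hA0.le
    have e : A * (ε / (2 * A)) = ε / 2 := by field_simp
    linarith
  have h2 : (P.V - 0) • (4 * P.K1 * ε') = ε / 2 := by
    rw [hε', smul_eq_mul]; field_simp; norm_num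
  rw [h2]
  linarith
end

/-- flux functional with the limit nonlinearity -/
def Xb (P : Par) (h : HF) (R : ℝ) (H : Eta) (n : ℝ) (p : ℝ → ℝ → ℝ) (v : ℝ) : ℝ :=
  ∫ g in (0:ℝ)..(R + 1), P.J v g * (h.h g * chi0.f (g - R)) * (H.f1 n * p v g - tht H n (p v g))

lemma HF.c (h : HF) : Continuous h.h := continuous_iff_continuousAt.2 fun g => (h.d1 g).continuousAt

section
variable {P : Par} {p p1 p2 : ℝ → ℝ → ℝ}

lemma Xb_int (S : Sol P p p1 p2) (h : HF) (R : ℝ) (H : Eta) (n : ℝ) {v : ℝ}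
    (hv : v ∈ Ioo 0 P.V) :
    Continuous fun g => P.J v g * (h.h g * chi0.f (g - R)) * (H.f1 n * p v g - tht H n (p v g)) := by
  have c0 := S.c0 v hv
  have c1 := h.c
  have c2 := chi0.c
  have c3 := tht_cont H n
  unfold Par.J
  fun_prop

lemma Xb_eq (S : Sol P p p1 p2) (h : HF) {R G : ℝ} (hR : R + 1 < G) (hR0 : 0 < R) (H : Eta) (n M : ℝ)
    {v : ℝ} (hv : v ∈ Ioo 0 P.V) (hM : ∀ g ∈ Icc 0 G, p v g ≤ M - 1) :
    H.f1 n * Xf P (h.tst R hR) tauEta M p v - Xf P (h.tst R hR) H n p v = Xb P h R H n p v := by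
  have hG : 0 ≤ G := by linarith
  have hc := Xb_int S h R H n hv
  unfold Xf
  rw [← intervalIntegral.integral_const_mul, ← intervalIntegral.integral_sub
    ((Xf_eq S hG (h.tst R hR) tauEta M v).1.const_mul _) (Xf_eq S hG (h.tst R hR) H n v).1]
  rw [intervalIntegral.integral_congr (g := fun g => P.J v g * (h.h g * chi0.f (g - R)) *
    (H.f1 n * p v g - tht H n (p v g)))]
  · rw [← intervalIntegral.integral_add_adjacent_intervals (hc.intervalIntegrable 0 (R + 1))
      (hc.intervalIntegrable (R + 1) G)]
    unfold Xb
    rw [add_eq_left]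
    rw [intervalIntegral.integral_congr (g := fun _ => (0:ℝ))]
    · simp
    · intro g hg
      rw [uIcc_of_le hR.le] at hg
      simp only
      rw [(chi0_right (g - R) (by linarith [hg.1])).1]; ring
  · intro g hg
    rw [uIcc_of_le hG] at hg
    simp only
    rw [tau_eq (S.nonneg v g) (hM g hg)]
    show H.f1 n * (P.J v g * (h.h g * chi0.f (g - R)) * p v g) -
      P.J v g * (h.h g * chi0.f (g - R)) * tht H n (p v g) = _
    ring

set_option maxHeartbeats 1000000 in
lemma osc_beta (S : Sol P p p1 p2) (B : BC P p) (hk0 : P.k0 = 0) (hk1 : P.V < P.k1)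
    {q : ℝ} (hq : 1 < q) (hI : IntegrableOn (Fq P p q) (Ioc 0 P.V ×ˢ Ioi 0))
    (hdec : ∀ ε > 0, ∃ G0 : ℝ, ∀ g, G0 ≤ g → ∀ v ∈ Ioo 0 P.V, g ^ 2 * p v g < ε)
    (H : Eta) {n : ℝ} (hn : 0 ≤ n)
    (hH : ∀ s, 0 ≤ s → 0 ≤ H.f1 n * s - tht H n s ∧ H.f1 n * s - tht H n s ≤ s ^ q ∧
      -thd H n s ≤ (q - 1) * s ^ q) (h : HF) {R : ℝ} (hR0 : 0 < R) {v w : ℝ}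
    (hv : v ∈ Ioo 0 P.V) (hw : w ∈ Ioo 0 P.V) (hvw : v ≤ w) :
    |Xb P h R H n p w - Xb P h R H n p v| ≤
      2 * P.K1 * P.cw * q * ∫ x in Ioc 0 P.V ×ˢ Ioi 0, Fq P p q x := by
  have hK0 := K0_ge
  have hK1 := P.K1_pos
  set d := ∫ x in Ioc 0 P.V ×ˢ Ioi 0, Fq P p q x with hd
  refine le_of_forall_pos_le_add fun ε hε => ?_
  set C := 3 * K0 * (2 + R) with hC
  have hC0 : 0 ≤ C := by positivity
  set Λ := H.f1 n with hΛ
  have hΛ0 : 0 ≤ Λ := H.n1 n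
  set ε' := ε / (5 * C * Λ + 1) with hε'
  have hε0 : 0 < ε' := by positivity
  obtain ⟨R0, hR0'⟩ := ee_small S hq.le hI hdec hε0
  set R' := max R0 (max (R + 1) (P.gL * P.V / (P.k1 - P.V))) with hR'
  have r1 : R0 ≤ R' := le_max_left _ _
  have r2 : R + 1 ≤ R' := (le_max_left _ _).trans (le_max_right _ _)
  have r3 : P.gL * P.V / (P.k1 - P.V) ≤ R' := (le_max_right _ _).trans (le_max_right _ _)
  set G := R' + 2 with hG
  have hRG : R + 1 < G := by linarith
  have hRG' : R' + 1 < G := by linarith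
  have hG0 : 0 ≤ G := by linarith
  have hbd : ∀ t ∈ Ioo 0 P.V, ∃ A, ∀ g ∈ Icc 0 G, p t g ≤ A := fun t ht => by
    obtain ⟨A, hA⟩ := (isCompact_Icc (a := (0:ℝ)) (b := G)).bddAbove_image (S.c0 t ht).continuousOn
    exact ⟨A, fun g hg => hA ⟨g, hg, rfl⟩⟩
  obtain ⟨Av, hAv⟩ := hbd v hv
  obtain ⟨Aw, hAw⟩ := hbd w hw
  obtain ⟨M, hM, hMn, hMv, hMw⟩ := ((hR0' R' r1 hRG').and ((eventually_ge_atTop (n + 1)).and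
    ((eventually_ge_atTop (Av + 1)).and (eventually_ge_atTop (Aw + 1))))).exists
  obtain ⟨w1, w2⟩ := W_facts S hI hG0
  have hWb : ∀ t ∈ Ioo 0 P.V, Λ * Ic P (h.tst R hRG) tauEta M p t - Ic P (h.tst R hRG) H n p t ≤
      P.K1 * q * ∫ g in (0:ℝ)..G, (1 + g) ^ 2 * (p t g) ^ q := by
    intro t ht
    have c0 := S.c0 t ht
    have cp : Continuous fun g => (1 + g) ^ 2 * (p t g) ^ q := by
      have : Continuous fun g => (p t g) ^ q := c0.rpow_const fun g => Or.inr (by linarith)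
      fun_prop
    have i1 := (Ac_eq S hG0 (h.tst R hRG) tauEta M t).1
    have i2 := (Ac_eq S hG0 (h.tst R hRG) H n t).1
    unfold Ic
    rw [← intervalIntegral.integral_const_mul, ← intervalIntegral.integral_const_mul,
      ← intervalIntegral.integral_sub (i1.const_mul Λ) i2]
    refine intervalIntegral.integral_mono_on hG0 ((i1.const_mul Λ).sub i2)
      ((cp.intervalIntegrable _ _).const_mul _) fun g hg => ?_
    have hs := S.nonneg t g
    obtain ⟨b0, b1, b2⟩ := hH _ hs
    have t1 := thd_nonpos tauEta M hs
    have t2 := tau_le (M := M) hs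
    have t3 := tht_le_tau H hn (show n ≤ M - 1 by linarith) hs
    have hsq := Real.rpow_nonneg hs q
    have l1 := h.tst_cc P hRG hg.1
    have l2 := h.tst_Ls P hRG hg.1
    have l0 : 0 ≤ (h.tst R hRG).f g * P.cc g := by
      refine mul_nonneg ((h.tst R hRG).nonneg g) ?_
      have := P.hgL; have := P.hσ; have := hg.1
      unfold Par.cc; positivity
    have m1 : (h.tst R hRG).f g * P.cc g * (Λ * thd tauEta M (p t g) - thd H n (p t g)) ≤
        P.K1 * (1 + g) ^ 2 * ((q - 1) * (p t g) ^ q) := by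
      have a1 : Λ * thd tauEta M (p t g) - thd H n (p t g) ≤ (q - 1) * (p t g) ^ q := by
        have := mul_nonpos_of_nonneg_of_nonpos hΛ0 t1
        linarith
      have a2 : 0 ≤ (q - 1) * (p t g) ^ q := mul_nonneg (by linarith) hsq
      exact (mul_le_mul_of_nonneg_left a1 l0).trans (mul_le_mul_of_nonneg_right l1 a2)
    have m2 : (Λ * tht tauEta M (p t g) - tht H n (p t g)) * (h.tst R hRG).Ls P g ≤
        (p t g) ^ q * (P.K1 * (1 + g) ^ 2) := by
      have a1 : 0 ≤ Λ * tht tauEta M (p t g) - tht H n (p t g) := by linarith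
      have a2 : Λ * tht tauEta M (p t g) - tht H n (p t g) ≤ (p t g) ^ q := by
        have := mul_le_mul_of_nonneg_left t2 hΛ0
        linarith
      exact (mul_le_mul_of_nonneg_left ((le_abs_self _).trans l2) a1).trans
        (mul_le_mul_of_nonneg_right a2 (by positivity))
    linarith
  have hTT := h.tst_le hRG hRG' hR0 r2
  have hosc := osc_level S B hk0 hk1 (show P.gL * P.V / (P.k1 - P.V) + 2 ≤ G by linarith) hG0
    (hfD.tst R' hRG') (h.tst R hRG) (hfD_d0 hRG' (by linarith)).1 (hfD_d0 hRG' (by linarith)).2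
    hC0 hTT (h.tst_d0 hRG hR0) H tauEta n M hΛ0
    (fun s hs => tht_le_tau H hn (show n ≤ M - 1 by linarith) hs)
    (W := fun t => P.K1 * q * ∫ g in (0:ℝ)..G, (1 + g) ^ 2 * (p t g) ^ q) (w1.const_mul _)
    (fun t => mul_nonneg (by positivity) (intervalIntegral.integral_nonneg hG0 fun g _ =>
      mul_nonneg (sq_nonneg _) (Real.rpow_nonneg (S.nonneg _ _) _))) hWb hv.1.le hvw hw.2.le
  rw [Xb_eq S h hRG hR0 H n M hv (fun g hg => by linarith [hAv g hg]),
    Xb_eq S h hRG hR0 H n M hw (fun g hg => by linarith [hAw g hg]),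
    intervalIntegral.integral_const_mul] at hosc
  refine hosc.trans ?_
  have e1 : P.K1 * q * (∫ t in (0:ℝ)..P.V, ∫ g in (0:ℝ)..G, (1 + g) ^ 2 * (p t g) ^ q) ≤
      P.K1 * q * (P.cw * d) := mul_le_mul_of_nonneg_left w2 (by positivity)
  have e2 : 5 * C * Λ * ee P (hfD.tst R' hRG') tauEta M p ≤ 5 * C * Λ * ε' :=
    mul_le_mul_of_nonneg_left hM (by positivity)
  have e3 : 5 * C * Λ * ε' ≤ ε := by
    rw [hε', ← mul_div_assoc, div_le_iff₀ (by positivity)]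
    linarith
  linarith
end

/-- final constant -/
def Par.CF (P : Par) : ℝ :=
  (2 * P.k1 + P.V * (2 + P.gL)) * (2 * P.K1 * P.cw) + (P.k1 ^ 2 + P.V * P.k1) * K0 / P.V

section
variable {P : Par} {p p1 p2 : ℝ → ℝ → ℝ}

lemma I_facts (S : Sol P p p1 p2) {q : ℝ} (hI : IntegrableOn (Fq P p q) (Ioc 0 P.V ×ˢ Ioi 0))
    {G : ℝ} (hG : 0 ≤ G) :
    IntervalIntegrable (fun t => ∫ g in (0:ℝ)..G, Fq P p q (t, g)) volume 0 P.V ∧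
    ∫ t in (0:ℝ)..P.V, ∫ g in (0:ℝ)..G, Fq P p q (t, g) ≤
      ∫ x in Ioc 0 P.V ×ˢ Ioi 0, Fq P p q x := by
  have hsub : Ioc 0 P.V ×ˢ Ioc 0 G ⊆ Ioc 0 P.V ×ˢ Ioi (0:ℝ) :=
    prod_mono subset_rfl fun x hx => hx.1
  obtain ⟨b1, b2⟩ := box_eq P.hV.le hG (hI.mono_set hsub)
  refine ⟨b1, ?_⟩
  rw [b2]
  exact setIntegral_mono_set hI (Eventually.of_forall (Fq_nonneg S q)) hsub.eventuallyLE

lemma J_abs (hk0 : P.k0 = 0) (hk1 : P.V < P.k1) {v g : ℝ} (hv : v ∈ Ioo 0 P.V) (hg : 0 ≤ g) :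
    |P.J v g| ≤ P.k1 * (g + P.gL) := by
  have hV := P.hV; have hL := P.hgL
  have h1 : 0 ≤ (g + P.gL) * v := mul_nonneg (by linarith) hv.1.le
  have h2 : (g + P.gL) * v ≤ (g + P.gL) * P.k1 :=
    mul_le_mul_of_nonneg_left (by linarith [hv.2]) (by linarith)
  have h3 : 0 ≤ P.k1 * g := mul_nonneg (by linarith) hg
  have h4 : 0 ≤ P.k1 * P.gL := mul_nonneg (by linarith) hL.le
  unfold Par.J
  rw [hk0, abs_le]; constructor <;> linarith

/-- truncated quantity -/
def FF (P : Par) (R : ℝ) (H : Eta) (n : ℝ) (p : ℝ → ℝ → ℝ) (v : ℝ) : ℝ :=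
  ∫ g in (0:ℝ)..(R + 1), P.J v g ^ 2 * chi0.f (g - R) * (H.f1 n * p v g - tht H n (p v g))

def BB (P : Par) (R : ℝ) (H : Eta) (n : ℝ) (p : ℝ → ℝ → ℝ) (v : ℝ) : ℝ :=
  Xb P hfA R H n p v - Xb P hfB R H n p v + P.gL * Xb P hfC R H n p v

lemma FF_eq (S : Sol P p p1 p2) (hk0 : P.k0 = 0) (R : ℝ) (H : Eta) (n : ℝ) {v : ℝ}
    (hv : v ∈ Ioo 0 P.V) :
    FF P R H n p v = P.k1 * (Xb P hfA R H n p v - Xb P hfB R H n p v) - v * BB P R H n p v := by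
  have cA := (Xb_int S hfA R H n hv).intervalIntegrable (μ := volume) 0 (R + 1)
  have cB := (Xb_int S hfB R H n hv).intervalIntegrable (μ := volume) 0 (R + 1)
  have cC := (Xb_int S hfC R H n hv).intervalIntegrable (μ := volume) 0 (R + 1)
  have e : FF P R H n p v = (P.k1 - v) * (Xb P hfA R H n p v - Xb P hfB R H n p v)
      - v * P.gL * Xb P hfC R H n p v := by
    unfold FF Xb
    rw [← intervalIntegral.integral_sub cA cB, ← intervalIntegral.integral_const_mul,
      ← intervalIntegral.integral_const_mul, ← intervalIntegral.integral_sub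
      ((cA.sub cB).const_mul _) (cC.const_mul _)]
    congr 1
    funext g
    simp only [hfA, hfB, hfC, Par.J, hk0]
    ring
  rw [e]; unfold BB; ring

lemma FF_cont (S : Sol P p p1 p2) (R : ℝ) (H : Eta) (n : ℝ) {v : ℝ} (hv : v ∈ Ioo 0 P.V) :
    Continuous fun g => P.J v g ^ 2 * chi0.f (g - R) * (H.f1 n * p v g - tht H n (p v g)) := by
  have c0 := S.c0 v hv
  have c2 := chi0.c
  have c3 := tht_cont H n
  unfold Par.J
  fun_prop

lemma Fq_cont (S : Sol P p p1 p2) {q : ℝ} (hq : 1 < q) {v : ℝ} (hv : v ∈ Ioo 0 P.V) :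
    Continuous fun g => Fq P p q (v, g) := by
  have c0 := S.c0 v hv
  have : Continuous fun g => (p v g) ^ q := c0.rpow_const fun g => Or.inr (by linarith)
  unfold Fq
  fun_prop

lemma FF_abs (S : Sol P p p1 p2) (hk0 : P.k0 = 0) (hk1 : P.V < P.k1) {q : ℝ} (hq : 1 < q)
    {R : ℝ} (hR : 0 < R) (H : Eta) {n : ℝ}
    (hH : ∀ s, 0 ≤ s → 0 ≤ H.f1 n * s - tht H n s ∧ H.f1 n * s - tht H n s ≤ s ^ q ∧
      -thd H n s ≤ (q - 1) * s ^ q) {v : ℝ} (hv : v ∈ Ioo 0 P.V) :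
    FF P R H n p v ≤ P.k1 ^ 2 * K0 * (∫ g in (0:ℝ)..(R + 1), Fq P p q (v, g)) ∧
    |BB P R H n p v| ≤ P.k1 * K0 * (∫ g in (0:ℝ)..(R + 1), Fq P p q (v, g)) := by
  have hR1 : 0 ≤ R + 1 := by linarith
  have cF := Fq_cont S hq hv
  have hK := K0_ge
  have hV := P.hV; have hL := P.hgL
  have hk : 0 < P.k1 := by linarith
  constructor
  · rw [← intervalIntegral.integral_const_mul]
    refine intervalIntegral.integral_mono_on hR1 ((FF_cont S R H n hv).intervalIntegrable _ _)
      ((cF.intervalIntegrable _ _).const_mul _) fun g hg => ?_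
    obtain ⟨b0, b1, -⟩ := hH _ (S.nonneg v g)
    have j := J_abs hk0 hk1 hv hg.1
    have j2 : P.J v g ^ 2 ≤ (P.k1 * (g + P.gL)) ^ 2 := by
      rw [← sq_abs]; exact pow_le_pow_left₀ (abs_nonneg _) j 2
    have k := (K0_spec (g - R)).1
    have := chi0.nonneg (g - R)
    calc _ ≤ (P.k1 * (g + P.gL)) ^ 2 * K0 * (p v g) ^ q := by gcongr
      _ = _ := by unfold Fq; ring
  · have cA := (Xb_int S hfA R H n hv).intervalIntegrable (μ := volume) 0 (R + 1)
    have cB := (Xb_int S hfB R H n hv).intervalIntegrable (μ := volume) 0 (R + 1)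
    have cC := (Xb_int S hfC R H n hv).intervalIntegrable (μ := volume) 0 (R + 1)
    have e : BB P R H n p v = ∫ g in (0:ℝ)..(R + 1),
        P.J v g * ((g + P.gL) * chi0.f (g - R)) * (H.f1 n * p v g - tht H n (p v g)) := by
      unfold BB Xb
      rw [← intervalIntegral.integral_sub cA cB, ← intervalIntegral.integral_const_mul,
        ← intervalIntegral.integral_add (cA.sub cB) (cC.const_mul _)]
      congr 1
      funext g
      simp only [hfA, hfB, hfC]
      ring
    rw [e, ← intervalIntegral.integral_const_mul, ← Real.norm_eq_abs]
    refine intervalIntegral.norm_integral_le_of_norm_le hR1 ?_ ((cF.intervalIntegrable _ _).const_mul _)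
    refine Eventually.of_forall fun g hg => ?_
    obtain ⟨b0, b1, -⟩ := hH _ (S.nonneg v g)
    have j := J_abs hk0 hk1 hv hg.1.le
    have k := (K0_spec (g - R)).1
    have k' := chi0.nonneg (g - R)
    have hg0 : 0 < g + P.gL := by linarith [hg.1]
    rw [Real.norm_eq_abs, abs_mul, abs_mul, abs_of_nonneg b0,
      abs_of_nonneg (mul_nonneg hg0.le k')]
    calc _ ≤ (P.k1 * (g + P.gL)) * ((g + P.gL) * K0) * (p v g) ^ q := by gcongr
      _ = _ := by unfold Fq; ring

set_option maxHeartbeats 1000000 in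
lemma FF_bound (S : Sol P p p1 p2) (B : BC P p) (hk0 : P.k0 = 0) (hk1 : P.V < P.k1)
    {q : ℝ} (hq : 1 < q) (hI : IntegrableOn (Fq P p q) (Ioc 0 P.V ×ˢ Ioi 0))
    (hdec : ∀ ε > 0, ∃ G0 : ℝ, ∀ g, G0 ≤ g → ∀ v ∈ Ioo 0 P.V, g ^ 2 * p v g < ε)
    (H : Eta) {n : ℝ} (hn : 0 ≤ n)
    (hH : ∀ s, 0 ≤ s → 0 ≤ H.f1 n * s - tht H n s ∧ H.f1 n * s - tht H n s ≤ s ^ q ∧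
      -thd H n s ≤ (q - 1) * s ^ q) {R : ℝ} (hR0 : 0 < R) {v : ℝ} (hv : v ∈ Ioo 0 P.V) :
    FF P R H n p v ≤ P.CF * q * ∫ x in Ioc 0 P.V ×ˢ Ioi 0, Fq P p q x := by
  have hV := P.hV; have hL := P.hgL
  have hK := K0_ge
  have hk : 0 < P.k1 := by linarith
  set d := ∫ x in Ioc 0 P.V ×ˢ Ioi 0, Fq P p q x with hd
  have hd0 : 0 ≤ d := integral_nonneg (Fq_nonneg S q)
  set E := 2 * P.K1 * P.cw * q * d with hE
  have osc : ∀ (h : HF) w, w ∈ Ioo 0 P.V → |Xb P h R H n p v - Xb P h R H n p w| ≤ E := by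
    intro h w hw
    rcases le_total v w with hvw | hvw
    · rw [abs_sub_comm]; exact osc_beta S B hk0 hk1 hq hI hdec H hn hH h hR0 hv hw hvw
    · exact osc_beta S B hk0 hk1 hq hI hdec H hn hH h hR0 hw hv hvw
  have hE0 : 0 ≤ E := (abs_nonneg _).trans (osc hfA v hv)
  have key : ∀ w ∈ Ioo 0 P.V, FF P R H n p v ≤ (2 * P.k1 + P.V * (2 + P.gL)) * E +
      (P.k1 ^ 2 + P.V * P.k1) * K0 * ∫ g in (0:ℝ)..(R + 1), Fq P p q (w, g) := by
    intro w hw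
    obtain ⟨f1, f2⟩ := FF_abs S hk0 hk1 hq hR0 H hH hw
    have oA := abs_le.1 (osc hfA w hw)
    have oB := abs_le.1 (osc hfB w hw)
    have oC := abs_le.1 (osc hfC w hw)
    have ev := FF_eq S hk0 R H n hv
    have ew := FF_eq S hk0 R H n hw
    set DD := (Xb P hfA R H n p v - Xb P hfB R H n p v) -
      (Xb P hfA R H n p w - Xb P hfB R H n p w) with hDD
    have eB : BB P R H n p v - BB P R H n p w = DD +
        P.gL * (Xb P hfC R H n p v - Xb P hfC R H n p w) := by unfold BB; ring
    have s1 : P.k1 * DD ≤ P.k1 * (2 * E) := mul_le_mul_of_nonneg_left (by linarith) hk.le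
    have s2 : |BB P R H n p v - BB P R H n p w| ≤ (2 + P.gL) * E := by
      have a1 := mul_le_mul_of_nonneg_left oC.1 hL.le
      have a2 := mul_le_mul_of_nonneg_left oC.2 hL.le
      rw [eB, abs_le]
      constructor <;> linarith
    have s3 : -(v * (BB P R H n p v - BB P R H n p w)) ≤ P.V * ((2 + P.gL) * E) := by
      refine (neg_le_abs _).trans ?_
      rw [abs_mul, abs_of_pos hv.1]
      exact mul_le_mul hv.2.le s2 (abs_nonneg _) hV.le
    have s4 : -((v - w) * BB P R H n p w) ≤
        P.V * (P.k1 * K0 * ∫ g in (0:ℝ)..(R + 1), Fq P p q (w, g)) := by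
      refine (neg_le_abs _).trans ?_
      rw [abs_mul]
      refine mul_le_mul ?_ f2 (abs_nonneg _) hV.le
      rw [abs_le]; constructor <;> linarith [hv.1, hv.2, hw.1, hw.2]
    have e2 : FF P R H n p v = FF P R H n p w + P.k1 * DD -
        v * (BB P R H n p v - BB P R H n p w) - (v - w) * BB P R H n p w := by
      rw [ev, ew, hDD]; ring
    rw [e2]
    linarith
  obtain ⟨i1, i2⟩ := I_facts S hI (show 0 ≤ R + 1 by linarith)
  have hint := intervalIntegral.integral_mono_on_of_le_Ioo hV.le
    (intervalIntegrable_const (c := FF P R H n p v))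
    ((intervalIntegrable_const (c := (2 * P.k1 + P.V * (2 + P.gL)) * E)).add (i1.const_mul
      ((P.k1 ^ 2 + P.V * P.k1) * K0))) key
  rw [intervalIntegral.integral_add intervalIntegrable_const (i1.const_mul _),
    intervalIntegral.integral_const_mul ((P.k1 ^ 2 + P.V * P.k1) * K0),
    intervalIntegral.integral_const, intervalIntegral.integral_const, smul_eq_mul, smul_eq_mul, sub_zero] at hint
  have h2 := mul_le_mul_of_nonneg_left i2 (show 0 ≤ (P.k1 ^ 2 + P.V * P.k1) * K0 by positivity)
  have h3 : (P.k1 ^ 2 + P.V * P.k1) * K0 * d ≤ (P.k1 ^ 2 + P.V * P.k1) * K0 * (q * d) := by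
    gcongr
    nlinarith
  have h4 : P.V * (P.CF * q * d) = P.V * ((2 * P.k1 + P.V * (2 + P.gL)) * E) +
      (P.k1 ^ 2 + P.V * P.k1) * K0 * (q * d) := by
    unfold Par.CF
    rw [hE]; field_simp
  refine le_of_mul_le_mul_left ?_ hV
  rw [h4]
  linarith

set_option maxHeartbeats 1000000 in
lemma F_final (S : Sol P p p1 p2) (B : BC P p) (hk0 : P.k0 = 0) (hk1 : P.V < P.k1)
    {q : ℝ} (hq : 1 < q) (hI : IntegrableOn (Fq P p q) (Ioc 0 P.V ×ˢ Ioi 0))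
    (hdec : ∀ ε > 0, ∃ G0 : ℝ, ∀ g, G0 ≤ g → ∀ v ∈ Ioo 0 P.V, g ^ 2 * p v g < ε)
    {R : ℝ} (hR0 : 0 < R) {v : ℝ} (hv : v ∈ Ioo 0 P.V) :
    ∫ g in (0:ℝ)..R, P.J v g ^ 2 * (p v g) ^ q ≤
      P.CF * q * ∫ x in Ioc 0 P.V ×ˢ Ioi 0, Fq P p q x := by
  have c0 := S.c0 v hv
  obtain ⟨A, hA⟩ := (isCompact_Icc (a := (0:ℝ)) (b := R)).bddAbove_image c0.continuousOn
  have hA' : ∀ g ∈ Icc 0 R, p v g ≤ A := fun g hg => hA ⟨g, hg, rfl⟩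
  have hA0 : 0 ≤ A := (S.nonneg v 0).trans (hA' 0 ⟨le_rfl, hR0.le⟩)
  set Q := ∫ g in (0:ℝ)..R, P.J v g ^ 2 with hQ
  have cJ : Continuous fun g => P.J v g ^ 2 := by unfold Par.J; fun_prop
  have cp : Continuous fun g => P.J v g ^ 2 * (p v g) ^ q := by
    have : Continuous fun g => (p v g) ^ q := c0.rpow_const fun g => Or.inr (by linarith)
    fun_prop
  set D := P.CF * q * ∫ x in Ioc 0 P.V ×ˢ Ioi 0, Fq P p q x with hD
  have main : ∀ n : ℝ, A + 1 ≤ n → ∫ g in (0:ℝ)..R, P.J v g ^ 2 * (p v g) ^ q ≤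
      D + ((2 / n) ^ q + q * (2 / n) ^ (q - 1) * A) * Q := by
    intro n hn
    have hn1 : 1 ≤ n := by linarith
    have hn0 : 0 < n := by linarith
    obtain ⟨H, hH, hH2⟩ := exists_beta hq hn1
    have hF := FF_bound S B hk0 hk1 hq hI hdec H (by linarith) hH hR0 hv
    have cF := FF_cont S R H n hv
    have h1 : ∫ g in (0:ℝ)..R, P.J v g ^ 2 * (H.f1 n * p v g - tht H n (p v g)) ≤ FF P R H n p v := by
      unfold FF
      rw [← intervalIntegral.integral_add_adjacent_intervals (cF.intervalIntegrable 0 R)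
        (cF.intervalIntegrable R (R + 1))]
      have h2 : 0 ≤ ∫ g in R..(R + 1),
          P.J v g ^ 2 * chi0.f (g - R) * (H.f1 n * p v g - tht H n (p v g)) :=
        intervalIntegral.integral_nonneg (by linarith) fun g _ =>
          mul_nonneg (mul_nonneg (sq_nonneg _) (chi0.nonneg _)) (hH _ (S.nonneg v g)).1
      rw [intervalIntegral.integral_congr (a := 0) (b := R)
        (g := fun g => P.J v g ^ 2 * chi0.f (g - R) * (H.f1 n * p v g - tht H n (p v g)))]
      · linarith
      · intro g hg
        rw [uIcc_of_le hR0.le] at hg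
        simp only
        rw [chi0_spec.1 _ (by linarith [hg.2]), mul_one]
    have cb : Continuous fun g => P.J v g ^ 2 * (H.f1 n * p v g - tht H n (p v g)) := by
      have := tht_cont H n
      fun_prop
    set η := (2 / n) ^ q + q * (2 / n) ^ (q - 1) * A with hη
    have h3 : ∫ g in (0:ℝ)..R, P.J v g ^ 2 * (p v g) ^ q ≤
        ∫ g in (0:ℝ)..R, (P.J v g ^ 2 * (H.f1 n * p v g - tht H n (p v g)) + η * P.J v g ^ 2) := by
      refine intervalIntegral.integral_mono_on hR0.le (cp.intervalIntegrable _ _)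
        ((cb.intervalIntegrable _ _).add ((cJ.intervalIntegrable _ _).const_mul η)) fun g hg => ?_
      have h4 := hH2 _ (S.nonneg v g) (by linarith [hA' g hg])
      have h5 : q * (2 / n) ^ (q - 1) * p v g ≤ q * (2 / n) ^ (q - 1) * A := by
        have := Real.rpow_nonneg (show 0 ≤ 2 / n by positivity) (q - 1)
        have := hA' g hg
        gcongr
      have h6 := mul_le_mul_of_nonneg_left (h4.trans (add_le_add_right h5 _)) (sq_nonneg (P.J v g))
      linarith
    rw [intervalIntegral.integral_add (cb.intervalIntegrable _ _)
      ((cJ.intervalIntegrable _ _).const_mul η), intervalIntegral.integral_const_mul] at h3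
    linarith
  have t2 : Tendsto (fun n : ℝ => 2 / n) atTop (nhds 0) := tendsto_const_nhds.div_atTop tendsto_id
  have tq : ∀ r : ℝ, 0 < r → Tendsto (fun n : ℝ => (2 / n) ^ r) atTop (nhds 0) := fun r hr => by
    have := ((Real.continuous_rpow_const hr.le).tendsto 0).comp t2
    rw [Real.zero_rpow hr.ne'] at this
    exact this
  have tl : Tendsto (fun n : ℝ => D + ((2 / n) ^ q + q * (2 / n) ^ (q - 1) * A) * Q) atTop
      (nhds (D + (0 + q * 0 * A) * Q)) :=
    (((tq q (by linarith)).add (((tq (q - 1) (by linarith)).const_mul q).mul_const A)).mul_const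
      Q).const_add D
  have := ge_of_tendsto tl ((eventually_ge_atTop (A + 1)).mono main)
  simpa using this
end

/-- the parameter set of the theorem -/
def mkPar (VF VE gL gin a σE : ℝ) (hVF : 0 < VF) (hgL : 0 < gL) (hgin : 0 < gin)
    (ha : 0 < a) (hσE : 0 < σE) : Par where
  V := VF
  k1 := VE
  k0 := 0
  gL := gL
  gin := gin
  a := a
  σ := σE
  hV := hVF
  hgL := hgL
  hgin := hgin
  ha := ha
  hσ := hσE

/-- clamping of the voltage -/
def clp (VF v : ℝ) : ℝ := max 0 (min v VF)

lemma clp_mem {VF : ℝ} (h : 0 < VF) (v : ℝ) : clp VF v ∈ Icc 0 VF :=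
  ⟨le_max_left _ _, max_le h.le (min_le_right _ _)⟩

lemma clp_eq {VF v : ℝ} (h : v ∈ Icc 0 VF) : clp VF v = v := by
  unfold clp; rw [min_eq_left h.2, max_eq_right h.1]

lemma clp_cont (VF : ℝ) : Continuous (clp VF) := by unfold clp; fun_prop

/-- extension of the density to the plane -/
def pext (VF : ℝ) (p : ℝ → ℝ → ℝ) (v g : ℝ) : ℝ := p (clp VF v) (max g 0)
def pext1 (p : ℝ → ℝ → ℝ) (v g : ℝ) : ℝ := derivWithin (p v) (Ici 0) (max g 0)
def pext2 (p : ℝ → ℝ → ℝ) (v g : ℝ) : ℝ :=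
  derivWithin (derivWithin (p v) (Ici 0)) (Ici 0) (max g 0)

lemma pext_eq {VF v g : ℝ} (p : ℝ → ℝ → ℝ) (hv : v ∈ Icc 0 VF) (hg : 0 ≤ g) :
    pext VF p v g = p v g := by
  unfold pext; rw [clp_eq hv, max_eq_left hg]

lemma comp_max_cont {f : ℝ → ℝ} (hf : ContinuousOn f (Ici 0)) : Continuous fun g => f (max g 0) :=
  hf.comp_continuous (by fun_prop) fun g => Set.mem_Ici.2 (le_max_right _ _)

lemma comp_max_deriv {f : ℝ → ℝ} (hf : DifferentiableOn ℝ f (Ici 0)) {g : ℝ} (hg : 0 < g) :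
    HasDerivAt f (derivWithin f (Ici 0) g) g ∧
    HasDerivAt (fun g => f (max g 0)) (derivWithin f (Ici 0) (max g 0)) g := by
  have h1 : HasDerivAt f (derivWithin f (Ici 0) g) g :=
    (hf g hg.le).hasDerivWithinAt.hasDerivAt (Ici_mem_nhds hg)
  refine ⟨h1, ?_⟩
  rw [max_eq_left hg.le]
  refine h1.congr_of_eventuallyEq ?_
  filter_upwards [lt_mem_nhds hg] with y hy
  rw [max_eq_left hy.le]

section
variable {VF VE gL gin a σE : ℝ} {p : ℝ → ℝ → ℝ}

lemma sm_facts (St : StatSol VF VE gL gin a σE p) {v : ℝ} (hv : v ∈ Ioo 0 VF) :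
    DifferentiableOn ℝ (p v) (Ici 0) ∧ DifferentiableOn ℝ (derivWithin (p v) (Ici 0)) (Ici 0) ∧
    ContinuousOn (derivWithin (derivWithin (p v) (Ici 0)) (Ici 0)) (Ici 0) := by
  have h := St.smooth_g v hv
  have h2 : ContDiffOn ℝ ((1:WithTop ℕ∞) + 1) (p v) (Ici 0) := by
    rw [one_add_one_eq_two]; exact h
  obtain ⟨a1, -, a2⟩ := (contDiffOn_succ_iff_derivWithin (uniqueDiffOn_Ici 0)).1 h2
  have a3 : ContDiffOn ℝ ((0:WithTop ℕ∞) + 1) (derivWithin (p v) (Ici 0)) (Ici 0) := by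
    rw [zero_add]; exact a2
  obtain ⟨b1, -, b2⟩ := (contDiffOn_succ_iff_derivWithin (uniqueDiffOn_Ici 0)).1 a3
  exact ⟨a1, b1, b2.continuousOn⟩

lemma nonneg_cl (St : StatSol VF VE gL gin a σE p) (hVF : 0 < VF) {v g : ℝ} (hv : v ∈ Icc 0 VF)
    (hg : 0 ≤ g) : 0 ≤ p v g := by
  have hc : closure (Ioo 0 VF) = Icc 0 VF := closure_Ioo hVF.ne
  refine le_on_closure (s := Ioo 0 VF) (f := fun _ => (0:ℝ)) (g := fun v => p v g)
    (fun x hx => St.nonneg x hx g hg) continuousOn_const ?_ ?_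
  · rw [hc]; exact St.cont_v g hg
  · rw [hc]; exact hv

lemma pext_contv (St : StatSol VF VE gL gin a σE p) (hVF : 0 < VF) (g : ℝ) :
    Continuous fun v => pext VF p v g :=
  (St.cont_v (max g 0) (Set.mem_Ici.2 (le_max_right _ _))).comp_continuous (clp_cont VF) (clp_mem hVF)

lemma pext_c0 (St : StatSol VF VE gL gin a σE p) {v : ℝ} (hv : v ∈ Ioo 0 VF) :
    Continuous (pext VF p v) := by
  unfold pext
  rw [clp_eq ⟨hv.1.le, hv.2.le⟩]
  exact comp_max_cont (sm_facts St hv).1.continuousOn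

lemma pext_meas (St : StatSol VF VE gL gin a σE p) (hVF : 0 < VF) :
    Measurable fun x : ℝ × ℝ => pext VF p x.1 x.2 := by
  refine measurable_uncurry_of_continuous_of_measurable (pext_contv St hVF) fun v => ?_
  have hc := clp_mem hVF v
  have e : pext VF p v = pext VF p (clp VF v) := by
    funext g; unfold pext; rw [clp_eq hc]
  rw [e]
  set c := clp VF v
  have tl : Tendsto (fun n : ℕ => c + (VF / 2 - c) * (1 / ((n:ℝ) + 1))) atTop
      (nhds (c + (VF / 2 - c) * 0)) :=
    (tendsto_one_div_add_atTop_nhds_zero_nat.const_mul _).const_add _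
  rw [mul_zero, add_zero] at tl
  refine measurable_of_tendsto_metrizable
    (f := fun n : ℕ => pext VF p (c + (VF / 2 - c) * (1 / ((n:ℝ) + 1)))) (fun n => ?_) ?_
  · refine (pext_c0 St ?_).measurable
    have h0 : 0 < 1 / ((n:ℝ) + 1) := by positivity
    have h1 : 1 / ((n:ℝ) + 1) ≤ 1 := by
      rw [div_le_one (by positivity)]
      have : (0:ℝ) ≤ n := Nat.cast_nonneg n
      linarith
    set r := 1 / ((n:ℝ) + 1)
    have e1 : c + (VF / 2 - c) * r = (1 - r) * c + r * (VF / 2) := by ring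
    have m1 : 0 ≤ (1 - r) * c := mul_nonneg (by linarith) hc.1
    have m2 : (1 - r) * c ≤ (1 - r) * VF := mul_le_mul_of_nonneg_left hc.2 (by linarith)
    have m3 : 0 < r * (VF / 2) := by positivity
    rw [e1]
    constructor <;> linarith
  · rw [tendsto_pi_nhds]
    intro g
    exact ((pext_contv St hVF g).tendsto c).comp tl

lemma mkSol (hVF : 0 < VF) (hgL : 0 < gL) (hgin : 0 < gin)
    (ha : 0 < a) (hσE : 0 < σE) (St : StatSol VF VE gL gin a σE p)
    (hpos : ∀ v ∈ Ioo 0 VF, ∀ g ∈ Ici (0:ℝ), 0 < p v g) :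
    Sol (mkPar VF VE gL gin a σE hVF hgL hgin ha hσE) (pext VF p) (pext1 p) (pext2 p) where
  nonneg := fun v g => nonneg_cl St hVF (clp_mem hVF v) (le_max_right _ _)
  contv := pext_contv St hVF
  meas := pext_meas St hVF
  c0 := fun v hv => pext_c0 St hv
  c1 := fun v hv => comp_max_cont (sm_facts St hv).2.1.continuousOn
  c2 := fun v hv => comp_max_cont (sm_facts St hv).2.2
  d1 := fun v hv g hg => by
    have hv : v ∈ Ioo 0 VF := hv
    have := (comp_max_deriv (sm_facts St hv).1 hg).2
    unfold pext
    rw [clp_eq ⟨hv.1.le, hv.2.le⟩]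
    exact this
  d2 := fun v hv g hg => (comp_max_deriv (sm_facts St hv).2.1 hg).2
  robin := fun v hv => by
    have hv : v ∈ Ioo 0 VF := hv
    have h := St.bc_g v hv
    have hp := hpos v hv 0 (Set.mem_Ici.2 le_rfl)
    show a * derivWithin (p v) (Ici 0) (max 0 0) = gin * p (clp VF v) (max 0 0)
    rw [max_self, clp_eq ⟨hv.1.le, hv.2.le⟩]
    by_cases hd : DifferentiableAt ℝ (p v) 0
    · have e : derivWithin (p v) (Ici 0) 0 = deriv (fun g' => p v g') 0 :=
        hd.derivWithin (uniqueDiffOn_Ici (0:ℝ) 0 (Set.mem_Ici.2 le_rfl))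
      rw [e]; linarith
    · have e : deriv (fun g' => p v g') 0 = 0 := deriv_zero_of_not_differentiableAt hd
      rw [e] at h
      have := mul_pos hgin hp
      linarith
  pde := fun v hv g hg => by
    have hv : v ∈ Ioo 0 VF := hv
    have hg0 : (0:ℝ) < g := hg
    obtain ⟨s1, s2, s3⟩ := sm_facts St hv
    have dv := (St.diff_v v hv g hg).hasDerivAt
    set d := deriv (fun v' => p v' g) v with hd
    refine ⟨d, ?_, ?_⟩
    · refine dv.congr_of_eventuallyEq ?_
      filter_upwards [Ioo_mem_nhds hv.1 hv.2] with t ht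
      exact pext_eq p ⟨ht.1.le, ht.2.le⟩ hg0.le
    · have h := St.pde v hv g hg
      have e1 : deriv (fun v' => Jflux VE gL v' g * p v' g) v =
          (-gL - g) * p v g + Jflux VE gL v g * d := by
        have dJ : HasDerivAt (fun v' => Jflux VE gL v' g) (-gL - g) v := by
          have := ((hasDerivAt_id v).const_mul (-gL)).add
            (((hasDerivAt_id v).const_sub VE).const_mul g)
          unfold Jflux
          refine HasDerivAt.congr_deriv this ?_
          ring
        exact (dJ.mul dv).deriv
      have q1 := (comp_max_deriv s1 hg0).1
      have q2 := (comp_max_deriv s2 hg0).1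
      have e2 : deriv (fun g' => ((gin - g') / σE) * p v g') g =
          (-1 / σE) * p v g + (gin - g) / σE * derivWithin (p v) (Ici 0) g := by
        have dl : HasDerivAt (fun g' => (gin - g') / σE) (-1 / σE) g :=
          ((hasDerivAt_id g).const_sub gin).div_const σE
        exact (dl.mul q1).deriv
      have e3 : deriv (deriv (fun g' => p v g')) g =
          derivWithin (derivWithin (p v) (Ici 0)) (Ici 0) g := by
        have : deriv (fun g' => p v g') =ᶠ[nhds g] derivWithin (p v) (Ici 0) := by
          filter_upwards [lt_mem_nhds hg0] with y hy
          exact (comp_max_deriv s1 hy).1.deriv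
        rw [this.deriv_eq, q2.deriv]
      rw [e1, e2, e3] at h
      rw [pext_eq p ⟨hv.1.le, hv.2.le⟩ hg0.le]
      have e4 : pext1 p v g = derivWithin (p v) (Ici 0) g := by
        unfold pext1; rw [max_eq_left hg0.le]
      have e5 : pext2 p v g = derivWithin (derivWithin (p v) (Ici 0)) (Ici 0) g := by
        unfold pext2; rw [max_eq_left hg0.le]
      rw [e4, e5]
      simp only [Par.J, Par.Lop, mkPar]
      unfold Jflux at h
      field_simp at h ⊢
      linarith

lemma mkBC (hVF : 0 < VF) (hVE : VF < VE) (hgL : 0 < gL) (hgin : 0 < gin)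
    (ha : 0 < a) (hσE : 0 < σE) (St : StatSol VF VE gL gin a σE p) :
    BC (mkPar VF VE gL gin a σE hVF hgL hgin ha hσE) (pext VF p) where
  low := fun g hg hg2 => by
    have hg2' : g < gL * VF / (VE - VF) := hg2
    obtain ⟨h1, h2⟩ := St.bc_v_low g ⟨hg, hg2'⟩
    show pext VF p 0 g = 0 ∧ pext VF p VF g = 0
    rw [pext_eq p ⟨le_rfl, hVF.le⟩ hg.le, pext_eq p ⟨hVF.le, le_rfl⟩ hg.le]
    constructor
    · refine (mul_eq_zero.1 h1).resolve_left ?_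
      unfold Jflux
      have : 0 < g * VE := mul_pos hg (by linarith)
      intro h; linarith
    · refine (mul_eq_zero.1 h2).resolve_left ?_
      rw [lt_div_iff₀ (by linarith)] at hg2'
      unfold Jflux
      intro h; linarith
  high := fun g hg => by
    have hg' : gL * VF / (VE - VF) ≤ g := hg
    have h := St.bc_v_high g hg'
    have hg0 : 0 ≤ g := le_trans (div_nonneg (by positivity) (by linarith)) hg'
    show Par.J _ 0 g * pext VF p 0 g = Par.J _ VF g * pext VF p VF g
    rw [pext_eq p ⟨le_rfl, hVF.le⟩ hg0, pext_eq p ⟨hVF.le, le_rfl⟩ hg0]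
    simp only [Par.J, mkPar]
    unfold Jflux at h
    linarith
end

/-- uniform-in-`v` bound `sup_v ∫ J² p^q dg ≤ C q d_q`,
with `C` independent of `q`. -/
theorem stmt11 (VF VE gL gin a σE : ℝ)
    (hVF : 0 < VF) (hVE : VF < VE) (hgL : 0 < gL) (hgin : 0 < gin)
    (ha : 0 < a) (hσE : 0 < σE) :
    ∃ C : ℝ, ∀ (p : ℝ → ℝ → ℝ), StatSol VF VE gL gin a σE p →
      (∀ v ∈ Ioo 0 VF, ∀ g ∈ Ici (0:ℝ), 0 < p v g) →
      ∀ q : ℝ, 4 / 3 ≤ q →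
      (∫⁻ x in (Ioo (0:ℝ) VF) ×ˢ (Ioi (0:ℝ)),
        ENNReal.ofReal ((x.2 + gL) ^ 2 * (p x.1 x.2) ^ q) < ⊤) →
      (∀ ε > 0, ∃ G : ℝ, ∀ g ∈ Ici G, ∀ v ∈ Ioo 0 VF,
        (p v g) ^ q < ε ∧ g ^ 2 * (p v g) ^ q < ε ∧
          |deriv (fun g' => (p v g') ^ q) g| < ε) →
      ∀ v ∈ Ioo 0 VF,
        (∫⁻ g in Ioi (0:ℝ), ENNReal.ofReal ((Jflux VE gL v g) ^ 2 * (p v g) ^ q)) ≤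
          ENNReal.ofReal (C * q) *
            ∫⁻ x in (Ioo (0:ℝ) VF) ×ˢ (Ioi (0:ℝ)),
              ENNReal.ofReal ((x.2 + gL) ^ 2 * (p x.1 x.2) ^ q) := by
  set P := mkPar VF VE gL gin a σE hVF hgL hgin ha hσE with hP
  refine ⟨P.CF, fun p St hpos q hq hfin _ v hv => ?_⟩
  have S : Sol P (pext VF p) (pext1 p) (pext2 p) := mkSol hVF hgL hgin ha hσE St hpos
  have B : BC P (pext VF p) := mkBC hVF hVE hgL hgin ha hσE St
  have hq1 : 1 < q := by linarith
  have hms : MeasurableSet (Ioo (0:ℝ) VF ×ˢ Ioi (0:ℝ)) := measurableSet_Ioo.prod measurableSet_Ioi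
  have hres : (volume : Measure (ℝ × ℝ)).restrict (Ioo (0:ℝ) VF ×ˢ Ioi (0:ℝ)) =
      volume.restrict (Ioc (0:ℝ) VF ×ˢ Ioi (0:ℝ)) := by
    rw [Measure.volume_eq_prod, ← Measure.prod_restrict, ← Measure.prod_restrict,
      Measure.restrict_congr_set Ioo_ae_eq_Ioc]
  have hmF : Measurable (Fq P (pext VF p) q) := by
    have := pq_meas S q
    unfold Fq
    fun_prop
  have hL : ∫⁻ x in (Ioo (0:ℝ) VF) ×ˢ (Ioi (0:ℝ)), ENNReal.ofReal ((x.2 + gL) ^ 2 * (p x.1 x.2) ^ q)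
      = ∫⁻ x in (Ioc (0:ℝ) VF) ×ˢ (Ioi (0:ℝ)), ENNReal.ofReal (Fq P (pext VF p) q x) := by
    rw [← hres]
    refine setLIntegral_congr_fun hms fun x hx => ?_
    have hx1 : x.1 ∈ Ioo 0 VF := hx.1
    have hx2 : (0:ℝ) < x.2 := hx.2
    simp only [Fq]
    rw [pext_eq p ⟨hx1.1.le, hx1.2.le⟩ hx2.le]
    rfl
  rw [hL] at hfin ⊢
  have hI : IntegrableOn (Fq P (pext VF p) q) (Ioc 0 P.V ×ˢ Ioi 0) := by
    refine ⟨hmF.aestronglyMeasurable, ?_⟩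
    rw [hasFiniteIntegral_iff_ofReal (Eventually.of_forall (Fq_nonneg S q))]
    exact hfin
  have hdec : ∀ ε > 0, ∃ G0 : ℝ, ∀ g, G0 ≤ g → ∀ v ∈ Ioo 0 P.V, g ^ 2 * pext VF p v g < ε := by
    intro ε hε
    obtain ⟨G, hG⟩ := St.decay ε hε
    refine ⟨max G 0, fun g hg v hv => ?_⟩
    have hv' : v ∈ Ioo 0 VF := hv
    rw [pext_eq p ⟨hv'.1.le, hv'.2.le⟩ ((le_max_right _ _).trans hg)]
    exact (hG g ((le_max_left _ _).trans hg) v hv').2.1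
  have hint : ∫⁻ x in (Ioc (0:ℝ) VF) ×ˢ (Ioi (0:ℝ)), ENNReal.ofReal (Fq P (pext VF p) q x) =
      ENNReal.ofReal (∫ x in Ioc 0 P.V ×ˢ Ioi 0, Fq P (pext VF p) q x) :=
    (ofReal_integral_eq_lintegral_ofReal hI (Eventually.of_forall (Fq_nonneg S q))).symm
  rw [hint]
  have hd0 : 0 ≤ ∫ x in Ioc 0 P.V ×ˢ Ioi 0, Fq P (pext VF p) q x := integral_nonneg (Fq_nonneg S q)
  rw [← ENNReal.ofReal_mul' hd0]
  have hU : Ioi (0:ℝ) = ⋃ n : ℕ, Ioc (0:ℝ) ((n:ℝ) + 1) := by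
    ext x
    simp only [mem_Ioi, mem_iUnion, mem_Ioc]
    constructor
    · intro hx
      obtain ⟨n, hn⟩ := exists_nat_ge x
      exact ⟨n, hx, by linarith⟩
    · rintro ⟨n, h, -⟩; exact h
  generalize hD : P.CF * q * (∫ x in Ioc 0 P.V ×ˢ Ioi 0, Fq P (pext VF p) q x) = D
  rw [hU, setLIntegral_iUnion_of_directed]
  · refine iSup_le fun n => ?_
    have hn : (0:ℝ) < (n:ℝ) + 1 := by positivity
    have hF := F_final S B rfl hVE hq1 hI hdec hn hv
    have cJ : Continuous fun g => P.J v g ^ 2 * (pext VF p v g) ^ q := by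
      have : Continuous fun g => (pext VF p v g) ^ q :=
        (S.c0 v hv).rpow_const fun g => Or.inr (by linarith)
      unfold Par.J
      fun_prop
    have hnn : ∀ g, 0 ≤ P.J v g ^ 2 * (pext VF p v g) ^ q := fun g =>
      mul_nonneg (sq_nonneg _) (Real.rpow_nonneg (S.nonneg _ _) _)
    have e : ∫⁻ g in Ioc (0:ℝ) ((n:ℝ) + 1), ENNReal.ofReal ((Jflux VE gL v g) ^ 2 * (p v g) ^ q) =
        ∫⁻ g in Ioc (0:ℝ) ((n:ℝ) + 1), ENNReal.ofReal (P.J v g ^ 2 * (pext VF p v g) ^ q) := by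
      refine setLIntegral_congr_fun measurableSet_Ioc fun g hg => ?_
      have hJ : P.J v g = Jflux VE gL v g := by
        simp only [hP, Par.J, mkPar, Jflux]; ring
      rw [hJ, pext_eq p ⟨hv.1.le, hv.2.le⟩ hg.1.le]
    rw [e, ← ofReal_integral_eq_lintegral_ofReal (cJ.integrableOn_Ioc) (Eventually.of_forall hnn)]
    rw [intervalIntegral.integral_of_le hn.le] at hF
    rw [← hD]
    exact ENNReal.ofReal_le_ofReal hF
  · refine directed_of_isDirected_le fun m n hmn => ?_
    have : (m:ℝ) ≤ n := by exact_mod_cast hmn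
    exact Ioc_subset_Ioc le_rfl (by linarith)
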